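/- arXiv:2112.00630 — 3 statements merged into one kernel-verified Lean document; each statement's English description precedes it below -/
import Mathlib

section
/- Fix 0 < p ≤ 2 and let ℝ_∞ be the free product of countably many copies of the additive group ℝ. Let φ : ℝ_∞ → ℝ be a function radial with respect to ‖·‖_p^p (i.e., φ(r) depends only on ‖r‖_p^p) with φ(e) = 1. Then φ is positive definite on ℝ_∞ if and only if there exist a finite positive Borel (Radon) measure μ on [0, ∞) and a constant b ≥ 0 such that φ(r) = ∫_0^∞ e^{−t ‖r‖_p^p} dμ(t) + b·χ_{{e}}(r) for all r ∈ ℝ_∞, where χ_{{e}} is the indicator function of the identity; moreover, when such a pair exists, μ is uniquely determined by φ. -/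
open ComplexOrder

/-- The `p`-th power ℓ^p length on the free product of copies of the additive group `ℝ`:
for a normal form `r = x₁ ⋯ x_n` (each `x_j` a nonzero real in one copy, consecutive
copies distinct), `‖r‖_p^p = ∑ j |x_j|^p`. -/
noncomputable def lppFree {ι : Type*} [DecidableEq ι] (p : ℝ)
    (g : Monoid.CoprodI (fun _ : ι => Multiplicative ℝ)) : ℝ :=
  ((Monoid.CoprodI.Word.equiv g).toList.map
    (fun l => |Multiplicative.toAdd l.2| ^ p)).sum

/-- A real-valued function on a group is positive definite. -/
def IsPositiveDefinite {G : Type*} [Group G] (φ : G → ℝ) : Prop :=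
  ∀ (n : ℕ) (x : Fin n → G) (c : Fin n → ℂ),
    0 ≤ ∑ j, ∑ k, c j * (starRingEnd ℂ) (c k) * (φ ((x j)⁻¹ * x k) : ℂ)

open MeasureTheory


def PSDK {X : Type*} (K : X → X → ℝ) : Prop :=
  (∀ x y, K x y = K y x) ∧
    ∀ (n : ℕ) (x : Fin n → X) (c : Fin n → ℝ), 0 ≤ ∑ j, ∑ k, c j * c k * K (x j) (x k)

namespace PSDK
variable {X Y : Type*} {K L : X → X → ℝ}

lemma matrix (hK : PSDK K) {n : ℕ} (x : Fin n → X) :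
    (Matrix.of fun j k => K (x j) (x k)).PosSemidef := by
  refine Matrix.PosSemidef.of_dotProduct_mulVec_nonneg ?_ ?_
  · ext j k
    simp [Matrix.conjTranspose_apply, hK.1 (x k) (x j)]
  · intro c
    refine (hK.2 n x c).trans_eq ?_
    simp only [dotProduct, Matrix.mulVec, Finset.mul_sum, Matrix.of_apply, star_trivial]
    refine Finset.sum_congr rfl fun j _ => Finset.sum_congr rfl fun k _ => by ring

lemma of_matrix (h : ∀ (n : ℕ) (x : Fin n → X), (Matrix.of fun j k => K (x j) (x k)).PosSemidef) :
    PSDK K := by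
  constructor
  · intro x y
    have := (h 2 ![x, y]).1
    have := congrFun (congrFun this 1) 0
    simpa [Matrix.conjTranspose_apply] using this
  · intro n x c
    refine ((h n x).dotProduct_mulVec_nonneg c).trans_eq ?_
    simp only [dotProduct, Matrix.mulVec, Finset.mul_sum, Matrix.of_apply, star_trivial]
    refine Finset.sum_congr rfl fun j _ => Finset.sum_congr rfl fun k _ => by ring

lemma mul (hK : PSDK K) (hL : PSDK L) : PSDK (fun x y => K x y * L x y) :=
  of_matrix fun _ x => (hK.matrix x).hadamard (hL.matrix x)

lemma comp (hK : PSDK K) (f : Y → X) : PSDK (fun x y => K (f x) (f y)) :=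
  ⟨fun _ _ => hK.1 _ _, fun n x c => hK.2 n (fun i => f (x i)) c⟩

lemma add (hK : PSDK K) (hL : PSDK L) : PSDK (fun x y => K x y + L x y) := by
  refine ⟨fun x y => by dsimp only; rw [hK.1, hL.1], fun n x c => ?_⟩
  simp only [mul_add, Finset.sum_add_distrib]
  exact add_nonneg (hK.2 n x c) (hL.2 n x c)

lemma rankOne (f : X → ℝ) : PSDK (fun x y => f x * f y) := by
  refine ⟨fun x y => mul_comm _ _, fun n x c => ?_⟩
  have : ∑ j, ∑ k, c j * c k * (f (x j) * f (x k)) = (∑ j, c j * f (x j)) ^ 2 := by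
    rw [sq, Finset.sum_mul_sum]
    refine Finset.sum_congr rfl fun j _ => Finset.sum_congr rfl fun k _ => by ring
  rw [this]; positivity

lemma const {a : ℝ} (ha : 0 ≤ a) : PSDK (fun _ _ : X => a) := by
  convert rankOne (fun _ : X => Real.sqrt a) using 3
  exact (Real.mul_self_sqrt ha).symm

lemma smul {a : ℝ} (ha : 0 ≤ a) (hK : PSDK K) : PSDK (fun x y => a * K x y) :=
  (const ha).mul hK

lemma prod {ι : Type*} (s : Finset ι) (F : ι → X → X → ℝ) (hF : ∀ i ∈ s, PSDK (F i)) :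
    PSDK (fun x y => ∏ i ∈ s, F i x y) := by
  classical
  induction s using Finset.induction_on with
  | empty => simpa using const (X := X) zero_le_one
  | insert a s ha ih =>
    simp only [Finset.prod_insert ha]
    exact (hF a (by simp)).mul (ih fun i hi => hF i (by simp [hi]))

lemma sum {ι : Type*} (s : Finset ι) (F : ι → X → X → ℝ) (hF : ∀ i ∈ s, PSDK (F i)) :
    PSDK (fun x y => ∑ i ∈ s, F i x y) := by
  classical
  induction s using Finset.induction_on with
  | empty => simpa using const (X := X) le_rfl
  | insert a s ha ih =>
    simp only [Finset.sum_insert ha]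
    exact (hF a (by simp)).add (ih fun i hi => hF i (by simp [hi]))

lemma pow (hK : PSDK K) (m : ℕ) : PSDK (fun x y => K x y ^ m) := by
  induction m with
  | zero => simpa using const (X := X) zero_le_one
  | succ m ih => simp only [pow_succ]; exact ih.mul hK

lemma lim {F : ℕ → X → X → ℝ} (hF : ∀ n, PSDK (F n))
    (h : ∀ x y, Filter.Tendsto (fun n => F n x y) Filter.atTop (nhds (K x y))) : PSDK K := by
  refine ⟨fun x y => tendsto_nhds_unique (h x y) ?_, fun n x c => ?_⟩
  · simpa only [(hF _).1 x y] using h y x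
  · refine ge_of_tendsto' (tendsto_finsetSum _ fun j _ => tendsto_finsetSum _ fun k _ =>
      (h (x j) (x k)).const_mul (c j * c k)) fun m => (hF m).2 n x c

lemma exp (hK : PSDK K) : PSDK (fun x y => Real.exp (K x y)) := by
  refine lim (F := fun n x y => ∑ m ∈ Finset.range n, ((m.factorial : ℝ))⁻¹ * K x y ^ m)
    (fun n => sum _ _ fun m _ => smul (by positivity) (hK.pow m)) fun x y => ?_
  have := (NormedSpace.expSeries_div_hasSum_exp (K x y)).tendsto_sum_nat
  rw [← Real.exp_eq_exp_ℝ] at this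
  simpa [div_eq_inv_mul] using this

lemma integral {Ω : Type*} [MeasurableSpace Ω] (μ : Measure Ω) (F : Ω → X → X → ℝ)
    (hF : ∀ᵐ t ∂μ, PSDK (F t)) (hi : ∀ x y, Integrable (fun t => F t x y) μ) :
    PSDK (fun x y => ∫ t, F t x y ∂μ) := by
  refine ⟨fun x y => integral_congr_ae (hF.mono fun t ht => ht.1 x y), fun n x c => ?_⟩
  have : ∑ j, ∑ k, c j * c k * ∫ t, F t (x j) (x k) ∂μ
      = ∫ t, ∑ j, ∑ k, c j * c k * F t (x j) (x k) ∂μ := by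
    rw [integral_finsetSum _ fun j _ => integrable_finsetSum _ fun k _ => (hi _ _).const_mul _]
    refine Finset.sum_congr rfl fun j _ => ?_
    rw [integral_finsetSum _ fun k _ => (hi _ _).const_mul _]
    refine Finset.sum_congr rfl fun k _ => (integral_const_mul _ _).symm
  rw [this]
  exact integral_nonneg_of_ae (hF.mono fun t ht => ht.2 n x c)

lemma delta [DecidableEq X] : PSDK (fun x y : X => if x = y then (1:ℝ) else 0) := by
  refine ⟨fun x y => by simp [eq_comm], fun n x c => ?_⟩
  have : ∑ j, ∑ k, c j * c k * (if x j = x k then (1:ℝ) else 0)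
      = ∑ z ∈ Finset.univ.image x, (∑ j, if x j = z then c j else (0:ℝ)) ^ 2 := by
    simp only [sq, Finset.sum_mul_sum]
    symm
    rw [Finset.sum_comm]
    refine Finset.sum_congr rfl fun j _ => ?_
    rw [Finset.sum_comm]
    refine Finset.sum_congr rfl fun k _ => ?_
    rw [Finset.sum_eq_single (x j)]
    · by_cases h : x j = x k
      · simp [h]
      · simp [h, Ne.symm h]
    · intro b _ hb; simp [Ne.symm hb]
    · intro h; exact absurd (Finset.mem_image_of_mem x (Finset.mem_univ j)) h
  rw [this]; positivity

/-- from real kernels to the complex definition -/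
lemma complex (hK : PSDK K) (n : ℕ) (x : Fin n → X) (c : Fin n → ℂ) :
    0 ≤ ∑ j, ∑ k, c j * (starRingEnd ℂ) (c k) * (K (x j) (x k) : ℂ) := by
  rw [Complex.nonneg_iff]
  constructor
  · have h1 := hK.2 n x (fun j => (c j).re)
    have h2 := hK.2 n x (fun j => (c j).im)
    have := add_nonneg h1 h2
    rw [← Finset.sum_add_distrib] at this
    simp only [← Finset.sum_add_distrib] at this
    simp only [Complex.re_sum]
    refine this.trans_eq (Finset.sum_congr rfl fun j _ => Finset.sum_congr rfl fun k _ => ?_)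
    simp; ring
  · simp only [Complex.im_sum]
    have h : ∀ j k, (c j * (starRingEnd ℂ) (c k) * (K (x j) (x k) : ℂ)).im
      = (c j).im * (c k).re * K (x j) (x k) - (c j).re * (c k).im * K (x j) (x k) := by
      intro j k; simp; ring
    simp only [h, Finset.sum_sub_distrib]
    rw [eq_comm, sub_eq_zero, Finset.sum_comm]
    refine Finset.sum_congr rfl fun j _ => Finset.sum_congr rfl fun k _ => ?_
    rw [hK.1]; ring
end PSDK

/-! ### `exp (-τ |x - y|^p)` is a positive semidefinite kernel on `ℝ` -/

noncomputable def stab (p u : ℝ) : ℝ := (1 - Real.cos u) * u ^ (-1 - p)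

lemma stab_nonneg (p : ℝ) {u : ℝ} (hu : 0 < u) : 0 ≤ stab p u :=
  mul_nonneg (by linarith [Real.cos_le_one u]) (Real.rpow_nonneg hu.le _)

lemma stab_integrable {p : ℝ} (hp0 : 0 < p) (hp2 : p < 2) :
    IntegrableOn (stab p) (Set.Ioi 0) := by
  have hmeas : Measurable (stab p) := by unfold stab; fun_prop
  rw [← Set.Ioc_union_Ioi_eq_Ioi (zero_le_one (α := ℝ))]
  refine IntegrableOn.union ?_ ?_
  · have h1 : IntegrableOn (fun u : ℝ => u ^ (1 - p)) (Set.Ioc 0 1) := by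
      have := intervalIntegral.intervalIntegrable_rpow' (a := 0) (b := 1) (r := 1 - p) (by linarith)
      rwa [intervalIntegrable_iff_integrableOn_Ioc_of_le zero_le_one] at this
    refine Integrable.mono' h1 hmeas.aestronglyMeasurable ?_
    refine (ae_restrict_iff' measurableSet_Ioc).2 (ae_of_all _ fun u hu => ?_)
    rw [Real.norm_eq_abs, abs_of_nonneg (stab_nonneg p hu.1), stab]
    have e : u ^ (1 - p) = u ^ 2 * u ^ (-1 - p) := by
      rw [← Real.rpow_natCast u 2, ← Real.rpow_add hu.1]; norm_num; ring_nf
    rw [e]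
    refine mul_le_mul_of_nonneg_right ?_ (Real.rpow_nonneg hu.1.le _)
    nlinarith [Real.one_sub_sq_div_two_le_cos (x := u), sq_nonneg u]
  · have h1 : IntegrableOn (fun u : ℝ => 2 * u ^ (-1 - p)) (Set.Ioi 1) :=
      (integrableOn_Ioi_rpow_of_lt (by linarith) zero_lt_one).const_mul 2
    refine Integrable.mono' h1 hmeas.aestronglyMeasurable ?_
    refine (ae_restrict_iff' measurableSet_Ioi).2 (ae_of_all _ fun u hu => ?_)
    have hu0 : (0:ℝ) < u := zero_lt_one.trans hu
    rw [Real.norm_eq_abs, abs_of_nonneg (stab_nonneg p hu0), stab]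
    refine mul_le_mul_of_nonneg_right ?_ (Real.rpow_nonneg hu0.le _)
    linarith [Real.neg_one_le_cos u]

lemma stab_pos {p : ℝ} (hp0 : 0 < p) (hp2 : p < 2) : 0 < ∫ u in Set.Ioi 0, stab p u := by
  rw [setIntegral_pos_iff_support_of_nonneg_ae
    ((ae_restrict_iff' measurableSet_Ioi).2 (ae_of_all _ fun u hu => stab_nonneg p hu))
    (stab_integrable hp0 hp2)]
  have : Set.Ioo (0:ℝ) 1 ⊆ Function.support (stab p) ∩ Set.Ioi 0 := by
    intro u hu
    refine ⟨?_, hu.1⟩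
    have h1 : Real.cos u < 1 := by
      have := Real.cos_lt_cos_of_nonneg_of_le_pi (x := 0) (y := u) le_rfl
        (by linarith [Real.pi_gt_three, hu.2]) hu.1
      simpa using this
    exact (mul_pos (by linarith) (Real.rpow_pos_of_pos hu.1 _)).ne'
  refine lt_of_lt_of_le ?_ (measure_mono this)
  simp

lemma stab_scale_int {p : ℝ} (hp0 : 0 < p) (hp2 : p < 2) (x : ℝ) :
    IntegrableOn (fun u => (1 - Real.cos (x * u)) * u ^ (-1 - p)) (Set.Ioi 0) ∧
    ∫ u in Set.Ioi 0, (1 - Real.cos (x * u)) * u ^ (-1 - p)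
      = |x| ^ p * ∫ u in Set.Ioi 0, stab p u := by
  rcases eq_or_ne x 0 with rfl | hx
  · simp [Real.zero_rpow hp0.ne']
  have hb : 0 < |x| := abs_pos.2 hx
  have e : ∀ u ∈ Set.Ioi (0:ℝ), (1 - Real.cos (x * u)) * u ^ (-1 - p)
      = |x| ^ (1 + p) * stab p (|x| * u) := by
    intro u hu
    have hu : (0:ℝ) < u := hu
    have hc : Real.cos (|x| * u) = Real.cos (x * u) := by
      rw [← Real.cos_abs (x * u), abs_mul, abs_of_pos hu]
    have h1 : |x| ^ (1 + p) * |x| ^ (-1 - p) = 1 := by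
      rw [← Real.rpow_add hb]; ring_nf; simp
    rw [stab, hc, Real.mul_rpow hb.le hu.le]
    linear_combination (-(1 - Real.cos (x * u)) * u ^ (-1 - p)) * h1
  constructor
  · rw [integrableOn_congr_fun e measurableSet_Ioi]
    have := (integrableOn_Ioi_comp_mul_left_iff (stab p) 0 hb).2 (by simpa using stab_integrable hp0 hp2)
    exact this.const_mul _
  · rw [setIntegral_congr_fun measurableSet_Ioi e, integral_const_mul,
      integral_comp_mul_left_Ioi _ _ hb, mul_zero, smul_eq_mul, ← mul_assoc]
    congr 1
    rw [Real.rpow_add hb, Real.rpow_one]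
    field_simp

lemma psdk_cos (u : ℝ) : PSDK (fun x y : ℝ =>
    (1 - Real.cos (x * u)) + (1 - Real.cos (y * u)) - (1 - Real.cos ((x - y) * u))) := by
  have := (PSDK.rankOne (fun x : ℝ => 1 - Real.cos (x * u))).add
    (PSDK.rankOne (fun x : ℝ => Real.sin (x * u)))
  convert this using 3 with x y
  rw [sub_mul, Real.cos_sub]; ring

lemma psdk_abs_rpow {p : ℝ} (hp0 : 0 < p) (hp2 : p ≤ 2) :
    PSDK (fun x y : ℝ => |x| ^ p + |y| ^ p - |x - y| ^ p) := by
  rcases hp2.eq_or_lt with rfl | hp2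
  · have := PSDK.smul (zero_le_two (α := ℝ)) (PSDK.rankOne (fun x : ℝ => x))
    convert this using 3 with x y
    norm_num; ring
  · have h := PSDK.integral (volume.restrict (Set.Ioi (0:ℝ)))
      (fun u (x y : ℝ) => u ^ (-1 - p) * ((1 - Real.cos (x * u)) + (1 - Real.cos (y * u))
        - (1 - Real.cos ((x - y) * u))))
      ((ae_restrict_iff' measurableSet_Ioi).2 (ae_of_all _ fun u hu =>
        (psdk_cos u).smul (Real.rpow_nonneg (le_of_lt hu) _)))
    have e : ∀ x y u : ℝ, u ^ (-1 - p) * ((1 - Real.cos (x * u)) + (1 - Real.cos (y * u))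
        - (1 - Real.cos ((x - y) * u))) = (1 - Real.cos (x * u)) * u ^ (-1 - p) +
        (1 - Real.cos (y * u)) * u ^ (-1 - p) - (1 - Real.cos ((x - y) * u)) * u ^ (-1 - p) := by
      intro x y u; ring
    have I := fun x => (stab_scale_int hp0 hp2 x).1
    have J := fun x => (stab_scale_int hp0 hp2 x).2
    simp only [e] at h
    have h' := h (fun x y => ((I x).add (I y)).sub (I (x - y)))
    have C := stab_pos hp0 hp2
    have := h'.smul (inv_nonneg.2 C.le)
    convert this using 3 with x y
    have hxy : IntegrableOn (fun u => (1 - Real.cos (x * u)) * u ^ (-1 - p)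
      + (1 - Real.cos (y * u)) * u ^ (-1 - p)) (Set.Ioi 0) := (I x).add (I y)
    rw [integral_sub hxy (I (x - y)), integral_add (I x) (I y), J, J, J]
    field_simp

lemma psdk_exp_abs {p : ℝ} (hp0 : 0 < p) (hp2 : p ≤ 2) {τ : ℝ} (hτ : 0 ≤ τ) :
    PSDK (fun x y : ℝ => Real.exp (-τ * |x - y| ^ p)) := by
  have := (PSDK.rankOne (fun x : ℝ => Real.exp (-τ * |x| ^ p))).mul
    ((psdk_abs_rpow hp0 hp2).smul hτ).exp
  convert this using 3 with x y
  rw [← Real.exp_add, ← Real.exp_add]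
  congr 1; ring

/-! ### Words in the free product -/

section Words
open Monoid.CoprodI

abbrev FLetter := Σ _ : ℕ, Multiplicative ℝ

abbrev FGrp := Monoid.CoprodI (fun _ : ℕ => Multiplicative ℝ)

noncomputable def flen (p : ℝ) (l : List FLetter) : ℝ :=
  (l.map (fun l => |Multiplicative.toAdd l.2| ^ p)).sum

def fprod (l : List FLetter) : FGrp :=
  (l.map (fun x => (of (M := fun _ : ℕ => Multiplicative ℝ) (i := x.1) x.2))).prod

def FRed (l : List FLetter) : Prop :=
  (∀ x ∈ l, x.2 ≠ 1) ∧ l.IsChain (fun a b => a.1 ≠ b.1)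

@[simp] lemma flen_nil (p : ℝ) : flen p [] = 0 := rfl
@[simp] lemma flen_cons (p : ℝ) (c : FLetter) (l) :
    flen p (c :: l) = |Multiplicative.toAdd c.2| ^ p + flen p l := by simp [flen]
@[simp] lemma flen_append (p : ℝ) (l l') : flen p (l ++ l') = flen p l + flen p l' := by
  simp [flen]
@[simp] lemma fprod_nil : fprod [] = 1 := rfl
@[simp] lemma fprod_cons (c : FLetter) (l) :
    fprod (c :: l) = of (M := fun _ : ℕ => Multiplicative ℝ) (i := c.1) c.2 * fprod l := by
  simp [fprod]
@[simp] lemma fprod_append (l l') : fprod (l ++ l') = fprod l * fprod l' := by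
  simp [fprod]

lemma lppFree_fprod (p : ℝ) {l : List FLetter} (h : FRed l) : lppFree p (fprod l) = flen p l := by
  let w : Word (fun _ : ℕ => Multiplicative ℝ) := ⟨l, h.1, h.2⟩
  have e : Word.equiv (fprod l) = w := Word.equiv.apply_symm_apply w
  rw [lppFree, e]; rfl

lemma exists_fprod (g : FGrp) : ∃ l, FRed l ∧ fprod l = g := by
  refine ⟨(Word.equiv g).toList, ⟨(Word.equiv g).ne_one, (Word.equiv g).chain_ne⟩, ?_⟩
  exact Word.equiv.symm_apply_apply g

def finv (l : List FLetter) : List FLetter := (l.map (fun x => ⟨x.1, x.2⁻¹⟩)).reverse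

lemma flen_finv (p : ℝ) (l) : flen p (finv l) = flen p l := by
  induction l with
  | nil => rfl
  | cons c l ih =>
    have : finv (c :: l) = finv l ++ [⟨c.1, c.2⁻¹⟩] := by simp [finv]
    rw [this]; simp [ih]; ring

lemma fprod_finv (l) : fprod (finv l) = (fprod l)⁻¹ := by
  induction l with
  | nil => simp [finv]
  | cons c l ih =>
    have : finv (c :: l) = finv l ++ [⟨c.1, c.2⁻¹⟩] := by simp [finv]
    rw [this]; simp [ih]

lemma FRed.finv {l} (h : FRed l) : FRed (finv l) := by
  constructor
  · intro x hx
    simp only [_root_.finv, List.mem_reverse, List.mem_map] at hx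
    obtain ⟨y, hy, rfl⟩ := hx
    simpa using h.1 y hy
  · simp only [_root_.finv, List.isChain_reverse, List.isChain_map]
    exact h.2.imp fun a b hab => hab.symm

lemma lppFree_disj (p : ℝ) {l l' : List FLetter} (h : FRed l) (h' : FRed l')
    (hd : ∀ x ∈ l.head?, ∀ y ∈ l'.head?, x.1 ≠ y.1) :
    lppFree p ((fprod l)⁻¹ * fprod l') = flen p l + flen p l' := by
  rw [← fprod_finv, ← fprod_append, lppFree_fprod, flen_append, flen_finv]
  refine ⟨?_, ?_⟩
  · intro x hx
    rcases List.mem_append.1 hx with hx | hx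
    · exact h.finv.1 x hx
    · exact h'.1 x hx
  · rw [List.isChain_append]
    refine ⟨h.finv.2, h'.2, ?_⟩
    intro x hx y hy
    simp only [finv, List.getLast?_reverse, List.head?_map, Option.mem_def, Option.map_eq_some_iff] at hx
    obtain ⟨z, hz, rfl⟩ := hx
    exact hd z hz y hy

lemma FRed.tail {c l} (h : FRed (c :: l)) : FRed l :=
  ⟨fun x hx => h.1 x (by simp [hx]), h.2.tail⟩

lemma FRed.head {c l} (h : FRed (c :: l)) : ∀ x ∈ l.head?, c.1 ≠ x.1 := by
  have := h.2
  rw [List.isChain_cons] at this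
  exact this.1

lemma FRed.cons {c : FLetter} {l} (h : FRed l) (hc : c.2 ≠ 1) (hd : ∀ x ∈ l.head?, c.1 ≠ x.1) :
    FRed (c :: l) := by
  refine ⟨by simpa using ⟨hc, h.1⟩, ?_⟩
  rw [List.isChain_cons]
  exact ⟨hd, h.2⟩

/-- letter kernel -/
noncomputable def kLet (p τ : ℝ) (c d : FLetter) : ℝ :=
  (if c.1 = d.1 then (1:ℝ) else 0) *
    (Real.exp (-τ * |Multiplicative.toAdd c.2 - Multiplicative.toAdd d.2| ^ p) -
      Real.exp (-τ * |Multiplicative.toAdd c.2| ^ p) * Real.exp (-τ * |Multiplicative.toAdd d.2| ^ p))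

noncomputable def uLen (p τ : ℝ) (l : List FLetter) : ℝ := Real.exp (-τ * flen p l)

open Classical in
noncomputable def kM (p τ : ℝ) : ℕ → List FLetter → List FLetter → ℝ
  | 0, _, _ => 0
  | n + 1, l, l' => ((if l = [] then (0:ℝ) else 1) * (if l' = [] then (0:ℝ) else 1)) *
      (uLen p τ l.tail * uLen p τ l'.tail * kLet p τ (l.headD ⟨0, 1⟩) (l'.headD ⟨0, 1⟩) +
        (if l.headD ⟨0, 1⟩ = l'.headD ⟨0, 1⟩ then (1:ℝ) else 0) * kM p τ n l.tail l'.tail)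

lemma psdk_exp_sub_one {X : Type*} {K : X → X → ℝ} (hK : PSDK K) :
    PSDK (fun x y => Real.exp (K x y) - 1) := by
  refine PSDK.lim (F := fun n x y => ∑ m ∈ Finset.range n, (((m + 1).factorial : ℝ))⁻¹ * K x y ^ (m + 1))
    (fun n => PSDK.sum _ _ fun m _ => PSDK.smul (by positivity) (hK.pow (m + 1))) fun x y => ?_
  have := NormedSpace.expSeries_div_hasSum_exp (K x y)
  rw [← Real.exp_eq_exp_ℝ, ← hasSum_nat_add_iff' 1] at this
  simpa [div_eq_inv_mul] using this.tendsto_sum_nat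

lemma psdk_kLet {p : ℝ} (hp0 : 0 < p) (hp2 : p ≤ 2) {τ : ℝ} (hτ : 0 ≤ τ) : PSDK (kLet p τ) := by
  have h1 := (PSDK.delta (X := ℕ)).comp (fun c : FLetter => c.1)
  have h2 := ((PSDK.rankOne (fun x : ℝ => Real.exp (-τ * |x| ^ p))).mul
    (psdk_exp_sub_one ((psdk_abs_rpow hp0 hp2).smul hτ))).comp
    (fun c : FLetter => Multiplicative.toAdd c.2)
  convert h1.mul h2 using 3 with c d
  rw [kLet]
  congr 1
  rw [mul_sub, mul_one, ← Real.exp_add, ← Real.exp_add]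
  congr 2; ring

lemma psdk_kM {p : ℝ} (hp0 : 0 < p) (hp2 : p ≤ 2) {τ : ℝ} (hτ : 0 ≤ τ) (n : ℕ) :
    PSDK (kM p τ n) := by
  classical
  induction n with
  | zero => exact PSDK.const le_rfl
  | succ n ih =>
    have h := (PSDK.rankOne (fun l : List FLetter => if l = [] then (0:ℝ) else 1)).mul
      ((((PSDK.rankOne (fun l : List FLetter => uLen p τ l.tail)).mul
        ((psdk_kLet hp0 hp2 hτ).comp (fun l : List FLetter => l.headD ⟨0, 1⟩))).add
        (((PSDK.delta (X := FLetter)).comp (fun l : List FLetter => l.headD ⟨0, 1⟩)).mul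
          (ih.comp List.tail))))
    convert h using 3 with l l'
    rw [kM]

lemma kM_eq {p : ℝ} (hp0 : 0 < p) (τ : ℝ) (n : ℕ) :
    ∀ l l' : List FLetter, FRed l → FRed l' → l.length ≤ n →
    Real.exp (-τ * lppFree p ((fprod l)⁻¹ * fprod l')) = kM p τ n l l' + uLen p τ l * uLen p τ l' := by
  induction n with
  | zero =>
    intro l l' h h' hl
    obtain rfl : l = [] := by simpa using hl
    rw [lppFree_disj p h h' (by simp)]
    simp [kM, uLen]
  | succ n ih =>
    intro l l' h h' hl
    rcases l with _ | ⟨c, t⟩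
    · rw [lppFree_disj p h h' (by simp)]
      simp [kM, uLen]
    rcases l' with _ | ⟨c', t'⟩
    · rw [lppFree_disj p h h' (by simp)]
      simp [kM, uLen]
    have key : ∀ a b : ℝ, Real.exp (-τ * (a + b)) = Real.exp (-τ * a) * Real.exp (-τ * b) := by
      intro a b; rw [mul_add, Real.exp_add]
    by_cases hc : c = c'
    · subst hc
      have e : (fprod (c :: t))⁻¹ * fprod (c :: t') = (fprod t)⁻¹ * fprod t' := by
        simp [mul_assoc]
      rw [e, ih t t' h.tail h'.tail (by simpa using hl)]
      simp only [kM, kLet, uLen, List.tail_cons, List.headD_cons, flen_cons, key]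
      simp [Real.zero_rpow hp0.ne']
      ring
    obtain ⟨i, a⟩ := c
    obtain ⟨i', a'⟩ := c'
    by_cases hi : i = i'
    · subst hi
      have ha : a ≠ a' := fun h => hc (by rw [h])
      have e : (fprod (⟨i, a⟩ :: t))⁻¹ * fprod (⟨i, a'⟩ :: t')
          = (fprod t)⁻¹ * fprod (⟨i, a⁻¹ * a'⟩ :: t') := by
        simp [mul_assoc]
      have h2 : FRed (⟨i, a⁻¹ * a'⟩ :: t') := h'.tail.cons
        (by simpa [inv_mul_eq_one] using ha) (by simpa using h'.head)
      rw [e, lppFree_disj p h.tail h2 (by simpa using fun x hx => (h.head x hx).symm)]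
      have e2 : |Multiplicative.toAdd (a⁻¹ * a')| = |Multiplicative.toAdd a - Multiplicative.toAdd a'| := by
        rw [toAdd_mul, toAdd_inv, abs_sub_comm]; congr 1; ring
      simp only [kM, kLet, uLen, List.tail_cons, List.headD_cons, flen_cons, key, e2]
      simp [ha]
      ring
    · rw [lppFree_disj p h h' (by simpa using hi)]
      simp only [kM, kLet, uLen, List.tail_cons, List.headD_cons, flen_cons, key]
      simp [hi]

lemma psdk_lpp {p : ℝ} (hp0 : 0 < p) (hp2 : p ≤ 2) {τ : ℝ} (hτ : 0 ≤ τ) :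
    PSDK (fun x y : FGrp => Real.exp (-τ * lppFree p (x⁻¹ * y))) := by
  choose L hL using exists_fprod
  refine PSDK.lim (F := fun n x y => kM p τ n (L x) (L y) + uLen p τ (L x) * uLen p τ (L y))
    (fun n => ((psdk_kM hp0 hp2 hτ n).add (PSDK.rankOne (uLen p τ))).comp L) fun x y => ?_
  refine tendsto_const_nhds.congr' ?_
  filter_upwards [Filter.eventually_ge_atTop (L x).length] with n hn
  rw [← kM_eq hp0 τ n (L x) (L y) (hL x).1 (hL y).1 hn, (hL x).2, (hL y).2]

end Words

/-! ### From the free product to the semigroup `[0, ∞)` -/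

section Semi
open Monoid.CoprodI

lemma lppFree_one (p : ℝ) : lppFree p (1 : FGrp) = 0 := by
  have := lppFree_fprod p (l := []) ⟨by simp, by simp⟩
  simpa using this

lemma exists_red_of {p : ℝ} (hp0 : 0 < p) (i : ℕ) (x : ℝ) :
    ∃ l : List FLetter, FRed l ∧ fprod l = of (M := fun _ : ℕ => Multiplicative ℝ) (i := i)
      (Multiplicative.ofAdd x) ∧ flen p l = |x| ^ p ∧ ∀ y ∈ l.head?, y.1 = i := by
  by_cases hx : x = 0
  · subst hx
    exact ⟨[], ⟨by simp, by simp⟩, by simp, by simp [Real.zero_rpow hp0.ne'], by simp⟩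
  · exact ⟨[⟨i, Multiplicative.ofAdd x⟩], ⟨by simpa using hx, by simp⟩, by simp, by simp, by simp⟩

lemma lppFree_two {p : ℝ} (hp0 : 0 < p) {i j : ℕ} (hij : i ≠ j) (x y : ℝ) :
    lppFree p ((of (M := fun _ : ℕ => Multiplicative ℝ) (i := i) (Multiplicative.ofAdd x))⁻¹ *
      of (M := fun _ : ℕ => Multiplicative ℝ) (i := j) (Multiplicative.ofAdd y))
      = |x| ^ p + |y| ^ p := by
  obtain ⟨l, h1, h2, h3, h4⟩ := exists_red_of hp0 i x
  obtain ⟨l', h1', h2', h3', h4'⟩ := exists_red_of hp0 j y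
  rw [← h2, ← h2', ← h3, ← h3']
  refine lppFree_disj p h1 h1' fun a ha b hb => ?_
  rw [h4 a ha, h4' b hb]; exact hij

lemma flen_nonneg (p : ℝ) (l) : 0 ≤ flen p l := by
  refine List.sum_nonneg ?_
  simp only [List.mem_map]
  rintro _ ⟨x, _, rfl⟩
  positivity

lemma lppFree_nonneg (p : ℝ) (r : FGrp) : 0 ≤ lppFree p r := by
  obtain ⟨l, hl, rfl⟩ := exists_fprod r
  rw [lppFree_fprod p hl]; exact flen_nonneg p l

lemma lppFree_pos (p : ℝ) {r : FGrp} (hr : r ≠ 1) : 0 < lppFree p r := by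
  obtain ⟨l, hl, rfl⟩ := exists_fprod r
  rw [lppFree_fprod p hl]
  rcases l with _ | ⟨c, l⟩
  · simp at hr
  · rw [flen_cons]
    have : Multiplicative.toAdd c.2 ≠ 0 := by
      simpa using hl.1 c (by simp)
    have := Real.rpow_pos_of_pos (abs_pos.2 this) p
    linarith [flen_nonneg p l]

lemma exists_lppFree {p : ℝ} (hp0 : 0 < p) {s : ℝ} (hs : 0 ≤ s) : ∃ r : FGrp, lppFree p r = s := by
  have := lppFree_two hp0 (i := 0) (j := 1) (by simp) 0 (s ^ p⁻¹)
  refine ⟨_, this.trans ?_⟩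
  rw [abs_zero, Real.zero_rpow hp0.ne', abs_of_nonneg (Real.rpow_nonneg hs _),
    Real.rpow_inv_rpow hs hp0.ne', zero_add]

lemma IsPositiveDefinite.real {G : Type*} [Group G] {φ : G → ℝ} (h : IsPositiveDefinite φ)
    {α : Type*} [Fintype α] (x : α → G) (c : α → ℝ) :
    0 ≤ ∑ a, ∑ b, c a * c b * φ ((x a)⁻¹ * x b) := by
  let e := (Fintype.equivFin α).symm
  have := h _ (fun j => x (e j)) (fun j => (c (e j) : ℂ))
  simp only [Complex.conj_ofReal] at this
  norm_cast at this
  rw [← Equiv.sum_comp e]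
  refine this.trans_eq (Finset.sum_congr rfl fun j _ => ?_)
  rw [← Equiv.sum_comp e]

lemma IsPositiveDefinite.inv {G : Type*} [Group G] {φ : G → ℝ} (h : IsPositiveDefinite φ)
    (g : G) : φ g⁻¹ = φ g := by
  have := (Complex.nonneg_iff.1 (h 2 ![1, g] ![1, Complex.I])).2
  simp [Fin.sum_univ_two] at this
  linarith

lemma IsPositiveDefinite.bdd {G : Type*} [Group G] {φ : G → ℝ} (h : IsPositiveDefinite φ)
    (h1 : φ 1 = 1) (g : G) : |φ g| ≤ 1 := by
  have a1 := h.real ![1, g] ![1, 1]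
  have a2 := h.real ![1, g] ![1, -1]
  simp [Fin.sum_univ_two, h1, h.inv] at a1 a2
  rw [abs_le]; constructor <;> linarith

def SPD (f : ℝ → ℝ) : Prop := (∃ C, ∀ s, 0 ≤ s → |f s| ≤ C) ∧
  ∀ (n : ℕ) (s c : Fin n → ℝ), (∀ j, 0 ≤ s j) → 0 ≤ ∑ j, ∑ k, c j * c k * f (s j + s k)

lemma spd_of_pd {p : ℝ} (hp0 : 0 < p) {φ : FGrp → ℝ} {f : ℝ → ℝ}
    (hf : ∀ r, φ r = f (lppFree p r)) (h : IsPositiveDefinite φ) (h1 : φ 1 = 1) : SPD f := by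
  constructor
  · refine ⟨1, fun s hs => ?_⟩
    obtain ⟨r, rfl⟩ := exists_lppFree hp0 hs
    rw [← hf]; exact h.bdd h1 r
  intro n s c hs
  set Q := ∑ j, ∑ k, c j * c k * f (s j + s k) with hQ
  set B := ∑ j, ∑ k, |c j * c k| with hB
  let g : ℕ → Fin n → FGrp := fun m j =>
    of (M := fun _ : ℕ => Multiplicative ℝ) (i := m) (Multiplicative.ofAdd ((s j) ^ p⁻¹))
  have hpow : ∀ j, |(s j) ^ p⁻¹| ^ p = s j := fun j => by
    rw [abs_of_nonneg (Real.rpow_nonneg (hs j) _), Real.rpow_inv_rpow (hs j) hp0.ne']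
  have hoff : ∀ m m', m ≠ m' → ∑ j, ∑ k, c j * c k * φ ((g m j)⁻¹ * g m' k) = Q := by
    intro m m' hm
    refine Finset.sum_congr rfl fun j _ => Finset.sum_congr rfl fun k _ => ?_
    rw [hf, lppFree_two hp0 hm, hpow, hpow]
  have hdiag : ∀ m, ∑ j, ∑ k, c j * c k * φ ((g m j)⁻¹ * g m k) ≤ B := by
    intro m
    refine Finset.sum_le_sum fun j _ => Finset.sum_le_sum fun k _ => ?_
    refine (le_abs_self _).trans ?_
    rw [abs_mul (c j * c k)]
    exact mul_le_of_le_one_right (abs_nonneg _) (h.bdd h1 _)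
  have hN : ∀ N : ℕ, 0 < N → 0 ≤ (N:ℝ) * Q + (B - Q) := by
    intro N hNpos
    have := h.real (fun a : Fin N × Fin n => g a.1 a.2) (fun a => c a.2)
    simp only [Fintype.sum_prod_type] at this
    have e : ∀ m : Fin N, ∑ j, ∑ m' : Fin N, ∑ k, c j * c k * φ ((g m j)⁻¹ * g m' k)
        ≤ N * Q + (B - Q) := by
      intro m
      rw [Finset.sum_comm]
      have : ∀ m' : Fin N, ∑ j, ∑ k, c j * c k * φ ((g m j)⁻¹ * g m' k)
          ≤ Q + if m = m' then B - Q else 0 := by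
        intro m'
        by_cases hm : m = m'
        · subst hm; simpa using hdiag m
        · rw [hoff m m' (fun h => hm (Fin.ext h)), if_neg hm, add_zero]
      refine (Finset.sum_le_sum fun m' _ => this m').trans_eq ?_
      simp [Finset.sum_add_distrib]
    have h2 := this.trans (Finset.sum_le_sum fun m _ => e m)
    simp only [Finset.sum_const, Finset.card_univ, Fintype.card_fin, nsmul_eq_mul] at h2
    exact nonneg_of_mul_nonneg_right h2 (by exact_mod_cast hNpos)
  have hB0 : 0 ≤ B := Finset.sum_nonneg fun j _ => Finset.sum_nonneg fun k _ => abs_nonneg _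
  by_contra hlt
  push Not at hlt
  obtain ⟨N, hNN⟩ := exists_nat_gt ((B - Q) / (-Q))
  have hpos : 0 < N := by
    have : (0:ℝ) < N := lt_of_le_of_lt (div_nonneg (by linarith) (by linarith)) hNN
    exact_mod_cast this
  have := hN N hpos
  rw [div_lt_iff₀ (by linarith)] at hNN
  nlinarith

end Semi

/-! ### Complete monotonicity -/

section CM
open Polynomial

lemma SPD.fintype {f : ℝ → ℝ} (hf : SPD f) {α : Type*} [Fintype α] (s c : α → ℝ)
    (hs : ∀ j, 0 ≤ s j) : 0 ≤ ∑ j, ∑ k, c j * c k * f (s j + s k) := by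
  let e := (Fintype.equivFin α).symm
  have := hf.2 _ (fun j => s (e j)) (fun j => c (e j)) (fun j => hs _)
  rw [← Equiv.sum_comp e]
  refine this.trans_eq (Finset.sum_congr rfl fun j _ => ?_)
  rw [← Equiv.sum_comp e]

lemma SPD.nonneg {f : ℝ → ℝ} (hf : SPD f) {s : ℝ} (hs : 0 ≤ s) : 0 ≤ f s := by
  have := hf.2 1 (fun _ => s / 2) (fun _ => 1) (fun _ => by positivity)
  simpa using this

lemma SPD.shift {f : ℝ → ℝ} (hf : SPD f) {a : ℝ} (ha : 0 ≤ a) : SPD (fun s => f (s + a)) := by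
  obtain ⟨C, hC⟩ := hf.1
  refine ⟨⟨C, fun s hs => hC _ (by positivity)⟩, fun n s c hs => ?_⟩
  refine (hf.2 n (fun j => s j + a / 2) c (fun j => add_nonneg (hs j) (by positivity))).trans_eq ?_
  refine Finset.sum_congr rfl fun j _ => Finset.sum_congr rfl fun k _ => ?_
  congr 2; ring

lemma SPD.quad_le {f : ℝ → ℝ} (hf : SPD f) {a : ℝ} (ha : 0 ≤ a) {n : ℕ} (s c : Fin n → ℝ)
    (hs : ∀ j, 0 ≤ s j) :
    ∑ j, ∑ k, c j * c k * f (s j + s k + a) ≤ ∑ j, ∑ k, c j * c k * f (s j + s k) := by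
  obtain ⟨C, hC⟩ := hf.1
  set q : ℝ → ℝ := fun b => ∑ j, ∑ k, c j * c k * f (s j + s k + b) with hq
  have hq0 : ∑ j, ∑ k, c j * c k * f (s j + s k) = q 0 := by simp [hq]
  have hqn : ∀ b, 0 ≤ b → 0 ≤ q b := fun b hb => (hf.shift hb).2 n s c hs
  have hbd : ∀ b, 0 ≤ b → q b ≤ ∑ j, ∑ k, |c j * c k| * C := by
    intro b hb
    refine Finset.sum_le_sum fun j _ => Finset.sum_le_sum fun k _ => (le_abs_self _).trans ?_
    rw [abs_mul (c j * c k)]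
    exact mul_le_mul_of_nonneg_left (hC _ (by linarith [hs j, hs k])) (abs_nonneg _)
  have hcs : ∀ b, 0 ≤ b → q b ^ 2 ≤ q 0 * q (2 * b) := by
    intro b hb
    have : ∀ x : ℝ, 0 ≤ q (2 * b) * (x * x) + (2 * q b) * x + q 0 := by
      intro x
      have h := hf.fintype (α := Fin n ⊕ Fin n) (Sum.elim s (fun j => s j + b))
        (Sum.elim c (fun j => x * c j)) (by rintro (j | j) <;> simp [hs, add_nonneg, hb])
      simp only [Fintype.sum_sum_type, Sum.elim_inl, Sum.elim_inr, Finset.sum_add_distrib] at h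
      refine h.trans_eq ?_
      have e1 : ∑ j, ∑ k, c j * (x * c k) * f (s j + (s k + b)) = x * q b := by
        simp only [hq, Finset.mul_sum]
        refine Finset.sum_congr rfl fun j _ => Finset.sum_congr rfl fun k _ => ?_
        rw [add_assoc]; ring
      have e2 : ∑ j, ∑ k, x * c j * c k * f (s j + b + s k) = x * q b := by
        simp only [hq, Finset.mul_sum]
        refine Finset.sum_congr rfl fun j _ => Finset.sum_congr rfl fun k _ => ?_
        rw [add_right_comm]; ring
      have e3 : ∑ j, ∑ k, x * c j * (x * c k) * f (s j + b + (s k + b)) = x * x * q (2 * b) := by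
        simp only [hq, Finset.mul_sum]
        refine Finset.sum_congr rfl fun j _ => Finset.sum_congr rfl fun k _ => ?_
        rw [show s j + b + (s k + b) = s j + s k + 2 * b by ring]; ring
      rw [e1, e2, e3, hq0]; ring
    have := discrim_le_zero this
    rw [discrim] at this
    nlinarith
  rw [hq0]
  by_contra hlt
  push Not at hlt
  change q 0 < q a at hlt
  have hQ : 0 < q 0 := by
    rcases (hqn 0 le_rfl).eq_or_lt with h | h
    · have := hcs a ha
      rw [← h, zero_mul] at this
      nlinarith [hqn a ha]
    · exact h
  set r := q a / q 0 with hr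
  have hr1 : 1 < r := (one_lt_div hQ).2 hlt
  have hgrow : ∀ m : ℕ, q 0 * r ^ (2 ^ m) ≤ q (2 ^ m * a) := by
    intro m
    induction m with
    | zero => simp [hr, mul_div_cancel₀ _ hQ.ne']
    | succ m ih =>
      have h1 := hcs (2 ^ m * a) (by positivity)
      have h2 : (q 0 * r ^ (2 ^ m)) ^ 2 ≤ q (2 ^ m * a) ^ 2 :=
        pow_le_pow_left₀ (by positivity) ih 2
      have h3 := h2.trans h1
      rw [show 2 ^ (m + 1) * a = 2 * (2 ^ m * a) by ring, pow_succ 2 m, pow_mul]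
      have h4 : q 0 * (q 0 * (r ^ 2 ^ m) ^ 2) ≤ q 0 * q (2 * (2 ^ m * a)) := by
        refine le_trans (le_of_eq ?_) h3; ring
      exact le_of_mul_le_mul_left h4 hQ
  obtain ⟨m, hm⟩ := pow_unbounded_of_one_lt ((∑ j, ∑ k, |c j * c k| * C) / q 0) hr1
  have h1 := (hgrow m).trans (hbd _ (by positivity))
  have h2 : r ^ m ≤ r ^ (2 ^ m) := pow_le_pow_right₀ hr1.le (Nat.lt_two_pow_self).le
  rw [div_lt_iff₀ hQ] at hm
  nlinarith

lemma SPD.diff {f : ℝ → ℝ} (hf : SPD f) {a : ℝ} (ha : 0 ≤ a) : SPD (fun s => f s - f (s + a)) := by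
  obtain ⟨C, hC⟩ := hf.1
  refine ⟨⟨C + C, fun s hs => (abs_sub _ _).trans (add_le_add (hC s hs) (hC _ (by positivity)))⟩,
    fun n s c hs => ?_⟩
  simp only [mul_sub, Finset.sum_sub_distrib, sub_nonneg]
  exact hf.quad_le ha s c hs

lemma SPD.anti {f : ℝ → ℝ} (hf : SPD f) {s t : ℝ} (hs : 0 ≤ s) (hst : s ≤ t) : f t ≤ f s := by
  have := (hf.diff (sub_nonneg.2 hst)).nonneg hs
  simpa using this

/-- the functional `X^k ↦ f (k h)` -/
noncomputable def momL (f : ℝ → ℝ) (h : ℝ) : ℝ[X] →ₗ[ℝ] ℝ :=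
  Polynomial.lsum (fun i => f (i * h) • (LinearMap.id : ℝ →ₗ[ℝ] ℝ))

lemma momL_monomial (f : ℝ → ℝ) (h : ℝ) (k : ℕ) (c : ℝ) :
    momL f h (monomial k c) = f (k * h) * c := by
  simp [momL, Polynomial.lsum_apply, Polynomial.sum_monomial_index]

lemma momL_X_pow (f : ℝ → ℝ) (h : ℝ) (k : ℕ) : momL f h (X ^ k) = f (k * h) := by
  rw [X_pow_eq_monomial, momL_monomial, mul_one]

lemma momL_X_mul (f : ℝ → ℝ) (h : ℝ) (P : ℝ[X]) :
    momL f h (X * P) = momL (fun s => f (s + h)) h P := by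
  induction P using Polynomial.induction_on' with
  | add p q hp hq => rw [mul_add, map_add, map_add, hp, hq]
  | monomial n a =>
    rw [X_mul_monomial, momL_monomial, momL_monomial]
    push_cast; rw [add_mul, one_mul]

lemma momL_sub (f g : ℝ → ℝ) (h : ℝ) (P : ℝ[X]) :
    momL (fun s => f s - g s) h P = momL f h P - momL g h P := by
  induction P using Polynomial.induction_on' with
  | add p q hp hq => rw [map_add, map_add, map_add, hp, hq]; ring
  | monomial n a => rw [momL_monomial, momL_monomial, momL_monomial]; ring

lemma momL_nonneg {h : ℝ} (hh : 0 ≤ h) (m k : ℕ) :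
    ∀ {f : ℝ → ℝ}, SPD f → 0 ≤ momL f h (X ^ k * (1 - X) ^ m) := by
  induction k with
  | zero =>
    induction m with
    | zero =>
      intro f hf
      have := momL_X_pow f h 0
      simp only [pow_zero, mul_one] at this ⊢
      rw [this]; exact hf.nonneg (by simp)
    | succ m ih =>
      intro f hf
      have := ih (hf.diff hh)
      rw [momL_sub, ← momL_X_mul, ← map_sub] at this
      refine this.trans_eq (congrArg _ ?_)
      ring
  | succ k ih =>
    intro f hf
    have := ih (hf.shift hh)
    rw [← momL_X_mul] at this
    refine this.trans_eq (congrArg _ ?_)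
    ring

lemma momL_bernstein_nonneg {f : ℝ → ℝ} (hf : SPD f) {h : ℝ} (hh : 0 ≤ h) (n k : ℕ) :
    0 ≤ momL f h (bernsteinPolynomial ℝ n k) := by
  have e : bernsteinPolynomial ℝ n k = (n.choose k : ℝ) • (X ^ k * (1 - X) ^ (n - k)) := by
    rw [bernsteinPolynomial, smul_eq_C_mul]; simp [mul_assoc]
  rw [e, map_smul, smul_eq_mul]
  exact mul_nonneg (by positivity) (momL_nonneg hh _ _ hf)

lemma bernstein_choose {n j : ℕ} (hj : j ≤ n) :
    ∑ k ∈ Finset.range (n + 1), (k.choose j : ℝ) • bernsteinPolynomial ℝ n k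
      = (n.choose j : ℝ) • X ^ j := by
  have hs := bernsteinPolynomial.sum ℝ (n - j)
  rw [Finset.range_eq_Ico, ← Finset.sum_Ico_consecutive _ (Nat.zero_le j) (by omega : j ≤ n + 1),
    Finset.sum_eq_zero, zero_add, Finset.sum_Ico_eq_sum_range]
  · rw [← mul_one (X ^ j : ℝ[X]), ← hs, Finset.mul_sum, Finset.smul_sum,
      show n + 1 - j = n - j + 1 by omega]
    refine Finset.sum_congr rfl fun i hi => ?_
    have hi : i ≤ n - j := by simpa [Nat.lt_succ_iff] using hi
    have hc := Nat.choose_mul (n := n) (k := j + i) (s := j) (by omega)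
    rw [show j + i - j = i by omega] at hc
    have hc' : ((n.choose (j + i) : ℝ[X])) * ((j + i).choose j : ℝ[X])
        = (n.choose j : ℝ[X]) * ((n - j).choose i : ℝ[X]) := by exact_mod_cast hc
    simp only [bernsteinPolynomial, smul_eq_C_mul, map_natCast]
    rw [show n - j - i = n - (j + i) by omega, pow_add]
    linear_combination (X ^ j * X ^ i * (1 - X) ^ (n - (j + i))) * hc'
  · intro k hk
    rw [Nat.choose_eq_zero_of_lt (by simpa using hk)]; simp

lemma choose_ratio {n k : ℕ} (hk : k ≤ n) (j : ℕ) (hj : j < n) :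
    |((k:ℝ) / n) ^ j - (k.choose j : ℝ) / n.choose j| ≤ (j:ℝ) ^ 2 / (n - j) := by
  induction j with
  | zero => simp
  | succ j ih =>
    have ih := ih (by omega)
    have hn : (0:ℝ) < n := by exact_mod_cast (by omega : 0 < n)
    have hnj : (0:ℝ) < n - (j + 1) := by
      have : ((j + 1 : ℕ) : ℝ) < n := by exact_mod_cast hj
      push_cast at this; linarith
    have hkn : (k:ℝ) ≤ n := by exact_mod_cast hk
    have hcn : (0:ℝ) < n.choose j := by exact_mod_cast Nat.choose_pos (by omega)
    have hR1 : (k.choose j : ℝ) / n.choose j ≤ 1 := by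
      rw [div_le_one hcn]; exact_mod_cast Nat.choose_le_choose j hk
    have hR0 : 0 ≤ (k.choose j : ℝ) / n.choose j := by positivity
    have step : ∀ m : ℕ, (m.choose (j + 1) : ℝ) * (j + 1) = m.choose j * (m - j) := by
      intro m
      rcases le_or_gt j m with h | h
      · have := Nat.choose_succ_right_eq m j
        have h2 : ((m.choose (j + 1) * (j + 1) : ℕ) : ℝ) = ((m.choose j * (m - j) : ℕ) : ℝ) := by
          rw [this]
        push_cast [Nat.cast_sub h] at h2
        exact h2
      · rw [Nat.choose_eq_zero_of_lt h, Nat.choose_eq_zero_of_lt (by omega)]; simp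
    have eR : (k.choose (j + 1) : ℝ) / n.choose (j + 1)
        = (k.choose j : ℝ) / n.choose j * ((k - j) / (n - j)) := by
      have h1 := step k
      have h2 := step n
      have hc1 : (0:ℝ) < n.choose (j + 1) := by exact_mod_cast Nat.choose_pos (by omega)
      have hnj' : (n:ℝ) - j ≠ 0 := by linarith
      have hj1 : (j:ℝ) + 1 ≠ 0 := by positivity
      rw [div_mul_div_comm, ← h1, ← h2]
      field_simp
    set R := (k.choose j : ℝ) / n.choose j with hRdef
    rw [eR]
    have hx0 : 0 ≤ (k:ℝ) / n := by positivity
    have hx1 : (k:ℝ) / n ≤ 1 := by rw [div_le_one hn]; exact hkn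
    have hnj2 : (0:ℝ) < n - j := by linarith
    have hd : (k:ℝ) / n - (k - j) / (n - j) = j * (n - k) / (n * (n - j)) := by
      have := hnj2.ne'
      field_simp; ring
    have hd0 : 0 ≤ (k:ℝ) / n - (k - j) / (n - j) := by
      rw [hd]; exact div_nonneg (mul_nonneg (by positivity) (by linarith)) (by positivity)
    have hd1 : (k:ℝ) / n - (k - j) / (n - j) ≤ j / (n - j) := by
      rw [hd, div_le_div_iff₀ (by positivity) hnj2]
      have : (0:ℝ) ≤ j * (n - j) * k := by positivity
      nlinarith
    have e : ((k:ℝ) / n) ^ (j + 1) - R * ((k - j) / (n - j))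
        = (((k:ℝ) / n) ^ j - R) * (k / n) + R * ((k:ℝ) / n - (k - j) / (n - j)) := by ring
    rw [e]
    refine (abs_add_le _ _).trans ?_
    rw [abs_mul, abs_mul, abs_of_nonneg hx0, abs_of_nonneg hR0, abs_of_nonneg hd0]
    have b1 : |((k:ℝ) / n) ^ j - R| * (k / n) ≤ (j:ℝ) ^ 2 / (n - j) :=
      (mul_le_of_le_one_right (abs_nonneg _) hx1).trans ih
    have b2 : R * ((k:ℝ) / n - (k - j) / (n - j)) ≤ j / (n - j) :=
      (mul_le_of_le_one_left hd0 hR1).trans hd1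
    have b3 : (j:ℝ) ^ 2 / (n - j) + j / (n - j) ≤ ((j + 1 : ℕ) : ℝ) ^ 2 / (n - (j + 1 : ℕ)) := by
      rw [← add_div]
      push_cast
      refine div_le_div₀ (by positivity) (by nlinarith [Nat.cast_nonneg (α := ℝ) j]) hnj (by linarith)
    linarith

end CM

/-! ### The Hausdorff moment problem -/

section Moment
open Filter Topology unitInterval Polynomial

lemma integrable_cont (μ : Measure I) [IsFiniteMeasure μ] {g : I → ℝ} (hg : Continuous g) :
    Integrable g μ :=
  (BoundedContinuousFunction.mkOfCompact ⟨g, hg⟩).integrable μ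

lemma moment_unique {μ ν : Measure I} [IsFiniteMeasure μ] [IsFiniteMeasure ν]
    (h : ∀ n : ℕ, ∫ x : I, (x : ℝ) ^ n ∂μ = ∫ x : I, (x : ℝ) ^ n ∂ν) : μ = ν := by
  have hpoly : ∀ P : ℝ[X], ∫ x : I, P.eval (x : ℝ) ∂μ = ∫ x : I, P.eval (x : ℝ) ∂ν := by
    intro P
    induction P using Polynomial.induction_on' with
    | add p q hp hq =>
      simp only [eval_add]
      rw [integral_add (integrable_cont μ (by fun_prop)) (integrable_cont μ (by fun_prop)),
        integral_add (integrable_cont ν (by fun_prop)) (integrable_cont ν (by fun_prop)), hp, hq]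
    | monomial n a =>
      simp only [eval_monomial]
      rw [integral_const_mul, integral_const_mul, h]
  refine ext_of_forall_integral_eq_of_IsFiniteMeasure fun f => ?_
  set M := μ.real Set.univ + ν.real Set.univ with hM
  have hM0 : 0 ≤ M := by positivity
  refine eq_of_forall_dist_le fun ε hε => ?_
  obtain ⟨P, hP⟩ := exists_polynomial_near_continuousMap 0 1 f.toContinuousMap (ε / (M + 1))
    (by positivity)
  have hb : ∀ x : I, ‖f x - P.eval (x:ℝ)‖ ≤ ε / (M + 1) := by
    intro x
    have := (ContinuousMap.norm_coe_le_norm (P.toContinuousMapOn _ - f.toContinuousMap) x).trans hP.le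
    rw [norm_sub_rev]
    simpa using this
  have hPm := integrable_cont μ (g := fun x : I => P.eval (x:ℝ)) (by fun_prop)
  have hPn := integrable_cont ν (g := fun x : I => P.eval (x:ℝ)) (by fun_prop)
  have h1 := norm_integral_le_of_norm_le_const (μ := μ) (ae_of_all _ hb)
  have h2 := norm_integral_le_of_norm_le_const (μ := ν) (ae_of_all _ hb)
  rw [integral_sub (f.integrable μ) hPm] at h1
  rw [integral_sub (f.integrable ν) hPn, ← hpoly] at h2
  rw [Real.norm_eq_abs, abs_le] at h1 h2
  have h3 : ε / (M + 1) * M ≤ ε := by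
    rw [div_mul_eq_mul_div, div_le_iff₀ (by positivity)]; nlinarith
  rw [hM, mul_add] at h3
  rw [Real.dist_eq, abs_le]
  constructor <;> linarith [h1.1, h1.2, h2.1, h2.2]

/-- grid point `k/n` in `[0,1]` -/
noncomputable def gridPt (n k : ℕ) : I := Set.projIcc 0 1 zero_le_one ((k:ℝ) / n)

lemma gridPt_coe {n k : ℕ} (hk : k ≤ n) : (gridPt n k : ℝ) = (k:ℝ) / n := by
  have : (k:ℝ) / n ∈ Set.Icc (0:ℝ) 1 :=
    ⟨by positivity, div_le_one_of_le₀ (by exact_mod_cast hk) (by positivity)⟩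
  rw [gridPt, Set.projIcc_of_mem _ this]

noncomputable def bernMeas (f : ℝ → ℝ) (h : ℝ) (n : ℕ) : Measure I :=
  ∑ k ∈ Finset.range (n + 1),
    ENNReal.ofReal (momL f h (bernsteinPolynomial ℝ n k)) • Measure.dirac (gridPt n k)

lemma momL_one (f : ℝ → ℝ) (h : ℝ) : momL f h 1 = f 0 := by
  have := momL_X_pow f h 0
  simpa using this

lemma bernSum {f : ℝ → ℝ} (h1 : f 0 = 1) (h : ℝ) (n : ℕ) :
    ∑ k ∈ Finset.range (n + 1), momL f h (bernsteinPolynomial ℝ n k) = 1 := by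
  rw [← map_sum, bernsteinPolynomial.sum, momL_one, h1]

lemma bernMeas_prob {f : ℝ → ℝ} (hf : SPD f) (h1 : f 0 = 1) {h : ℝ} (hh : 0 ≤ h) (n : ℕ) :
    IsProbabilityMeasure (bernMeas f h n) := by
  constructor
  simp only [bernMeas, Measure.coe_finsetSum, Finset.sum_apply, Measure.smul_apply, measure_univ,
    smul_eq_mul, mul_one]
  rw [← ENNReal.ofReal_sum_of_nonneg (fun k _ => momL_bernstein_nonneg hf hh n k), bernSum h1]
  simp

lemma bernMeas_integral {f : ℝ → ℝ} (hf : SPD f) {h : ℝ} (hh : 0 ≤ h) (n : ℕ)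
    {g : I → ℝ} (hg : Continuous g) :
    ∫ x, g x ∂(bernMeas f h n) =
      ∑ k ∈ Finset.range (n + 1), momL f h (bernsteinPolynomial ℝ n k) * g (gridPt n k) := by
  rw [bernMeas, integral_finsetSum_measure]
  · refine Finset.sum_congr rfl fun k _ => ?_
    rw [integral_smul_measure, integral_dirac, ENNReal.toReal_ofReal
      (momL_bernstein_nonneg hf hh n k), smul_eq_mul]
  · intro k _
    exact (integrable_cont _ hg).smul_measure ENNReal.ofReal_ne_top

lemma bernMeas_tendsto {f : ℝ → ℝ} (hf : SPD f) (h1 : f 0 = 1) {h : ℝ} (hh : 0 ≤ h) (j : ℕ) :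
    Tendsto (fun n => ∫ x : I, (x:ℝ) ^ j ∂(bernMeas f h n)) atTop (𝓝 (f (j * h))) := by
  rw [tendsto_iff_dist_tendsto_zero]
  have hlim : Tendsto (fun n : ℕ => (j:ℝ) ^ 2 / ((n:ℝ) - j)) atTop (𝓝 0) :=
    tendsto_const_nhds.div_atTop (tendsto_atTop_add_const_right _ _ tendsto_natCast_atTop_atTop)
  refine squeeze_zero' (Eventually.of_forall fun n => dist_nonneg) ?_ hlim
  filter_upwards [eventually_gt_atTop j] with n hn
  rw [bernMeas_integral hf hh n (by fun_prop)]
  have hc : (0:ℝ) < n.choose j := by exact_mod_cast Nat.choose_pos hn.le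
  have hm : f (j * h) = ∑ k ∈ Finset.range (n + 1),
      momL f h (bernsteinPolynomial ℝ n k) * ((k.choose j : ℝ) / n.choose j) := by
    have := congrArg (momL f h) (bernstein_choose hn.le)
    rw [map_sum, map_smul, momL_X_pow] at this
    simp only [map_smul, smul_eq_mul] at this
    rw [← mul_right_inj' hc.ne', ← this, Finset.mul_sum]
    refine Finset.sum_congr rfl fun k _ => ?_
    field_simp
  rw [hm, Real.dist_eq, ← Finset.sum_sub_distrib]
  refine (Finset.abs_sum_le_sum_abs _ _).trans ?_
  calc _ ≤ ∑ k ∈ Finset.range (n + 1), momL f h (bernsteinPolynomial ℝ n k) * ((j:ℝ) ^ 2 / (n - j)) := by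
        refine Finset.sum_le_sum fun k hk => ?_
        have hk : k ≤ n := by simpa [Nat.lt_succ_iff] using hk
        rw [← mul_sub, abs_mul, abs_of_nonneg (momL_bernstein_nonneg hf hh n k), gridPt_coe hk]
        exact mul_le_mul_of_nonneg_left (choose_ratio hk j hn) (momL_bernstein_nonneg hf hh n k)
    _ = _ := by rw [← Finset.sum_mul, bernSum h1, one_mul]

lemma hausdorff {f : ℝ → ℝ} (hf : SPD f) (h1 : f 0 = 1) {h : ℝ} (hh : 0 ≤ h) :
    ∃ ν : Measure I, IsProbabilityMeasure ν ∧ ∀ j : ℕ, ∫ x : I, (x:ℝ) ^ j ∂ν = f (j * h) := by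
  let N : ℕ → ProbabilityMeasure I := fun n => ⟨bernMeas f h n, bernMeas_prob hf h1 hh n⟩
  obtain ⟨ν, -, hν⟩ := isCompact_univ.ultrafilter_le_nhds ((hyperfilter ℕ).map N) (by simp)
  refine ⟨ν, inferInstance, fun j => ?_⟩
  have hν : Tendsto N (hyperfilter ℕ : Filter ℕ) (𝓝 ν) := hν
  have t1 := (ProbabilityMeasure.tendsto_iff_forall_integral_tendsto.1 hν)
    (BoundedContinuousFunction.mkOfCompact ⟨fun x : I => (x:ℝ) ^ j, by fun_prop⟩)
  have t2 := (bernMeas_tendsto hf h1 hh j).mono_left Nat.hyperfilter_le_atTop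
  exact tendsto_nhds_unique t1 t2

/-- Bernstein-type theorem for semigroup-positive-definite functions. -/
lemma bernstein_repr {f : ℝ → ℝ} (hf : SPD f) (h1 : f 0 = 1) :
    ∃ ν : Measure I, IsProbabilityMeasure ν ∧ ∀ s : ℝ, 0 ≤ s → ∫ x : I, (x:ℝ) ^ s ∂ν = f s := by
  obtain ⟨ν, hνp, hν⟩ := hausdorff hf h1 zero_le_one
  refine ⟨ν, hνp, ?_⟩
  have hq : ∀ (j N : ℕ), 0 < N → ∫ x : I, (x:ℝ) ^ ((j:ℝ) / N) ∂ν = f (j / N) := by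
    intro j N hN
    have hN0 : (N:ℝ) ≠ 0 := by positivity
    obtain ⟨ρ, hρp, hρ⟩ := hausdorff hf h1 (h := 1 / (N:ℝ)) (by positivity)
    have hcont : Continuous (fun x : I => x ^ N) := by fun_prop
    have hmap : ν = ρ.map (fun x : I => x ^ N) := by
      have : IsFiniteMeasure (ρ.map (fun x : I => x ^ N)) := Measure.isFiniteMeasure_map _ _
      refine moment_unique fun n => ?_
      rw [integral_map hcont.measurable.aemeasurable
        (by fun_prop : Continuous fun x : I => (x:ℝ) ^ n).aestronglyMeasurable, hν]
      have := hρ (N * n)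
      simp only [Set.Icc.coe_pow, ← pow_mul]
      rw [this]; congr 1; push_cast; field_simp
    have hc2 : Continuous (fun x : I => (x:ℝ) ^ ((j:ℝ) / N)) := by
      refine continuous_subtype_val.rpow_const fun x => Or.inr (by positivity)
    rw [hmap, integral_map hcont.measurable.aemeasurable hc2.aestronglyMeasurable]
    rw [show (j:ℝ) / N = j * (1 / N) by ring, ← hρ j]
    refine integral_congr_ae (ae_of_all _ fun x => ?_)
    have hx : (0:ℝ) ≤ x := x.2.1
    simp only [Set.Icc.coe_pow]
    rw [← Real.rpow_natCast, ← Real.rpow_mul hx, ← Real.rpow_natCast]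
    congr 1; field_simp
  have hrat : ∀ q : ℚ, 0 ≤ q → ∫ x : I, (x:ℝ) ^ (q:ℝ) ∂ν = f q := by
    intro q hq0
    have := hq q.num.toNat q.den q.den_pos
    have e : ((q.num.toNat : ℝ) / q.den) = q := by
      have h2 : ((q.num.toNat : ℤ) : ℝ) = (q.num : ℝ) := by
        rw [Int.toNat_of_nonneg (Rat.num_nonneg.2 hq0)]
      rw [Int.cast_natCast] at h2
      rw [h2]; exact (Rat.cast_def q).symm
    rwa [e] at this
  intro s hs
  rcases hs.eq_or_lt with rfl | hs
  · simp [h1]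
  have hcontF : ContinuousAt (fun t : ℝ => ∫ x : I, (x:ℝ) ^ t ∂ν) s := by
    refine continuousAt_of_dominated (bound := fun _ => 1) ?_ ?_ (integrable_const _) ?_
    · filter_upwards [lt_mem_nhds hs] with t ht
      exact (continuous_subtype_val.rpow_const fun x => Or.inr ht.le).aestronglyMeasurable
    · filter_upwards [lt_mem_nhds hs] with t ht
      refine ae_of_all _ fun x => ?_
      rw [Real.norm_eq_abs, abs_of_nonneg (Real.rpow_nonneg x.2.1 _)]
      exact Real.rpow_le_one x.2.1 x.2.2 ht.le
    · exact ae_of_all _ fun x => Real.continuousAt_const_rpow' hs.ne'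
  refine eq_of_forall_dist_le fun ε hε => ?_
  obtain ⟨δ, hδ, hF⟩ := Metric.continuousAt_iff.1 hcontF ε hε
  obtain ⟨q, hq1, hq2⟩ := exists_rat_btwn (max_lt (sub_lt_self s hδ) hs)
  obtain ⟨r, hr1, hr2⟩ := exists_rat_btwn (lt_add_of_pos_right s hδ)
  have hq0 : (0:ℝ) < q := (le_max_right _ _).trans_lt hq1
  have hqδ := (le_max_left (s - δ) 0).trans_lt hq1
  have d1 := hF (x := (q:ℝ)) (by rw [Real.dist_eq, abs_lt]; constructor <;> linarith)
  have d2 := hF (x := (r:ℝ)) (by rw [Real.dist_eq, abs_lt]; constructor <;> linarith)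
  rw [hrat q (by exact_mod_cast hq0.le), Real.dist_eq, abs_lt] at d1
  rw [hrat r (by exact_mod_cast (hs.trans hr1).le), Real.dist_eq, abs_lt] at d2
  have m1 := hf.anti hq0.le hq2.le
  have m2 := hf.anti hs.le hr1.le
  rw [Real.dist_eq, abs_le]
  constructor <;> linarith [d1.1, d1.2, d2.1, d2.2]

end Moment

/-! ### Change of variables and conclusion -/

section Final
open Filter Topology unitInterval

/-- `y ↦ -log y` -/
noncomputable def toIci (y : I) : Set.Ici (0:ℝ) :=
  ⟨-Real.log y, by
    have := Real.log_nonpos y.2.1 y.2.2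
    simp only [Set.mem_Ici]; linarith⟩

/-- `t ↦ exp (-t)` -/
noncomputable def toI (t : Set.Ici (0:ℝ)) : I :=
  ⟨Real.exp (-t), (Real.exp_pos _).le, Real.exp_le_one_iff.2 (by
    have : (0:ℝ) ≤ t := t.2
    linarith)⟩

lemma measurable_toIci : Measurable toIci :=
  ((Real.measurable_log.comp measurable_subtype_coe).neg).subtype_mk

lemma measurable_toI : Measurable toI :=
  (Real.measurable_exp.comp measurable_subtype_coe.neg).subtype_mk

lemma toIci_toI (t : Set.Ici (0:ℝ)) : toIci (toI t) = t := by
  ext; simp [toIci, toI]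

lemma laplace_bound (s : ℝ) (hs : 0 ≤ s) (t : Set.Ici (0:ℝ)) :
    ‖Real.exp (-(t:ℝ) * s)‖ ≤ 1 := by
  rw [Real.norm_of_nonneg (Real.exp_pos _).le, Real.exp_le_one_iff]
  have : (0:ℝ) ≤ t := t.2
  nlinarith

lemma laplace_meas (s : ℝ) : Measurable (fun t : Set.Ici (0:ℝ) => Real.exp (-(t:ℝ) * s)) := by
  fun_prop

lemma laplace_int (μ : Measure (Set.Ici (0:ℝ))) [IsFiniteMeasure μ] (s : ℝ) (hs : 0 ≤ s) :
    Integrable (fun t : Set.Ici (0:ℝ) => Real.exp (-(t:ℝ) * s)) μ :=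
  Integrable.of_bound (laplace_meas s).aestronglyMeasurable 1
    (Eventually.of_forall (laplace_bound s hs))

lemma laplace_tendsto (μ : Measure (Set.Ici (0:ℝ))) [IsFiniteMeasure μ] :
    Tendsto (fun n : ℕ => ∫ t : Set.Ici (0:ℝ), Real.exp (-(t:ℝ) * (1 / ((n:ℝ) + 1))) ∂μ) atTop
      (𝓝 (∫ t : Set.Ici (0:ℝ), Real.exp (-(t:ℝ) * 0) ∂μ)) := by
  refine tendsto_integral_of_dominated_convergence (fun _ => 1)
    (fun n => (laplace_meas _).aestronglyMeasurable) (integrable_const _)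
    (fun n => Eventually.of_forall (laplace_bound _ (by positivity)))
    (Eventually.of_forall fun t => ?_)
  exact (Real.continuous_exp.tendsto _).comp
    (tendsto_const_nhds.mul tendsto_one_div_add_atTop_nhds_zero_nat)

lemma laplace_unique (μ ν : Measure (Set.Ici (0:ℝ))) [IsFiniteMeasure μ] [IsFiniteMeasure ν]
    (h : ∀ s : ℝ, 0 < s → ∫ t : Set.Ici (0:ℝ), Real.exp (-(t:ℝ) * s) ∂μ
      = ∫ t : Set.Ici (0:ℝ), Real.exp (-(t:ℝ) * s) ∂ν) : μ = ν := by
  have h0 : ∫ t : Set.Ici (0:ℝ), Real.exp (-(t:ℝ) * 0) ∂μ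
      = ∫ t : Set.Ici (0:ℝ), Real.exp (-(t:ℝ) * 0) ∂ν := by
    refine tendsto_nhds_unique (laplace_tendsto μ) ?_
    refine (laplace_tendsto ν).congr fun n => ?_
    exact (h _ (by positivity)).symm
  have key : ∀ (ρ : Measure (Set.Ici (0:ℝ))) (n : ℕ),
      ∫ x : I, (x:ℝ)^n ∂(ρ.map toI) = ∫ t : Set.Ici (0:ℝ), Real.exp (-(t:ℝ) * n) ∂ρ := by
    intro ρ n
    rw [integral_map measurable_toI.aemeasurable
      (Measurable.aestronglyMeasurable (by fun_prop))]
    refine integral_congr_ae (Eventually.of_forall fun t => ?_)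
    simp only [toI]
    rw [← Real.exp_nat_mul]; ring_nf
  have hm : μ.map toI = ν.map toI := by
    refine moment_unique fun n => ?_
    rw [key, key]
    rcases Nat.eq_zero_or_pos n with rfl | hn
    · simpa using h0
    · exact h _ (by exact_mod_cast hn)
  have back : ∀ ρ : Measure (Set.Ici (0:ℝ)), (ρ.map toI).map toIci = ρ := by
    intro ρ
    rw [Measure.map_map measurable_toIci measurable_toI]
    have : toIci ∘ toI = id := funext toIci_toI
    rw [this, Measure.map_id]
  rw [← back μ, hm, back ν]

lemma laplace_exists (ν : Measure I) [IsProbabilityMeasure ν] :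
    ∃ (μ : Measure (Set.Ici (0 : ℝ))) (b : ℝ), IsFiniteMeasure μ ∧ 0 ≤ b ∧
      (∀ s : ℝ, 0 < s → ∫ x : I, (x:ℝ) ^ s ∂ν
        = ∫ t : Set.Ici (0:ℝ), Real.exp (-(t:ℝ) * s) ∂μ) ∧
      (∫ t : Set.Ici (0:ℝ), Real.exp (-(t:ℝ) * 0) ∂μ) + b = 1 := by
  have hms : MeasurableSet ({0}ᶜ : Set I) := (measurableSet_singleton 0).compl
  have key : ∀ s : ℝ, ∫ t : Set.Ici (0:ℝ), Real.exp (-(t:ℝ) * s) ∂((ν.restrict {0}ᶜ).map toIci)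
      = ∫ x : I in {0}ᶜ, (x:ℝ) ^ s ∂ν := by
    intro s
    rw [integral_map measurable_toIci.aemeasurable (laplace_meas s).aestronglyMeasurable]
    refine setIntegral_congr_fun hms fun x hx => ?_
    have hx0 : (0:ℝ) < x := lt_of_le_of_ne x.2.1 fun h => hx (Subtype.ext h.symm)
    simp only [toIci, neg_neg]
    rw [Real.rpow_def_of_pos hx0]
  refine ⟨(ν.restrict {0}ᶜ).map toIci, ν.real {0}, inferInstance, measureReal_nonneg, ?_, ?_⟩
  · intro s hs
    rw [key s]
    symm
    refine setIntegral_eq_integral_of_forall_compl_eq_zero fun x hx => ?_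
    have : x = 0 := by simpa using hx
    subst this
    simp [Real.zero_rpow hs.ne']
  · rw [key 0]
    simp only [Real.rpow_zero, integral_const, smul_eq_mul, mul_one, measureReal_restrict_apply_univ]
    have := probReal_add_probReal_compl (μ := ν) (measurableSet_singleton (0 : I))
    linarith

end Final

/-- A radial (w.r.t. `‖·‖_p^p`, `0 < p ≤ 2`) function on the free product `ℝ_∞` of
countably many copies of `ℝ` with `φ(e) = 1` is positive definite iff
`φ(r) = ∫_0^∞ e^{−t‖r‖_p^p} dμ(t) + b·χ_{{e}}(r)` for some finite positive Borel measure
`μ` on `[0,∞)` and some `b ≥ 0`; moreover `μ` is then uniquely determined by `φ`. -/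
theorem posDef_iff_laplace_lppFree
    (p : ℝ) (hp0 : 0 < p) (hp2 : p ≤ 2)
    (φ : Monoid.CoprodI (fun _ : ℕ => Multiplicative ℝ) → ℝ)
    (hrad : ∃ φdot : ℝ → ℝ,
      ∀ r : Monoid.CoprodI (fun _ : ℕ => Multiplicative ℝ), φ r = φdot (lppFree p r))
    (hone : φ 1 = 1) :
    (IsPositiveDefinite φ ↔
      ∃ (μ : Measure (Set.Ici (0 : ℝ))) (b : ℝ), IsFiniteMeasure μ ∧ 0 ≤ b ∧
        ∀ r : Monoid.CoprodI (fun _ : ℕ => Multiplicative ℝ),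
          φ r = (∫ t : Set.Ici (0 : ℝ), Real.exp (-(t : ℝ) * lppFree p r) ∂μ)
            + Set.indicator ({1} : Set (Monoid.CoprodI (fun _ : ℕ => Multiplicative ℝ)))
                (fun _ => b) r) ∧
    ∀ (μ₁ μ₂ : Measure (Set.Ici (0 : ℝ))) (b₁ b₂ : ℝ),
      IsFiniteMeasure μ₁ → IsFiniteMeasure μ₂ → 0 ≤ b₁ → 0 ≤ b₂ →
      (∀ r : Monoid.CoprodI (fun _ : ℕ => Multiplicative ℝ),
        φ r = (∫ t : Set.Ici (0 : ℝ), Real.exp (-(t : ℝ) * lppFree p r) ∂μ₁)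
          + Set.indicator ({1} : Set (Monoid.CoprodI (fun _ : ℕ => Multiplicative ℝ)))
              (fun _ => b₁) r) →
      (∀ r : Monoid.CoprodI (fun _ : ℕ => Multiplicative ℝ),
        φ r = (∫ t : Set.Ici (0 : ℝ), Real.exp (-(t : ℝ) * lppFree p r) ∂μ₂)
          + Set.indicator ({1} : Set (Monoid.CoprodI (fun _ : ℕ => Multiplicative ℝ)))
              (fun _ => b₂) r) →
      μ₁ = μ₂ := by
  classical
  refine ⟨⟨fun h => ?_, ?_⟩, ?_⟩
  · obtain ⟨f, hf⟩ := hrad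
    have hf0 : f 0 = 1 := by rw [← lppFree_one p, ← hf, hone]
    obtain ⟨ν, hν, hrep⟩ := bernstein_repr (spd_of_pd hp0 hf h hone) hf0
    obtain ⟨μ, b, hμ, hb, h1, h2⟩ := laplace_exists ν
    refine ⟨μ, b, hμ, hb, fun r => ?_⟩
    by_cases hr : r = 1
    · subst hr
      rw [hone, lppFree_one, Set.indicator_of_mem (Set.mem_singleton _), h2]
    · have hpos := lppFree_pos p hr
      rw [hf, Set.indicator_of_notMem (by simpa using hr), add_zero, ← h1 _ hpos,
        hrep _ hpos.le]
  · rintro ⟨μ, b, hμ, hb, h⟩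
    have hK : PSDK (fun x y : FGrp => φ (x⁻¹ * y)) := by
      have h1 : PSDK (fun x y : FGrp =>
          ∫ t : Set.Ici (0 : ℝ), Real.exp (-(t : ℝ) * lppFree p (x⁻¹ * y)) ∂μ) :=
        PSDK.integral μ (fun (t : Set.Ici (0:ℝ)) (x y : FGrp) =>
          Real.exp (-(t : ℝ) * lppFree p (x⁻¹ * y)))
          (Filter.Eventually.of_forall fun t => psdk_lpp hp0 hp2 t.2)
          (fun x y => laplace_int μ _ (lppFree_nonneg p _))
      have h2 := h1.add (PSDK.smul hb (PSDK.delta (X := FGrp)))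
      convert h2 using 3 with x y
      rw [h]
      congr 1
      by_cases hxy : x = y
      · simp [hxy]
      · simp [hxy, Set.indicator, inv_mul_eq_one]
    intro n x c
    exact hK.complex n x c
  · intro μ₁ μ₂ b₁ b₂ hμ₁ hμ₂ _ _ h1 h2
    refine laplace_unique μ₁ μ₂ fun s hs => ?_
    obtain ⟨r, hr⟩ := exists_lppFree hp0 hs.le
    have hr1 : r ≠ 1 := by
      rintro rfl
      rw [lppFree_one] at hr
      exact hs.ne hr
    have e1 := h1 r
    have e2 := h2 r
    rw [Set.indicator_of_notMem (by simpa using hr1), add_zero, hr] at e1 e2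
    rw [← e1, ← e2]
end

section
/- Fix 0 < p ≤ 2 and let ℝ_∞ be the free product of countably many copies of the additive group ℝ. Let ψ : ℝ_∞ → ℝ be a function radial with respect to ‖·‖_p^p with ψ(e) = 0. Then ψ is conditionally negative definite and bounded below on ℝ_∞ if and only if there exist constants b, c ≥ 0 and a positive Borel measure ν on (0, ∞) with ∫_0^∞ (1 − e^{−t}) dν(t) < ∞ such that ψ(r) = c‖r‖_p^p + b·χ_{ℝ_∞∖{e}}(r) + ∫_0^∞ (1 − e^{−t ‖r‖_p^p}) dν(t) for all r ∈ ℝ_∞; moreover, when they exist, b, c, and ν are uniquely determined by ψ. -/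
open ComplexOrder

/-- A real-valued function on a group is conditionally negative definite. -/
def IsCondNegDef {G : Type*} [Group G] (ψ : G → ℝ) : Prop :=
  (∀ g : G, ψ g⁻¹ = ψ g) ∧
    ∀ (n : ℕ) (x : Fin n → G) (c : Fin n → ℂ), (∑ j, c j) = 0 →
      ∑ j, ∑ k, c j * (starRingEnd ℂ) (c k) * (ψ ((x j)⁻¹ * x k) : ℂ) ≤ 0

open MeasureTheory

section
namespace LK

/-- A (real) conditionally negative definite kernel. -/
def CNK {X : Type*} (K : X → X → ℝ) : Prop :=
  ∀ (ι : Type) [Fintype ι] (x : ι → X) (c : ι → ℝ), ∑ i, c i = 0 →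
    ∑ i, ∑ j, c i * c j * K (x i) (x j) ≤ 0

abbrev FP := Monoid.CoprodI (fun _ : ℕ => Multiplicative ℝ)
abbrev Ltr := (Σ _ : ℕ, Multiplicative ℝ)

noncomputable def nrm (p : ℝ) (a : Ltr) : ℝ := |Multiplicative.toAdd a.2| ^ p

noncomputable def len (p : ℝ) (l : List Ltr) : ℝ := (l.map (nrm p)).sum

noncomputable def ev (k : ℕ) : List Ltr → ℝ
  | [] => 0
  | a :: _ => if a.1 = k then Multiplicative.toAdd a.2 else 0

open Classical in
noncomputable def tl (a : Ltr) : List Ltr → List Ltr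
  | [] => []
  | b :: l => if b = a then l else []

open Classical in
noncomputable def dst (p : ℝ) : List Ltr → List Ltr → ℝ
  | [], v => len p v
  | a :: u, [] => len p (a :: u)
  | a :: u, b :: v => if a = b then dst p u v else
      (if a.1 = b.1 then |Multiplicative.toAdd a.2 - Multiplicative.toAdd b.2| ^ p
        else nrm p a + nrm p b) + (len p u + len p v)

lemma len_nil (p : ℝ) : len p [] = 0 := rfl
lemma len_cons (p : ℝ) (a : Ltr) (l) : len p (a :: l) = nrm p a + len p l := by simp [len]

lemma dst_nil_right (p : ℝ) (u) : dst p u [] = len p u := by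
  cases u <;> simp [dst]

lemma dst_nil_left (p : ℝ) (u) : dst p [] u = len p u := by
  simp [dst]

lemma dst_comm (p : ℝ) (u v) : dst p u v = dst p v u := by
  induction u generalizing v with
  | nil => rw [dst_nil_right, dst_nil_left]
  | cons a u ih =>
    cases v with
    | nil => rw [dst_nil_right, dst_nil_left]
    | cons b v =>
      unfold dst
      by_cases h : a = b
      · subst h; simp [ih]
      · rw [if_neg h, if_neg (Ne.symm h)]
        by_cases h1 : a.1 = b.1
        · rw [if_pos h1, if_pos h1.symm, abs_sub_comm]; ring
        · rw [if_neg h1, if_neg (Ne.symm h1)]; ring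

open Classical in
lemma dst_decomp (p : ℝ) (hp : 0 < p) (I : Finset ℕ) (A : Finset Ltr) (u v : List Ltr)
    (hu : ∀ a ∈ u.head?, a ∈ A) (hv : ∀ a ∈ v.head?, a ∈ A)
    (hu' : ∀ a ∈ u.head?, a.1 ∈ I) (hv' : ∀ a ∈ v.head?, a.1 ∈ I) :
    dst p u v = ∑ k ∈ I, |ev k u - ev k v| ^ p + ∑ a ∈ A, dst p (tl a u) (tl a v) := by
  have h0 : (0:ℝ) ^ p = 0 := Real.zero_rpow hp.ne'
  have hc : ∀ a : Ltr, a.1 ∈ I → ∀ w, ∑ k ∈ I, |ev k (a :: w)| ^ p = nrm p a := by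
    intro a ha w
    rw [Finset.sum_eq_single a.1]
    · simp [ev, nrm]
    · intro b _ hb; simp [ev, hb.symm, h0]
    · intro h; exact absurd ha h
  have hd : ∀ a : Ltr, a ∈ A → ∀ w, ∑ k ∈ A, len p (tl k (a :: w)) = len p w := by
    intro a ha w
    rw [Finset.sum_eq_single a]
    · simp [tl]
    · intro b _ hb; simp [tl, hb.symm, len_nil]
    · intro h; exact absurd ha h
  cases u with
  | nil =>
    cases v with
    | nil => simp [dst, len, ev, tl, h0]
    | cons b v =>
      simp only [dst_nil_left]
      have : ∀ k, tl k [] = [] := fun k => rfl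
      simp only [this, dst_nil_left]
      rw [hd b (by simpa using hv)]
      simp only [show ∀ k, ev k [] = 0 from fun k => rfl, zero_sub, abs_neg]
      rw [hc b (by simpa using hv'), len_cons]
  | cons a u =>
    cases v with
    | nil =>
      simp only [dst_nil_right]
      have : ∀ k, tl k [] = [] := fun k => rfl
      simp only [this, dst_nil_right]
      rw [hd a (by simpa using hu)]
      simp only [show ∀ k, ev k [] = 0 from fun k => rfl, sub_zero]
      rw [hc a (by simpa using hu'), len_cons]
    | cons b v =>
      have ha : a ∈ A := by simpa using hu
      have hb : b ∈ A := by simpa using hv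
      have ha' : a.1 ∈ I := by simpa using hu'
      have hb' : b.1 ∈ I := by simpa using hv'
      by_cases h : a = b
      · subst h
        have e1 : ∑ k ∈ I, |ev k (a :: u) - ev k (a :: v)| ^ p = 0 := by
          apply Finset.sum_eq_zero; intro k _; simp [ev, h0]
        rw [e1, Finset.sum_eq_single a]
        · simp [tl, dst]
        · intro c _ hc; simp [tl, hc.symm, dst_nil_left, len_nil]
        · intro h; exact absurd ha h
      · rw [dst, if_neg h]
        congr 1
        · by_cases h1 : a.1 = b.1
          · rw [if_pos h1, Finset.sum_eq_single a.1]
            · simp [ev, h1]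
            · intro k _ hk; simp [ev, ← h1, hk.symm, h0]
            · intro h; exact absurd ha' h
          · rw [if_neg h1, ← hc a ha' u, ← hc b hb' v, ← Finset.sum_add_distrib]
            apply Finset.sum_congr rfl
            intro k _
            by_cases hk : a.1 = k
            · have : b.1 ≠ k := by rintro rfl; exact h1 hk
              simp [ev, hk, this, h0]
            · simp [ev, hk, h0]
        · rw [← hd a ha u, ← hd b hb v, ← Finset.sum_add_distrib]
          apply Finset.sum_congr rfl
          intro k _
          by_cases hk : a = k
          · have : b ≠ k := by rintro rfl; exact h hk
            simp [tl, hk, this, dst_nil_right, len_nil]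
          · simp [tl, hk, dst_nil_left, len_nil]

lemma tl_length (a : Ltr) (u : List Ltr) (n : ℕ) (h : u.length ≤ n + 1) : (tl a u).length ≤ n := by
  cases u with
  | nil => simp [tl]
  | cons b u =>
    by_cases hb : b = a
    · simpa [tl, hb] using h
    · simp [tl, hb]

lemma cnk_dst (p : ℝ) (hp : 0 < p) (hR : CNK (fun x y : ℝ => |x - y| ^ p)) : CNK (dst p) := by
  classical
  have key : ∀ (n : ℕ) (ι : Type) [Fintype ι] (x : ι → List Ltr) (c : ι → ℝ),
      (∀ i, (x i).length ≤ n) → ∑ i, c i = 0 →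
      ∑ i, ∑ j, c i * c j * dst p (x i) (x j) ≤ 0 := by
    intro n
    induction n with
    | zero =>
      intro ι _ x c hx hc
      have : ∀ i, x i = [] := fun i => by simpa using hx i
      simp [this, dst_nil_left, len_nil]
    | succ n ih =>
      intro ι _ x c hx hc
      set A : Finset Ltr := Finset.univ.biUnion (fun i => (x i).head?.toFinset) with hA
      set I : Finset ℕ := A.image Sigma.fst with hI
      have h1 : ∀ i, ∀ a ∈ (x i).head?, a ∈ A := by
        intro i a ha
        rw [hA, Finset.mem_biUnion]
        exact ⟨i, Finset.mem_univ _, by simpa using ha⟩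
      have h2 : ∀ i, ∀ a ∈ (x i).head?, a.1 ∈ I := fun i a ha =>
        Finset.mem_image_of_mem _ (h1 i a ha)
      have e : ∑ i, ∑ j, c i * c j * dst p (x i) (x j) =
          ∑ k ∈ I, ∑ i, ∑ j, c i * c j * |ev k (x i) - ev k (x j)| ^ p +
          ∑ a ∈ A, ∑ i, ∑ j, c i * c j * dst p (tl a (x i)) (tl a (x j)) := by
        rw [Finset.sum_comm (s := I), Finset.sum_comm (s := A), ← Finset.sum_add_distrib]
        apply Finset.sum_congr rfl; intro i _
        rw [Finset.sum_comm (s := I), Finset.sum_comm (s := A), ← Finset.sum_add_distrib]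
        apply Finset.sum_congr rfl; intro j _
        rw [dst_decomp p hp I A (x i) (x j) (h1 i) (h1 j) (h2 i) (h2 j), mul_add,
          Finset.mul_sum, Finset.mul_sum]
      rw [e]
      have := Finset.sum_nonpos (s := I) (fun k _ => hR ι (fun i => ev k (x i)) c hc)
      have := Finset.sum_nonpos (s := A) (fun a _ => ih ι (fun i => tl a (x i)) c
        (fun i => tl_length a _ n (hx i)) hc)
      linarith
  intro ι _ x c hc
  exact key (∑ i, (x i).length) ι x c
    (fun i => Finset.single_le_sum (f := fun i => (x i).length) (fun _ _ => Nat.zero_le _)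
      (Finset.mem_univ i)) hc

/-! ### Reduced words -/

def Red (l : List Ltr) : Prop :=
  (∀ a ∈ l, a.2 ≠ 1) ∧ l.IsChain (fun a b => a.1 ≠ b.1)

def pr (l : List Ltr) : FP := (l.map (fun a => Monoid.CoprodI.of (M := fun _ : ℕ => Multiplicative ℝ) (i := a.1) a.2)).prod

def inv (l : List Ltr) : List Ltr := (l.map (fun a => (⟨a.1, a.2⁻¹⟩ : Ltr))).reverse

lemma lpp_pr (p : ℝ) (l : List Ltr) (h : Red l) : lppFree p (pr l) = len p l := by
  have : pr l = Monoid.CoprodI.Word.equiv.symm ⟨l, h.1, h.2⟩ := rfl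
  rw [this, lppFree, Equiv.apply_symm_apply]
  rfl

lemma pr_word (g : FP) : pr (Monoid.CoprodI.Word.equiv g).toList = g :=
  Monoid.CoprodI.Word.equiv.symm_apply_apply g

lemma red_word (g : FP) : Red (Monoid.CoprodI.Word.equiv g).toList :=
  ⟨(Monoid.CoprodI.Word.equiv g).ne_one, (Monoid.CoprodI.Word.equiv g).chain_ne⟩

lemma pr_inv (l : List Ltr) : pr (inv l) = (pr l)⁻¹ := by
  induction l with
  | nil => simp [pr, inv]
  | cons a l ih =>
    have e : inv (a :: l) = inv l ++ [⟨a.1, a.2⁻¹⟩] := by simp [inv]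
    rw [e]
    have e2 : pr (inv l ++ [⟨a.1, a.2⁻¹⟩]) = pr (inv l) * pr [⟨a.1, a.2⁻¹⟩] := by simp [pr]
    rw [e2, ih]
    simp [pr]

lemma red_inv (l : List Ltr) (h : Red l) : Red (inv l) := by
  refine ⟨?_, ?_⟩
  · intro a ha
    simp only [inv, List.mem_reverse, List.mem_map] at ha
    obtain ⟨b, hb, rfl⟩ := ha
    simpa using h.1 b hb
  · rw [inv, List.isChain_reverse, List.isChain_map]
    exact h.2.imp (fun a b hab => hab.symm)

lemma len_append (p : ℝ) (u v) : len p (u ++ v) = len p u + len p v := by simp [len]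

lemma len_inv (p : ℝ) (u) : len p (inv u) = len p u := by
  simp only [len, inv, List.map_reverse, List.sum_reverse, List.map_map]
  congr 2
  funext a
  simp [nrm]

lemma pr_append (u v) : pr (u ++ v) = pr u * pr v := by simp [pr]

lemma red_append {u v : List Ltr} (hu : Red u) (hv : Red v)
    (h : ∀ a ∈ u.getLast?, ∀ b ∈ v.head?, a.1 ≠ b.1) : Red (u ++ v) := by
  refine ⟨?_, ?_⟩
  · intro a ha
    rcases List.mem_append.1 ha with h | h
    · exact hu.1 a h
    · exact hv.1 a h
  · rw [List.isChain_append]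
    exact ⟨hu.2, hv.2, h⟩

lemma red_tail {a : Ltr} {u} (h : Red (a :: u)) : Red u :=
  ⟨fun b hb => h.1 b (List.mem_cons_of_mem _ hb), h.2.tail⟩

lemma getLast_inv (u : List Ltr) : ∀ a ∈ (inv u).getLast?, ∃ b ∈ u.head?, b.1 = a.1 := by
  intro a ha
  rw [inv, List.getLast?_reverse] at ha
  cases u with
  | nil => simp at ha
  | cons b u =>
    simp at ha
    exact ⟨b, by simp, by rw [← ha]⟩

lemma head_ne {a : Ltr} {u} (h : Red (a :: u)) : ∀ b ∈ u.head?, a.1 ≠ b.1 := by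
  have := h.2
  rw [List.isChain_cons] at this
  exact this.1

lemma lpp_pr_inv_mul (p : ℝ) (u v : List Ltr) (hu : Red u) (hv : Red v) :
    lppFree p ((pr u)⁻¹ * pr v) = dst p u v := by
  induction u generalizing v with
  | nil =>
    rw [show pr [] = 1 from rfl, inv_one, one_mul, lpp_pr p v hv, dst_nil_left]
  | cons a u ih =>
    cases v with
    | nil =>
      rw [show pr [] = 1 from rfl, mul_one, ← pr_inv, lpp_pr p _ (red_inv _ hu), len_inv,
        dst_nil_right]
    | cons b v =>
      by_cases h : a = b
      · subst h
        rw [dst, if_pos rfl, ← ih v (red_tail hu) (red_tail hv)]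
        congr 1
        simp [pr, mul_assoc]
      · rw [dst, if_neg h]
        by_cases h1 : a.1 = b.1
        · rw [if_pos h1]
          obtain ⟨i, x⟩ := a
          obtain ⟨j, y⟩ := b
          obtain rfl : i = j := h1
          have hxy : x ≠ y := fun e => h (by rw [e])
          have hr : Red (inv u ++ ((⟨i, x⁻¹ * y⟩ : Ltr) :: v)) := by
            apply red_append (red_inv _ (red_tail hu))
            · refine ⟨?_, ?_⟩
              · intro c hc
                rcases List.mem_cons.1 hc with rfl | hc
                · intro h
                  exact hxy (inv_mul_eq_one.1 h)
                · exact (red_tail hv).1 c hc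
              · rw [List.isChain_cons]
                exact ⟨fun c hc => head_ne hv c hc, (red_tail hv).2⟩
            · intro c hc d hd
              obtain ⟨e, he, hec⟩ := getLast_inv u c hc
              have := head_ne hu e he
              simp at hd
              subst hd
              rw [← hec]
              exact this.symm
          have := lpp_pr p _ hr
          rw [len_append, len_cons, len_inv, pr_append, pr_inv] at this
          have e : (pr (⟨i, x⟩ :: u))⁻¹ * pr (⟨i, y⟩ :: v) =
              (pr u)⁻¹ * pr (⟨i, x⁻¹ * y⟩ :: v) := by
            simp [pr]; group
          rw [e, this]
          simp only [nrm, toAdd_mul, toAdd_inv]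
          rw [← abs_neg (Multiplicative.toAdd x - Multiplicative.toAdd y)]
          rw [show -(Multiplicative.toAdd x - Multiplicative.toAdd y)
            = -Multiplicative.toAdd x + Multiplicative.toAdd y by ring]
          ring
        · rw [if_neg h1]
          have hr : Red (inv (a :: u) ++ (b :: v)) := by
            apply red_append (red_inv _ hu) hv
            intro c hc d hd
            obtain ⟨e, he, hec⟩ := getLast_inv _ c hc
            simp at hd he
            subst hd he
            rw [← hec]; exact h1
          have := lpp_pr p _ hr
          rw [len_append, len_inv, pr_append, pr_inv] at this
          rw [this, len_cons, len_cons]; ring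

lemma lpp_inv_mul (p : ℝ) (g h : FP) : lppFree p (g⁻¹ * h) =
    dst p (Monoid.CoprodI.Word.equiv g).toList (Monoid.CoprodI.Word.equiv h).toList := by
  rw [← lpp_pr_inv_mul p _ _ (red_word g) (red_word h), pr_word, pr_word]

lemma lpp_one (p : ℝ) : lppFree p (1 : FP) = 0 := by
  have := lpp_pr p [] ⟨by simp, by simp⟩
  simpa [pr, len] using this

lemma lpp_inv (p : ℝ) (g : FP) : lppFree p g⁻¹ = lppFree p g := by
  have h1 := lpp_inv_mul p g 1
  have h2 := lpp_inv_mul p 1 g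
  rw [mul_one] at h1
  rw [inv_one, one_mul] at h2
  rw [h1, h2, dst_comm]

lemma lpp_eq_zero (p : ℝ) (g : FP) : lppFree p g = 0 ↔ g = 1 := by
  refine ⟨fun h => ?_, fun h => by rw [h, lpp_one]⟩
  have hr := red_word g
  rw [← pr_word g, lpp_pr p _ hr] at h
  rw [← pr_word g]
  cases hl : (Monoid.CoprodI.Word.equiv g).toList with
  | nil => rfl
  | cons a l =>
    exfalso
    rw [hl, len_cons] at h
    rw [hl] at hr
    have h1 : 0 < nrm p a := by
      have : Multiplicative.toAdd a.2 ≠ 0 := fun h => hr.1 a (by simp) (by simpa using h)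
      unfold nrm; positivity
    have h2 : 0 ≤ len p l := by
      apply List.sum_nonneg
      intro x hx
      simp only [List.mem_map] at hx
      obtain ⟨b, _, rfl⟩ := hx
      unfold nrm; positivity
    linarith

lemma lpp_nonneg (p : ℝ) (g : FP) : 0 ≤ lppFree p g := by
  apply List.sum_nonneg
  intro x hx
  simp only [List.mem_map] at hx
  obtain ⟨b, _, rfl⟩ := hx
  positivity

/-- the element `x` of the `i`-th copy -/
def lt (i : ℕ) (x : ℝ) : FP :=
  Monoid.CoprodI.of (M := fun _ : ℕ => Multiplicative ℝ) (i := i) (Multiplicative.ofAdd x)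

lemma lt_zero (i : ℕ) : lt i 0 = 1 := by simp [lt]

lemma lpp_lt (p : ℝ) (hp : 0 < p) (i : ℕ) (x : ℝ) : lppFree p (lt i x) = |x| ^ p := by
  by_cases hx : x = 0
  · subst hx; rw [lt_zero, lpp_one]; simp [Real.zero_rpow hp.ne']
  · have := lpp_pr p [⟨i, Multiplicative.ofAdd x⟩] ⟨by simpa using hx, by simp⟩
    simpa [pr, len, nrm, lt] using this

lemma lpp_lt_lt (p : ℝ) (hp : 0 < p) (i j : ℕ) (hij : i ≠ j) (x y : ℝ) :
    lppFree p ((lt i x)⁻¹ * lt j y) = |x| ^ p + |y| ^ p := by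
  by_cases hx : x = 0
  · subst hx; rw [lt_zero, inv_one, one_mul, lpp_lt p hp]; simp [Real.zero_rpow hp.ne']
  by_cases hy : y = 0
  · subst hy; rw [lt_zero, mul_one, lpp_inv, lpp_lt p hp]; simp [Real.zero_rpow hp.ne']
  have := lpp_pr_inv_mul p [⟨i, Multiplicative.ofAdd x⟩] [⟨j, Multiplicative.ofAdd y⟩]
    ⟨by simpa using hx, by simp⟩ ⟨by simpa using hy, by simp⟩
  simp only [pr, dst] at this
  rw [if_neg (by simp [hij]), if_neg (by simpa using hij)] at this
  simpa [nrm, len, lt] using this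

lemma lpp_cnk (p : ℝ) (hp : 0 < p) (hR : CNK (fun x y : ℝ => |x - y| ^ p)) :
    CNK (fun g h : FP => lppFree p (g⁻¹ * h)) := by
  intro ι _ x c hc
  simp only [lpp_inv_mul]
  exact cnk_dst p hp hR ι (fun i => (Monoid.CoprodI.Word.equiv (x i)).toList) c hc

end LK
end

section
namespace LK

lemma CNK.integral {X T : Type*} [MeasurableSpace T] (μ : Measure T) (K : T → X → X → ℝ)
    (hK : ∀ᵐ t ∂μ, CNK (K t)) (hi : ∀ x y, Integrable (fun t => K t x y) μ) :
    CNK (fun x y => ∫ t, K t x y ∂μ) := by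
  intro ι _ x c hc
  have : ∑ i, ∑ j, c i * c j * ∫ t, K t (x i) (x j) ∂μ
      = ∫ t, ∑ i, ∑ j, c i * c j * K t (x i) (x j) ∂μ := by
    rw [integral_finsetSum]
    · apply Finset.sum_congr rfl; intro i _
      rw [integral_finsetSum]
      · apply Finset.sum_congr rfl; intro j _
        rw [integral_const_mul]
      · intro j _; exact (hi _ _).const_mul _
    · intro i _
      apply integrable_finsetSum
      intro j _; exact (hi _ _).const_mul _
  rw [this]
  apply integral_nonpos_of_ae
  filter_upwards [hK] with t ht
  exact ht ι x c hc

lemma CNK.const_mul {X : Type*} {K : X → X → ℝ} (hK : CNK K) (a : ℝ) (ha : 0 ≤ a) :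
    CNK (fun x y => a * K x y) := by
  intro ι _ x c hc
  have : ∑ i, ∑ j, c i * c j * (a * K (x i) (x j)) = a * ∑ i, ∑ j, c i * c j * K (x i) (x j) := by
    simp only [Finset.mul_sum]
    refine Finset.sum_congr rfl fun i _ => Finset.sum_congr rfl fun j _ => by ring
  rw [this]
  exact mul_nonpos_of_nonneg_of_nonpos ha (hK ι x c hc)

lemma CNK.add {X : Type*} {K L : X → X → ℝ} (hK : CNK K) (hL : CNK L) :
    CNK (fun x y => K x y + L x y) := by
  intro ι _ x c hc
  simp only [mul_add, Finset.sum_add_distrib]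
  exact add_nonpos (hK ι x c hc) (hL ι x c hc)

lemma sum_mul_left_zero {ι : Type} [Fintype ι] (c : ι → ℝ) (f : ι → ℝ) (hc : ∑ i, c i = 0) :
    ∑ i, ∑ j, c i * c j * f i = 0 := by
  have : ∀ i, ∑ j, c i * c j * f i = (c i * f i) * ∑ j, c j := by
    intro i; rw [Finset.mul_sum]; exact Finset.sum_congr rfl fun j _ => by ring
  simp [this, hc]

lemma sum_mul_right_zero {ι : Type} [Fintype ι] (c : ι → ℝ) (f : ι → ℝ) (hc : ∑ i, c i = 0) :
    ∑ i, ∑ j, c i * c j * f j = 0 := by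
  rw [Finset.sum_comm, ← sum_mul_left_zero c f hc]
  exact Finset.sum_congr rfl fun i _ => Finset.sum_congr rfl fun j _ => by ring

lemma cnk_const_sub {X : Type*} {K : X → X → ℝ} (a : ℝ)
    (hK : ∀ (ι : Type) [Fintype ι] (x : ι → X) (c : ι → ℝ),
      0 ≤ ∑ i, ∑ j, c i * c j * K (x i) (x j)) : CNK (fun x y => a - K x y) := by
  intro ι _ x c hc
  have h1 := sum_mul_left_zero c (fun _ => a) hc
  have h2 := hK ι x c
  simp only [mul_sub, Finset.sum_sub_distrib]
  linarith

lemma cnk_one_sub_cos (s : ℝ) : CNK (fun x y : ℝ => 1 - Real.cos ((x - y) * s)) := by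
  apply cnk_const_sub
  intro ι _ x c
  have : ∑ i, ∑ j, c i * c j * Real.cos ((x i - x j) * s)
      = (∑ i, c i * Real.cos (x i * s)) ^ 2 + (∑ i, c i * Real.sin (x i * s)) ^ 2 := by
    rw [sq, sq, Finset.sum_mul_sum, Finset.sum_mul_sum, ← Finset.sum_add_distrib]
    refine Finset.sum_congr rfl fun i _ => ?_
    rw [← Finset.sum_add_distrib]
    refine Finset.sum_congr rfl fun j _ => ?_
    rw [sub_mul, Real.cos_sub]; ring
  rw [this]; positivity

lemma cnk_sq : CNK (fun x y : ℝ => |x - y| ^ (2:ℝ)) := by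
  intro ι _ x c hc
  have e : ∑ i, ∑ j, c i * c j * |x i - x j| ^ (2:ℝ) =
      ∑ i, ∑ j, c i * c j * (x i ^ 2) + ∑ i, ∑ j, c i * c j * (x j ^ 2)
      - 2 * (∑ i, c i * x i) ^ 2 := by
    rw [sq (∑ i, c i * x i), Finset.sum_mul_sum, Finset.mul_sum, ← Finset.sum_add_distrib,
      ← Finset.sum_sub_distrib]
    refine Finset.sum_congr rfl fun i _ => ?_
    rw [Finset.mul_sum, ← Finset.sum_add_distrib, ← Finset.sum_sub_distrib]
    refine Finset.sum_congr rfl fun j _ => ?_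
    rw [Real.rpow_two, sq_abs]; ring
  rw [e, sum_mul_left_zero c _ hc, sum_mul_right_zero c _ hc]
  nlinarith [sq_nonneg (∑ i, c i * x i)]

lemma integrableOn_cos (p : ℝ) (hp0 : 0 < p) (hp2 : p < 2) (x : ℝ) :
    IntegrableOn (fun s : ℝ => (1 - Real.cos (x * s)) * s ^ (-1 - p)) (Set.Ioi 0) := by
  have hm : ∀ S : Set ℝ, AEStronglyMeasurable (fun s : ℝ => (1 - Real.cos (x * s)) * s ^ (-1 - p))
      (volume.restrict S) := by
    intro S
    apply Measurable.aestronglyMeasurable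
    fun_prop
  rw [← Set.Ioc_union_Ioi_eq_Ioi (zero_le_one' ℝ)]
  apply IntegrableOn.union
  · have h1 : IntegrableOn (fun s : ℝ => x ^ 2 / 2 * s ^ (1 - p)) (Set.Ioc 0 1) := by
      apply Integrable.const_mul
      have := intervalIntegral.intervalIntegrable_rpow' (a := 0) (b := 1) (r := 1 - p) (by linarith)
      rwa [intervalIntegrable_iff_integrableOn_Ioc_of_le zero_le_one] at this
    refine h1.mono' (hm _) ?_
    filter_upwards [ae_restrict_mem measurableSet_Ioc] with s hs
    have hs0 : 0 < s := hs.1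
    have a1 := Real.one_sub_sq_div_two_le_cos (x := x * s)
    have a2 := Real.cos_le_one (x * s)
    have e : s ^ (1 - p) = s ^ 2 * s ^ (-1 - p) := by
      rw [← Real.rpow_two, ← Real.rpow_add hs0]; congr 1; ring
    rw [Real.norm_of_nonneg (mul_nonneg (by linarith) (by positivity)), e, ← mul_assoc]
    gcongr
    linarith [mul_pow x s 2]
  · have h1 : IntegrableOn (fun s : ℝ => 2 * s ^ (-1 - p)) (Set.Ioi 1) := by
      apply Integrable.const_mul
      exact integrableOn_Ioi_rpow_of_lt (by linarith) zero_lt_one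
    refine h1.mono' (hm _) ?_
    filter_upwards [ae_restrict_mem measurableSet_Ioi] with s hs
    have hs0 : 0 < s := lt_trans zero_lt_one hs
    have a1 := Real.neg_one_le_cos (x * s)
    have a2 := Real.cos_le_one (x * s)
    rw [Real.norm_of_nonneg (mul_nonneg (by linarith) (by positivity))]
    gcongr
    linarith

lemma cos_integral_eq (p : ℝ) (hp0 : 0 < p) (x : ℝ) :
    ∫ s in Set.Ioi (0:ℝ), (1 - Real.cos (x * s)) * s ^ (-1 - p) =
     |x| ^ p * ∫ s in Set.Ioi (0:ℝ), (1 - Real.cos s) * s ^ (-1 - p) := by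
  by_cases hx : x = 0
  · subst hx; simp [Real.zero_rpow hp0.ne']
  have hx' : 0 < |x| := abs_pos.2 hx
  have h := integral_comp_mul_left_Ioi (fun s : ℝ => (1 - Real.cos s) * s ^ (-1 - p)) 0 hx'
  rw [mul_zero, smul_eq_mul] at h
  have e : ∫ s in Set.Ioi (0:ℝ), (1 - Real.cos (|x| * s)) * (|x| * s) ^ (-1 - p) =
      |x| ^ (-1 - p) * ∫ s in Set.Ioi (0:ℝ), (1 - Real.cos (x * s)) * s ^ (-1 - p) := by
    rw [← integral_const_mul]
    apply setIntegral_congr_fun measurableSet_Ioi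
    intro s hs
    have hs : 0 < s := hs
    simp only
    rw [Real.mul_rpow hx'.le hs.le]
    have : Real.cos (|x| * s) = Real.cos (x * s) := by
      rw [← Real.cos_abs (x * s), abs_mul, abs_of_pos hs]
    rw [this]; ring
  rw [e] at h
  have e2 : |x| ^ p * |x|⁻¹ = |x| ^ p * |x| ^ p * |x| ^ (-1 - p) := by
    rw [← Real.rpow_neg_one, ← Real.rpow_add hx', ← Real.rpow_add hx', ← Real.rpow_add hx']
    congr 1; ring
  have e3 : |x| ^ p * |x| ^ (-1 - p) = |x|⁻¹ := by
    rw [← Real.rpow_neg_one, ← Real.rpow_add hx']; congr 1; ring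
  have e4 : |x|⁻¹ ≠ 0 := by positivity
  apply mul_left_cancel₀ e4
  calc _ = |x| ^ p * (|x| ^ (-1 - p) * ∫ s in Set.Ioi (0:ℝ), (1 - Real.cos (x * s)) * s ^ (-1 - p)) := by
        rw [← mul_assoc, e3]
    _ = _ := by rw [h]; ring

lemma cos_integral_pos (p : ℝ) (hp0 : 0 < p) (hp2 : p < 2) :
    0 < ∫ s in Set.Ioi (0:ℝ), (1 - Real.cos s) * s ^ (-1 - p) := by
  have hi := integrableOn_cos p hp0 hp2 1
  simp only [one_mul] at hi
  rw [setIntegral_pos_iff_support_of_nonneg_ae _ hi]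
  · have : Set.Ioo (0:ℝ) 1 ⊆ (Function.support fun s : ℝ => (1 - Real.cos s) * s ^ (-1 - p)) ∩ Set.Ioi 0 := by
      intro s hs
      refine ⟨?_, hs.1⟩
      rw [Function.mem_support]
      have h1 : Real.cos s < Real.cos 0 :=
        Real.strictAntiOn_cos ⟨le_rfl, Real.pi_pos.le⟩ ⟨hs.1.le, by linarith [hs.2, Real.pi_gt_three]⟩ hs.1
      rw [Real.cos_zero] at h1
      have h2 := Real.rpow_pos_of_pos hs.1 (-1 - p)
      have : 0 < 1 - Real.cos s := by linarith
      positivity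
    refine lt_of_lt_of_le ?_ (measure_mono this)
    simp
  · filter_upwards [ae_restrict_mem measurableSet_Ioi] with s hs
    have hs : 0 < s := hs
    have := Real.cos_le_one s
    exact mul_nonneg (by linarith) (by positivity)

lemma cnk_rpow (p : ℝ) (hp0 : 0 < p) (hp2 : p ≤ 2) : CNK (fun x y : ℝ => |x - y| ^ p) := by
  rcases hp2.lt_or_eq with hp2 | rfl
  · have h := CNK.integral (volume.restrict (Set.Ioi (0:ℝ)))
      (fun (s : ℝ) (x y : ℝ) => (1 - Real.cos ((x - y) * s)) * s ^ (-1 - p))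
      (by
        filter_upwards [ae_restrict_mem measurableSet_Ioi] with s hs
        have hs : 0 < s := hs
        have := (cnk_one_sub_cos s).const_mul (s ^ (-1 - p)) (by positivity)
        simpa only [mul_comm] using this)
      (fun x y => integrableOn_cos p hp0 hp2 (x - y))
    simp only [cos_integral_eq p hp0] at h
    have hpos := cos_integral_pos p hp0 hp2
    set I := ∫ s in Set.Ioi (0:ℝ), (1 - Real.cos s) * s ^ (-1 - p)
    have h2 := h.const_mul I⁻¹ (by positivity)
    have e : (fun x y : ℝ => |x - y| ^ p) = fun x y => I⁻¹ * (|x - y| ^ p * I) := by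
      funext x y; field_simp
    rw [e]; exact h2
  · exact cnk_sq

lemma psd_pow {ι : Type} [Fintype ι] (A : Matrix ι ι ℝ) (hA : A.PosSemidef) (n : ℕ) :
    (Matrix.of fun i j => A i j ^ n).PosSemidef := by
  classical
  induction n with
  | zero =>
    have h := Matrix.posSemidef_vecMulVec_self_star (fun _ : ι => (1:ℝ))
    convert h using 1
    ext i j; simp [Matrix.vecMulVec]
  | succ n ih =>
    have h := ih.hadamard hA
    have e : (Matrix.of fun i j => A i j ^ (n + 1)) =
        Matrix.hadamard (Matrix.of fun i j => A i j ^ n) A := by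
      ext i j; simp [pow_succ]
    rw [e]; exact h

lemma psd_quad {ι : Type} [Fintype ι] (A : Matrix ι ι ℝ) (hA : A.PosSemidef) (c : ι → ℝ) :
    0 ≤ ∑ i, ∑ j, c i * c j * A i j := by
  have h := hA.dotProduct_mulVec_nonneg c
  simp only [dotProduct, Matrix.mulVec, Finset.mul_sum] at h
  refine le_of_le_of_eq h ?_
  refine Finset.sum_congr rfl fun i _ => Finset.sum_congr rfl fun j _ => ?_
  simp; ring

lemma exp_quad {ι : Type} [Fintype ι] (A : Matrix ι ι ℝ) (hA : A.PosSemidef) (c : ι → ℝ) :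
    0 ≤ ∑ i, ∑ j, c i * c j * Real.exp (A i j) := by
  have h1 : HasSum (fun n : ℕ => ∑ i, ∑ j, c i * c j * (A i j ^ n / (n.factorial : ℝ)))
      (∑ i, ∑ j, c i * c j * Real.exp (A i j)) := by
    apply hasSum_sum; intro i _
    apply hasSum_sum; intro j _
    apply HasSum.mul_left
    rw [Real.exp_eq_exp_ℝ]
    exact NormedSpace.expSeries_div_hasSum_exp (A i j)
  apply h1.nonneg
  intro n
  have h2 := psd_quad _ (psd_pow A hA n) c
  have : ∑ i, ∑ j, c i * c j * (A i j ^ n / (n.factorial : ℝ)) =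
      (∑ i, ∑ j, c i * c j * A i j ^ n) / (n.factorial : ℝ) := by
    simp only [Finset.sum_div, mul_div_assoc]
  rw [this]
  exact div_nonneg h2 (by positivity)

lemma schoenberg {X : Type*} {K : X → X → ℝ} (hK : CNK K) (hs : ∀ x y, K x y = K y x)
    (h0 : ∀ x, K x x = 0) (ι : Type) [Fintype ι] (x : ι → X) (c : ι → ℝ) :
    0 ≤ ∑ i, ∑ j, c i * c j * Real.exp (- K (x i) (x j)) := by
  classical
  rcases isEmpty_or_nonempty ι with he | ⟨⟨o⟩⟩
  · simp
  set A : Matrix ι ι ℝ := Matrix.of fun i j => K (x i) (x o) + K (x j) (x o) - K (x i) (x j) with hA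
  have hpsd : A.PosSemidef := by
    apply Matrix.PosSemidef.of_dotProduct_mulVec_nonneg
    · ext i j; simp [hA, hs (x j) (x i)]; ring
    · intro d
      have h := hK (Option ι) (fun i => i.elim (x o) x) (fun i => i.elim (-∑ i, d i) d)
        (by simp [Fintype.sum_option])
      simp only [Fintype.sum_option, Option.elim, h0] at h
      simp only [dotProduct, Matrix.mulVec, Finset.mul_sum]
      have e : ∑ i, ∑ j, star d i * (A i j * d j) =
        ∑ i, ∑ j, d i * d j * K (x i) (x o) + ∑ i, ∑ j, d i * d j * K (x j) (x o)
          - ∑ i, ∑ j, d i * d j * K (x i) (x j) := by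
        simp only [← Finset.sum_add_distrib, ← Finset.sum_sub_distrib]
        refine Finset.sum_congr rfl fun i _ => Finset.sum_congr rfl fun j _ => ?_
        simp [hA]; ring
      have e1 : ∑ i, ∑ j, d i * d j * K (x i) (x o) = (∑ i, d i * K (x i) (x o)) * ∑ j, d j := by
        rw [Finset.sum_mul_sum]
        refine Finset.sum_congr rfl fun i _ => Finset.sum_congr rfl fun j _ => by ring
      have e2 : ∑ i, ∑ j, d i * d j * K (x j) (x o) = (∑ i, d i * K (x i) (x o)) * ∑ j, d j := by
        rw [Finset.sum_comm, ← e1]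
        refine Finset.sum_congr rfl fun i _ => Finset.sum_congr rfl fun j _ => by ring
      rw [e, e1, e2]
      have e3 : ∑ j, (-∑ i, d i) * d j * K (x o) (x j) = - ((∑ i, d i * K (x i) (x o)) * ∑ j, d j) := by
        rw [mul_comm, ← neg_mul, Finset.mul_sum]
        refine Finset.sum_congr rfl fun i _ => by rw [hs (x o)]; ring
      have e4 : ∑ i, d i * (-∑ i, d i) * K (x i) (x o) = - ((∑ i, d i * K (x i) (x o)) * ∑ j, d j) := by
        rw [mul_comm, ← neg_mul, Finset.mul_sum]
        refine Finset.sum_congr rfl fun i _ => by ring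
      rw [Finset.sum_add_distrib, e3, e4] at h
      linarith
  have h := exp_quad A hpsd (fun i => c i * Real.exp (- K (x i) (x o)))
  convert h using 1
  refine Finset.sum_congr rfl fun i _ => Finset.sum_congr rfl fun j _ => ?_
  have : Real.exp (- K (x i) (x j)) = Real.exp (- K (x i) (x o)) * Real.exp (- K (x j) (x o)) *
      Real.exp (A i j) := by
    rw [← Real.exp_add, ← Real.exp_add]; congr 1; simp [hA]; ring
  rw [this]; ring

lemma condNegDef_of_cnk {G : Type*} [Group G] (ψ : G → ℝ) (hi : ∀ g, ψ g⁻¹ = ψ g)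
    (h : CNK (fun g h : G => ψ (g⁻¹ * h))) : IsCondNegDef ψ := by
  refine ⟨hi, ?_⟩
  intro n x c hc
  have hs : ∀ j k, ψ ((x j)⁻¹ * x k) = ψ ((x k)⁻¹ * x j) := by
    intro j k; rw [← hi]; congr 1; group
  have h1 := h (Fin n) x (fun j => (c j).re) (by rw [← Complex.re_sum, hc]; rfl)
  have h2 := h (Fin n) x (fun j => (c j).im) (by rw [← Complex.im_sum, hc]; rfl)
  rw [Complex.le_def]
  constructor
  · simp only [Complex.re_sum, Complex.zero_re]
    have := add_nonpos h1 h2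
    simp only [← Finset.sum_add_distrib] at this
    refine le_of_eq_of_le ?_ this
    refine Finset.sum_congr rfl fun i _ => Finset.sum_congr rfl fun j _ => ?_
    simp; ring
  · simp only [Complex.im_sum, Complex.zero_im]
    have e : ∀ j k, (c j * (starRingEnd ℂ) (c k) * (ψ ((x j)⁻¹ * x k) : ℂ)).im =
        (c j).im * (c k).re * ψ ((x j)⁻¹ * x k) - (c k).im * (c j).re * ψ ((x k)⁻¹ * x j) := by
      intro j k; rw [hs k j]; simp; ring
    simp only [e, Finset.sum_sub_distrib]
    rw [Finset.sum_comm (f := fun j k => (c k).im * (c j).re * ψ ((x k)⁻¹ * x j)), sub_self]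

lemma cnk_of_condNegDef {G : Type*} [Group G] (ψ : G → ℝ) (h : IsCondNegDef ψ) :
    CNK (fun g h : G => ψ (g⁻¹ * h)) := by
  intro ι _ x c hc
  set e := Fintype.equivFin ι
  have h1 := h.2 (Fintype.card ι) (fun i => x (e.symm i)) (fun i => (c (e.symm i) : ℂ))
    (by rw [Equiv.sum_comp e.symm (fun i => (c i : ℂ)), ← Complex.ofReal_sum, hc]; rfl)
  simp only [Complex.conj_ofReal, ← Complex.ofReal_mul, ← Complex.ofReal_sum] at h1
  rw [← Complex.ofReal_zero, Complex.real_le_real] at h1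
  refine le_of_eq_of_le ?_ h1
  rw [← Equiv.sum_comp e.symm]
  refine Finset.sum_congr rfl fun i _ => ?_
  rw [← Equiv.sum_comp e.symm]

end LK
end

section
namespace LK

lemma one_sub_pow_le (x s : ℝ) (hx0 : 0 ≤ x) (hx1 : x ≤ 1) (hs : 0 ≤ s) :
    1 - x ^ s ≤ (s + 1) * (1 - x) := by
  have h := one_add_mul_self_le_rpow_one_add (s := x - 1) (p := s + 1) (by linarith) (by linarith)
  rw [add_sub_cancel] at h
  have h2 : x ^ (s + 1) ≤ x ^ s := by
    rcases hx0.eq_or_lt with rfl | hx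
    · rw [Real.zero_rpow (by linarith)]; positivity
    · exact Real.rpow_le_rpow_of_exponent_ge hx hx1 (by linarith)
  linarith

lemma integrable_base (ν : Measure (Set.Ioi (0 : ℝ)))
    (h : (∫⁻ t : Set.Ioi (0 : ℝ), ENNReal.ofReal (1 - Real.exp (-(t : ℝ))) ∂ν) < ⊤) :
    Integrable (fun t : Set.Ioi (0 : ℝ) => 1 - Real.exp (-(t : ℝ))) ν := by
  refine ⟨by fun_prop, ?_⟩
  rw [hasFiniteIntegral_iff_ofReal]
  · exact h
  · filter_upwards with t
    have : 0 < (t : ℝ) := t.2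
    simp; exact this.le

lemma integrable_all (ν : Measure (Set.Ioi (0 : ℝ)))
    (h : (∫⁻ t : Set.Ioi (0 : ℝ), ENNReal.ofReal (1 - Real.exp (-(t : ℝ))) ∂ν) < ⊤)
    (s : ℝ) (hs : 0 ≤ s) :
    Integrable (fun t : Set.Ioi (0 : ℝ) => 1 - Real.exp (-(t : ℝ) * s)) ν := by
  refine ((integrable_base ν h).const_mul (s + 1)).mono' (by fun_prop) ?_
  filter_upwards with t
  have ht : 0 < (t : ℝ) := t.2
  have h1 : Real.exp (-(t:ℝ) * s) ≤ 1 := by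
    rw [Real.exp_le_one_iff]; nlinarith
  rw [Real.norm_of_nonneg (by linarith)]
  have := one_sub_pow_le (Real.exp (-(t:ℝ))) s (Real.exp_pos _).le
    (by rw [Real.exp_le_one_iff]; linarith) hs
  rwa [← Real.exp_mul] at this

lemma cnk_indicator (b : ℝ) (hb : 0 ≤ b) :
    CNK (fun g h : FP => Set.indicator ({1}ᶜ : Set FP) (fun _ => b) (g⁻¹ * h)) := by
  classical
  have h := (cnk_const_sub (X := FP) (K := fun g h => if g = h then 1 else 0) 1 (by
    intro ι _ x c
    have e : ∑ i, ∑ j, c i * c j * (if x i = x j then (1:ℝ) else 0) =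
        ∑ a ∈ Finset.univ.image x, (∑ i, if x i = a then c i else 0) ^ 2 := by
      simp only [sq, Finset.sum_mul_sum]
      rw [Finset.sum_comm (s := Finset.univ.image x)]
      refine Finset.sum_congr rfl fun i _ => ?_
      rw [Finset.sum_comm (s := Finset.univ.image x)]
      refine Finset.sum_congr rfl fun j _ => ?_
      rw [Finset.sum_eq_single (x i)]
      · by_cases h : x i = x j
        · simp [h]
        · simp [h, Ne.symm h]
      · intro a _ ha; simp [ha.symm]
      · intro h; exact absurd (Finset.mem_image_of_mem _ (Finset.mem_univ i)) h
    rw [e]; positivity)).const_mul b hb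
  convert h using 3 with g h
  by_cases hgh : g = h
  · simp [hgh]
  · have : g⁻¹ * h ≠ 1 := fun e => hgh (inv_mul_eq_one.1 e)
    simp [hgh, this]

theorem bwd (p : ℝ) (hp0 : 0 < p) (hp2 : p ≤ 2) (ψ : FP → ℝ)
    (b c : ℝ) (ν : Measure (Set.Ioi (0 : ℝ))) (hb : 0 ≤ b) (hc : 0 ≤ c)
    (hν : (∫⁻ t : Set.Ioi (0 : ℝ), ENNReal.ofReal (1 - Real.exp (-(t : ℝ))) ∂ν) < ⊤)
    (h : ∀ r : FP, ψ r = c * lppFree p r + Set.indicator ({1}ᶜ : Set FP) (fun _ => b) r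
        + ∫ t : Set.Ioi (0 : ℝ), (1 - Real.exp (-(t : ℝ) * lppFree p r)) ∂ν) :
    IsCondNegDef ψ ∧ BddBelow (Set.range ψ) := by
  have hφ := lpp_cnk p hp0 (cnk_rpow p hp0 hp2)
  refine ⟨condNegDef_of_cnk ψ ?_ ?_, ⟨0, ?_⟩⟩
  · intro g
    rw [h, h, lpp_inv]
    congr 2
    by_cases hg : g = 1 <;> simp [hg]
  · simp only [h]
    refine ((hφ.const_mul c hc).add (cnk_indicator b hb)).add ?_
    apply CNK.integral
    · filter_upwards with t
      have ht : 0 < (t : ℝ) := t.2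
      apply cnk_const_sub
      intro ι _ x d
      have := schoenberg (hφ.const_mul t ht.le)
        (fun x y => by rw [← lpp_inv, mul_inv_rev, inv_inv]) (fun x => by simp [lpp_one]) ι x d
      simpa only [neg_mul] using this
    · intro x y
      exact integrable_all ν hν _ (lpp_nonneg p _)
  · rintro _ ⟨g, rfl⟩
    rw [h]
    have h1 : 0 ≤ c * lppFree p g := mul_nonneg hc (lpp_nonneg p g)
    have h2 : 0 ≤ Set.indicator ({1}ᶜ : Set FP) (fun _ => b) g := Set.indicator_nonneg (fun _ _ => hb) g
    have h3 : 0 ≤ ∫ t : Set.Ioi (0 : ℝ), (1 - Real.exp (-(t : ℝ) * lppFree p g)) ∂ν := by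
      apply integral_nonneg
      intro t
      have ht : 0 < (t : ℝ) := t.2
      have := lpp_nonneg p g
      simp only [Pi.zero_apply, sub_nonneg, Real.exp_le_one_iff]
      nlinarith
    positivity

end LK
end

section
namespace LK

open Filter Topology

/-- Positive definiteness on the semigroup `[0,∞)`, conditional when `Z` holds. -/
def CPD (Z : Prop) (f : ℝ → ℝ) : Prop :=
  ∀ (ι : Type) [Fintype ι] (s c : ι → ℝ), (∀ i, 0 ≤ s i) → (Z → ∑ i, c i = 0) →
    0 ≤ ∑ i, ∑ j, c i * c j * f (s i + s j)

lemma le_of_growth (q : ℝ → ℝ) (hq : ∀ a, 0 ≤ a → q a ^ 2 ≤ q 0 * q (2 * a)) (h0 : 0 ≤ q 0)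
    (C : ℝ) (hC : ∀ a, 0 ≤ a → q a ≤ C * (1 + a)) (a : ℝ) (ha : 0 ≤ a) : q a ≤ q 0 := by
  rcases h0.eq_or_lt with h0 | h0
  · have := hq a ha
    rw [← h0, zero_mul] at this
    rw [← h0]
    nlinarith
  by_contra hcon
  push Not at hcon
  set r := q a / q 0 with hr
  have hr1 : 1 < r := by rw [hr, one_lt_div h0]; exact hcon
  have key : ∀ n : ℕ, q 0 * r ^ (2 ^ n) ≤ q (2 ^ n * a) := by
    intro n
    induction n with
    | zero => simp [hr]; field_simp; rfl
    | succ n ih =>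
      have h1 := hq (2 ^ n * a) (by positivity)
      have e : (2:ℝ) ^ (n + 1) * a = 2 * (2 ^ n * a) := by ring
      rw [e, pow_succ, pow_mul]
      have h2 : (q 0 * r ^ 2 ^ n) ^ 2 ≤ q (2 ^ n * a) ^ 2 := by
        apply pow_le_pow_left₀ (by positivity) ih
      have h3 : q 0 * (q 0 * (r ^ 2 ^ n) ^ 2) ≤ q 0 * q (2 * (2 ^ n * a)) := by
        calc _ = (q 0 * r ^ 2 ^ n) ^ 2 := by ring
          _ ≤ _ := h2.trans h1
      exact le_of_mul_le_mul_left h3 h0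
  have t1 : Tendsto (fun N : ℕ => (N:ℝ) ^ 1 / r ^ N) atTop (𝓝 0) :=
    tendsto_pow_const_div_const_pow_of_one_lt 1 hr1
  have t2 : Tendsto (fun N : ℕ => (N:ℝ) ^ 0 / r ^ N) atTop (𝓝 0) :=
    tendsto_pow_const_div_const_pow_of_one_lt 0 hr1
  have t3 : Tendsto (fun N : ℕ => C / q 0 * ((N:ℝ) ^ 0 / r ^ N + a * ((N:ℝ) ^ 1 / r ^ N))) atTop (𝓝 0) := by
    have := (t2.add (t1.const_mul a)).const_mul (C / q 0)
    simpa using this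
  have t4 := t3.comp (tendsto_pow_atTop_atTop_of_one_lt (r := 2) one_lt_two)
  have : (1:ℝ) ≤ 0 := by
    refine ge_of_tendsto' t4 ?_
    intro n
    have h1 := (key n).trans (hC (2 ^ n * a) (by positivity))
    have hp : 0 < r ^ 2 ^ n := by positivity
    simp only [Function.comp, pow_zero, pow_one, Nat.cast_pow, Nat.cast_ofNat]
    have e : C / q 0 * (1 / r ^ 2 ^ n + a * (2 ^ n / r ^ 2 ^ n)) = C * (1 + 2 ^ n * a) / (q 0 * r ^ 2 ^ n) := by
      field_simp
    rw [e, le_div_iff₀ (by positivity), one_mul]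
    exact h1
  linarith

lemma CPD.shift {Z : Prop} {f : ℝ → ℝ} (hf : CPD Z f) (C : ℝ)
    (hC : ∀ a, 0 ≤ a → |f a| ≤ C * (1 + a)) (a : ℝ) (ha : 0 ≤ a) :
    CPD Z (fun s => f s - f (s + a)) := by
  intro ι _ s c hs hc
  set q : ℝ → ℝ := fun a => ∑ i, ∑ j, c i * c j * f (s i + s j + a) with hqdef
  have hC0 : 0 ≤ C := by
    have := (abs_nonneg _).trans (hC 0 le_rfl); linarith
  have h0 : 0 ≤ q 0 := by
    have := hf ι s c hs hc
    simpa [hqdef] using this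
  have main : q a ≤ q 0 := by
    apply le_of_growth q ?_ h0 (∑ i, ∑ j, |c i * c j| * (C * (1 + s i + s j))) ?_ a ha
    · intro a ha
      have hx : ∀ x : ℝ, 0 ≤ q 0 * (x * x) + 2 * q a * x + q (2 * a) := by
        intro x
        have h := hf (ι ⊕ ι) (Sum.elim s (fun i => s i + a)) (Sum.elim (fun i => x * c i) c)
          (by rintro (i | i)
              · exact hs i
              · exact add_nonneg (hs i) ha)
          (by intro hz
              simp [← Finset.mul_sum, hc hz])
        simp only [Fintype.sum_sum_type, Sum.elim_inl, Sum.elim_inr, Finset.sum_add_distrib] at h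
        refine le_of_le_of_eq h ?_
        have e1 : ∑ i, ∑ j, x * c i * (x * c j) * f (s i + s j) = q 0 * (x * x) := by
          simp only [hqdef, Finset.sum_mul, add_zero]
          refine Finset.sum_congr rfl fun i _ => Finset.sum_congr rfl fun j _ => by ring
        have e2 : ∑ i, ∑ j, x * c i * c j * f (s i + (s j + a)) = q a * x := by
          simp only [hqdef, Finset.sum_mul, add_assoc]
          refine Finset.sum_congr rfl fun i _ => Finset.sum_congr rfl fun j _ => by ring
        have e3 : ∑ i, ∑ j, c i * (x * c j) * f (s i + a + s j) = q a * x := by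
          simp only [hqdef, Finset.sum_mul]
          refine Finset.sum_congr rfl fun i _ => Finset.sum_congr rfl fun j _ => ?_
          rw [add_right_comm]; ring
        have e4 : ∑ i, ∑ j, c i * c j * f (s i + a + (s j + a)) = q (2 * a) := by
          simp only [hqdef]
          refine Finset.sum_congr rfl fun i _ => Finset.sum_congr rfl fun j _ => ?_
          congr 2; ring
        rw [e1, e2, e3, e4]; ring
      have := discrim_le_zero hx
      rw [discrim] at this
      nlinarith
    · intro a ha
      simp only [hqdef, Finset.sum_mul]
      refine Finset.sum_le_sum fun i _ => Finset.sum_le_sum fun j _ => ?_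
      have h1 := hC (s i + s j + a) (by have := hs i; have := hs j; positivity)
      have h2 : C * (1 + (s i + s j + a)) ≤ C * (1 + s i + s j) * (1 + a) := by
        have := hs i
        have := hs j
        have : 0 ≤ C * ((s i + s j) * a) := by positivity
        linarith
      calc c i * c j * f (s i + s j + a) ≤ |c i * c j| * |f (s i + s j + a)| := by
            rw [← abs_mul]; exact le_abs_self _
        _ ≤ |c i * c j| * (C * (1 + s i + s j) * (1 + a)) := by
            gcongr; exact h1.trans h2
        _ = _ := by ring
  simp only [mul_sub, Finset.sum_sub_distrib]
  have e0 : q 0 = ∑ i, ∑ j, c i * c j * f (s i + s j) := by simp [hqdef]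
  have ea : q a = ∑ i, ∑ j, c i * c j * f (s i + s j + a) := rfl
  linarith

lemma anti_of_midconvex (f : ℝ → ℝ) (hf : ∀ x d, 0 ≤ x → 0 ≤ d → 2 * f (x + d) ≤ f x + f (x + 2 * d))
    (M : ℝ) (hM : ∀ x, 0 ≤ x → f x ≤ M) (x d : ℝ) (hx : 0 ≤ x) (hd : 0 ≤ d) : f (x + d) ≤ f x := by
  by_contra hcon
  push Not at hcon
  set δ := f (x + d) - f x with hδ
  have hpos : 0 < δ := by linarith
  have h1 : ∀ n : ℕ, δ ≤ f (x + (n + 1) * d) - f (x + n * d) := by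
    intro n
    induction n with
    | zero => simp [hδ]
    | succ n ih =>
      have := hf (x + n * d) d (by positivity) hd
      rw [show x + n * d + d = x + (n + 1) * d by ring,
        show x + n * d + 2 * d = x + (n + 1 + 1) * d by ring] at this
      push_cast
      linarith
  have h2 : ∀ n : ℕ, f x + n * δ ≤ f (x + n * d) := by
    intro n
    induction n with
    | zero => simp
    | succ n ih => have := h1 n; push_cast; linarith
  obtain ⟨n, hn⟩ := exists_nat_gt ((M - f x) / δ)
  rw [div_lt_iff₀ hpos] at hn
  have := h2 n
  have := hM (x + n * d) (by positivity)
  linarith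

lemma CPD.midconvex {f : ℝ → ℝ} (hf : CPD True f) (x d : ℝ) (hx : 0 ≤ x) (hd : 0 ≤ d) :
    2 * f (x + d) ≤ f x + f (x + 2 * d) := by
  have h := hf Bool (fun b => cond b (x / 2) (x / 2 + d)) (fun b => cond b 1 (-1))
    (by rintro (_ | _) <;> simp <;> positivity) (by simp)
  simp at h
  rw [show x / 2 + d + (x / 2 + d) = x + 2 * d by ring, show x / 2 + (x / 2 + d) = x + d by ring,
    show x / 2 + d + x / 2 = x + d by ring] at h
  linarith

lemma CPD.nonneg {f : ℝ → ℝ} (hf : CPD False f) (x : ℝ) (hx : 0 ≤ x) : 0 ≤ f x := by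
  have h := hf Unit (fun _ => x / 2) (fun _ => 1) (fun _ => by positivity) (fun h => h.elim)
  simpa using h

lemma CPD.uncond {G : ℝ → ℝ} (hG : CPD True G) (h0 : ∀ x, 0 ≤ x → 0 ≤ G x)
    (ha : ∀ x d, 0 ≤ x → 0 ≤ d → G (x + d) ≤ G x) : CPD False G := by
  intro ι _ s c hs _
  set D := ∑ i, c i with hD
  have hanti : Antitone (fun x => G (max x 0)) := by
    intro x y hxy
    have := ha (max x 0) (max y 0 - max x 0) (le_max_right _ _)
      (sub_nonneg.2 (max_le_max_right 0 hxy))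
    simpa using this
  have hbdd : BddBelow (Set.range (fun x => G (max x 0))) :=
    ⟨0, by rintro _ ⟨x, rfl⟩; exact h0 _ (le_max_right _ _)⟩
  have ht := tendsto_atTop_ciInf hanti hbdd
  set l := ⨅ x, G (max x 0) with hl
  have hl0 : 0 ≤ l := le_ciInf fun x => h0 _ (le_max_right _ _)
  have ht' : ∀ a : ℝ, 0 ≤ a → Tendsto (fun n : ℕ => G (a + n)) atTop (𝓝 l) := by
    intro a ha
    have h1 : Tendsto (fun n : ℕ => a + (n:ℝ)) atTop atTop :=
      tendsto_atTop_add_const_left _ _ tendsto_natCast_atTop_atTop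
    refine (ht.comp h1).congr ?_
    intro n
    simp only [Function.comp]
    rw [max_eq_left (by positivity)]
  have key : ∀ n : ℕ, 0 ≤ ∑ i, ∑ j, c i * c j * G (s i + s j)
      - 2 * D * ∑ i, c i * G (s i + n) + D ^ 2 * G (n + n) := by
    intro n
    have h := hG (Option ι) (fun i => i.elim (n:ℝ) s) (fun i => i.elim (-D) c)
      (by rintro (_ | i)
          · simp
          · exact hs i)
      (by intro _; simp [Fintype.sum_option, hD])
    simp only [Fintype.sum_option, Option.elim, Finset.sum_add_distrib] at h
    refine le_of_le_of_eq h ?_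
    have e1 : ∑ i, -D * c i * G (n + s i) = - (D * ∑ i, c i * G (s i + n)) := by
      rw [← neg_mul, Finset.mul_sum]
      refine Finset.sum_congr rfl fun i _ => by rw [add_comm]; ring
    have e2 : ∑ i, c i * -D * G (s i + n) = - (D * ∑ i, c i * G (s i + n)) := by
      rw [← neg_mul, Finset.mul_sum]
      refine Finset.sum_congr rfl fun i _ => by ring
    rw [e1, e2]; ring
  have h2n : Tendsto (fun n : ℕ => G (n + n)) atTop (𝓝 l) := by
    have h1 : Tendsto (fun n : ℕ => (n:ℝ) + n) atTop atTop :=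
      tendsto_natCast_atTop_atTop.atTop_add_atTop tendsto_natCast_atTop_atTop
    refine (ht.comp h1).congr ?_
    intro n
    simp only [Function.comp]
    rw [max_eq_left (by positivity)]
  have hlim : Tendsto (fun n : ℕ => ∑ i, ∑ j, c i * c j * G (s i + s j)
      - 2 * D * ∑ i, c i * G (s i + n) + D ^ 2 * G (n + n)) atTop
      (𝓝 (∑ i, ∑ j, c i * c j * G (s i + s j) - 2 * D * ∑ i, c i * l + D ^ 2 * l)) := by
    refine ((tendsto_const_nhds.sub (Tendsto.const_mul _ ?_))).add (h2n.const_mul _)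
    exact tendsto_finsetSum _ fun i _ => (ht' (s i) (hs i)).const_mul _
  have := ge_of_tendsto' hlim key
  rw [← Finset.sum_mul, ← hD] at this
  have : 0 ≤ D ^ 2 * l := by positivity
  nlinarith

/-- difference operator -/
def dif (δ : ℝ) (f : ℝ → ℝ) : ℝ → ℝ := fun s => f s - f (s + δ)

structure BPD (f : ℝ → ℝ) : Prop where
  cpd : CPD False f
  bdd : ∃ M, ∀ x, 0 ≤ x → f x ≤ M

lemma BPD.dif {f : ℝ → ℝ} (hf : BPD f) (δ : ℝ) (hδ : 0 ≤ δ) : BPD (dif δ f) := by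
  obtain ⟨M, hM⟩ := hf.bdd
  refine ⟨hf.cpd.shift M ?_ δ hδ, M, ?_⟩
  · intro a ha
    have h1 := hf.cpd.nonneg a ha
    have h2 := hM a ha
    rw [abs_of_nonneg h1]
    nlinarith
  · intro x hx
    have h1 := hM x hx
    have h2 := hf.cpd.nonneg (x + δ) (by positivity)
    simp only [LK.dif]; linarith

lemma BPD.iter {f : ℝ → ℝ} (hf : BPD f) (δ : ℝ) (hδ : 0 ≤ δ) (n : ℕ) : BPD ((LK.dif δ)^[n] f) := by
  induction n with
  | zero => exact hf
  | succ n ih => rw [Function.iterate_succ_apply']; exact ih.dif δ hδ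

/-- Main consequence for negative definite functions on the semigroup. -/
lemma bpd_of_negdef (F : ℝ → ℝ) (hF : CPD True (fun s => - F s)) (h0 : ∀ x, 0 ≤ x → 0 ≤ F x)
    (hz : F 0 = 0) :
    BPD (fun s => F (s + 1) - F s) ∧ (∀ x d, 0 ≤ x → 0 ≤ d → F x ≤ F (x + d)) ∧
    (∀ x d, 0 ≤ x → 0 ≤ d → F (x + 1 + d) - F (x + d) ≤ F (x + 1) - F x) ∧
    (∀ x d, 0 ≤ x → 0 ≤ d → F x + F (x + 2 * d) ≤ 2 * F (x + d)) := by
  have hmid : ∀ x d, 0 ≤ x → 0 ≤ d → F x + F (x + 2 * d) ≤ 2 * F (x + d) := by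
    intro x d hx hd
    have := hF.midconvex x d hx hd
    linarith
  have hmono : ∀ x d, 0 ≤ x → 0 ≤ d → F x ≤ F (x + d) := by
    intro x d hx hd
    have := anti_of_midconvex (fun s => - F s) (fun x d hx hd => hF.midconvex x d hx hd) 0
      (fun x hx => by have := h0 x hx; linarith) x d hx hd
    linarith
  have hstep : ∀ x, 0 ≤ x → F (x + 2) - F (x + 1) ≤ F (x + 1) - F x := by
    intro x hx
    have := hmid x 1 hx zero_le_one
    norm_num at this
    linarith
  have hstepn : ∀ (x : ℝ) (n : ℕ), 0 ≤ x → F (x + n + 1) - F (x + n) ≤ F (x + 1) - F x := by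
    intro x n hx
    induction n with
    | zero => simp
    | succ n ih =>
      have := hstep (x + n) (by positivity)
      push_cast
      rw [show x + (n + 1) + 1 = x + n + 2 by ring, show x + (n + 1 : ℝ) = x + n + 1 by ring]
      linarith
  have hlin : ∀ n : ℕ, F n ≤ n * F 1 := by
    intro n
    induction n with
    | zero => simp [hz]
    | succ n ih =>
      have := hstepn 0 n le_rfl
      simp only [zero_add, hz] at this
      push_cast; linarith
  have hF1 : 0 ≤ F 1 := h0 1 zero_le_one
  have hgrow : ∀ a, 0 ≤ a → |(-F a)| ≤ F 1 * (1 + a) := by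
    intro a ha
    rw [abs_neg, abs_of_nonneg (h0 a ha)]
    have h1 := hmono a (⌈a⌉₊ - a) ha (sub_nonneg.2 (Nat.le_ceil a))
    rw [add_sub_cancel] at h1
    have h2 := hlin ⌈a⌉₊
    have h3 := Nat.ceil_lt_add_one ha
    nlinarith
  have hcpd : CPD True (fun s => F (s + 1) - F s) := by
    have := hF.shift (F 1) hgrow 1 zero_le_one
    convert this using 2
    ring
  have hnn : ∀ x, 0 ≤ x → 0 ≤ F (x + 1) - F x := fun x hx => sub_nonneg.2 (hmono x 1 hx zero_le_one)
  have hbd : ∀ x, 0 ≤ x → F (x + 1) - F x ≤ F 2 := by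
    intro x hx
    have h1 := hstepn (Int.fract x) ⌊x⌋₊ (Int.fract_nonneg x)
    have e : Int.fract x + (⌊x⌋₊ : ℝ) = x := by
      rw [natCast_floor_eq_intCast_floor hx, Int.fract_add_floor]
    rw [e] at h1
    have h2 := h0 _ (Int.fract_nonneg x)
    have h3 := hmono (Int.fract x + 1) (2 - (Int.fract x + 1)) (by have := Int.fract_nonneg x; positivity)
      (by have := Int.fract_lt_one x; linarith)
    rw [add_sub_cancel] at h3
    linarith
  have hanti : ∀ x d, 0 ≤ x → 0 ≤ d → F (x + d + 1) - F (x + d) ≤ F (x + 1) - F x := by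
    intro x d hx hd
    exact anti_of_midconvex (fun s => F (s + 1) - F s) (fun x d hx hd => hcpd.midconvex x d hx hd)
      (F 2) hbd x d hx hd
  refine ⟨⟨hcpd.uncond hnn hanti, F 2, hbd⟩, hmono, ?_, hmid⟩
  intro x d hx hd
  have := hanti x d hx hd
  rwa [add_right_comm] at this

/-- Transfer from the free product to the semigroup. -/
lemma cpd_of_cnk (p : ℝ) (hp0 : 0 < p) (F : ℝ → ℝ)
    (h : CNK (fun g h : FP => F (lppFree p (g⁻¹ * h)))) : CPD True (fun s => - F s) := by
  intro ι _ s c hs hc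
  have hc := hc trivial
  set S := ∑ i, ∑ j, c i * c j * F (s i + s j) with hS
  set y : ι → ℝ := fun i => s i ^ p⁻¹ with hy
  have hyp : ∀ i, |y i| ^ p = s i := by
    intro i
    rw [hy, abs_of_nonneg (Real.rpow_nonneg (hs i) _), Real.rpow_inv_rpow (hs i) hp0.ne']
  set S' := ∑ i, ∑ j, c i * c j * F (lppFree p ((lt 0 (y i))⁻¹ * lt 0 (y j))) with hS'
  have hsame : ∀ k i j, lppFree p ((lt k (y i))⁻¹ * lt k (y j)) =
      lppFree p ((lt 0 (y i))⁻¹ * lt 0 (y j)) := by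
    intro k i j
    have : ∀ k, (lt k (y i))⁻¹ * lt k (y j) = lt k (-(y i) + y j) := by
      intro k; simp only [lt]; rw [← map_inv, ← map_mul]; rfl
    rw [this, this, lpp_lt p hp0, lpp_lt p hp0]
  have key : ∀ N : ℕ, (N:ℝ) * ((N - 1) * S + S') ≤ 0 := by
    intro N
    have h1 := h (ι × Fin N) (fun q => lt q.2 (y q.1)) (fun q => c q.1)
      (by rw [Fintype.sum_prod_type]; simp [← Finset.mul_sum, hc])
    refine le_of_eq_of_le ?_ h1
    simp only [Fintype.sum_prod_type]
    have e : ∀ i j (k l : Fin N), F (lppFree p ((lt k (y i))⁻¹ * lt l (y j))) =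
        F (s i + s j) + if k = l then F (lppFree p ((lt 0 (y i))⁻¹ * lt 0 (y j))) - F (s i + s j) else 0 := by
      intro i j k l
      by_cases hkl : k = l
      · subst hkl; rw [hsame, if_pos rfl]; ring
      · rw [if_neg hkl, lpp_lt_lt p hp0 k l (fun e => hkl (Fin.ext e)), hyp, hyp, add_zero]
    simp only [e]
    have e2 : ∀ i, ∑ k : Fin N, ∑ j, ∑ l : Fin N, c i * c j * (F (s i + s j) +
        if k = l then F (lppFree p ((lt 0 (y i))⁻¹ * lt 0 (y j))) - F (s i + s j) else 0) =
        ∑ j, (N * ((N - 1) * (c i * c j * F (s i + s j)) +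
          c i * c j * F (lppFree p ((lt 0 (y i))⁻¹ * lt 0 (y j))))) := by
      intro i
      rw [Finset.sum_comm]
      refine Finset.sum_congr rfl fun j _ => ?_
      simp only [← Finset.mul_sum, Finset.sum_add_distrib, Finset.sum_ite_eq, Finset.mem_univ,
        if_true, Finset.sum_const, Finset.card_univ, Fintype.card_fin, nsmul_eq_mul]
      ring
    simp only [e2]
    rw [hS, hS', Finset.mul_sum, ← Finset.sum_add_distrib, Finset.mul_sum]
    refine Finset.sum_congr rfl fun i _ => ?_
    rw [Finset.mul_sum, ← Finset.sum_add_distrib, Finset.mul_sum]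
  have hSle : S ≤ 0 := by
    by_contra hcon
    push Not at hcon
    obtain ⟨n, hn⟩ := exists_nat_gt (-S' / S)
    rw [div_lt_iff₀ hcon] at hn
    have := key (n + 1)
    push_cast at this
    have h3 : 0 < (n:ℝ) + 1 := by positivity
    have h4 : 0 < ((n:ℝ) + 1 - 1) * S + S' := by
      rw [add_sub_cancel_right]; linarith
    have := mul_pos h3 h4
    linarith
  simp only [mul_neg, Finset.sum_neg_distrib]
  linarith

end LK
end

section
namespace LK

open Filter Topology Polynomial

lemma bern_desc (m : ℕ) : ∀ n : ℕ, ∑ k ∈ Finset.range (n + 1),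
    (k.descFactorial m : ℝ[X]) * bernsteinPolynomial ℝ n k = (n.descFactorial m : ℝ[X]) * X ^ m := by
  induction m with
  | zero => intro n; simpa using bernsteinPolynomial.sum ℝ n
  | succ m ih =>
    intro n
    cases n with
    | zero => simp
    | succ n =>
      rw [Finset.sum_range_succ']
      simp only [Nat.zero_descFactorial_succ, Nat.cast_zero, zero_mul, add_zero]
      have : ∀ k ∈ Finset.range (n + 1), (((k + 1).descFactorial (m + 1) : ℕ) : ℝ[X]) * bernsteinPolynomial ℝ (n + 1) (k + 1)
          = (n + 1 : ℝ[X]) * X * ((k.descFactorial m : ℝ[X]) * bernsteinPolynomial ℝ n k) := by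
        intro k hk
        rw [Nat.succ_descFactorial_succ, bernsteinPolynomial, bernsteinPolynomial]
        have h := Nat.add_one_mul_choose_eq n k
        have h2 : ((n:ℝ[X]) + 1) * (n.choose k) = ((n+1).choose (k+1)) * (k + 1) := by exact_mod_cast h
        rw [Nat.add_sub_add_right]
        push_cast
        linear_combination (- (k.descFactorial m : ℝ[X]) * X ^ (k + 1) * (1 - X) ^ (n - k)) * h2
      rw [Finset.sum_congr rfl this, ← Finset.mul_sum, ih n, Nat.succ_descFactorial_succ]
      push_cast; ring

lemma desc_bound (n k : ℕ) (hn : 0 < n) (hk : k ≤ n) (m : ℕ) :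
    0 ≤ (k.descFactorial m : ℝ) / n ^ m ∧ (k.descFactorial m : ℝ) / n ^ m ≤ 1 ∧
    |((k:ℝ) / n) ^ m - (k.descFactorial m : ℝ) / n ^ m| ≤ (m:ℝ) ^ 2 / n := by
  have hn' : (0:ℝ) < n := by exact_mod_cast hn
  have hx0 : (0:ℝ) ≤ (k:ℝ) / n := by positivity
  have hx1 : (k:ℝ) / n ≤ 1 := by rw [div_le_one hn']; exact_mod_cast hk
  have hd : ∀ m, 0 ≤ (k.descFactorial m : ℝ) / n ^ m ∧ (k.descFactorial m : ℝ) / n ^ m ≤ 1 := by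
    intro m
    refine ⟨by positivity, ?_⟩
    rw [div_le_one (by positivity)]
    have : k.descFactorial m ≤ n ^ m := (Nat.descFactorial_le_pow k m).trans (Nat.pow_le_pow_left hk m)
    exact_mod_cast this
  refine ⟨(hd m).1, (hd m).2, ?_⟩
  induction m with
  | zero => simp
  | succ m ih =>
    have e : (k.descFactorial (m + 1) : ℝ) / n ^ (m + 1) = ((k:ℝ) / n - m / n) * ((k.descFactorial m : ℝ) / n ^ m) := by
      rw [Nat.descFactorial_succ]
      rcases le_or_gt m k with h | h
      · push_cast [Nat.cast_sub h]; field_simp; ring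
      · rw [Nat.descFactorial_eq_zero_iff_lt.2 h]; simp
    have e2 : ((k:ℝ) / n) ^ (m + 1) - (k.descFactorial (m + 1) : ℝ) / n ^ (m + 1)
      = (k:ℝ)/n * (((k:ℝ) / n) ^ m - (k.descFactorial m : ℝ) / n ^ m) + (m:ℝ)/n * ((k.descFactorial m : ℝ) / n ^ m) := by
      rw [e]; ring
    rw [e2]
    have hm : (0:ℝ) ≤ (m:ℝ)/n := by positivity
    calc _ ≤ |(k:ℝ)/n * (((k:ℝ) / n) ^ m - (k.descFactorial m : ℝ) / n ^ m)| + |(m:ℝ)/n * ((k.descFactorial m : ℝ) / n ^ m)| := abs_add_le _ _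
      _ ≤ 1 * ((m:ℝ)^2/n) + (m:ℝ)/n * 1 := by
        rw [abs_mul, abs_mul, abs_of_nonneg hx0, abs_of_nonneg hm, abs_of_nonneg (hd m).1]
        gcongr
        exact (hd m).2
      _ ≤ _ := by
        push_cast
        rw [one_mul, mul_one, ← add_div]
        gcongr
        nlinarith

lemma bern_moment (L : ℝ[X] →ₗ[ℝ] ℝ) (hL : ∀ k m, 0 ≤ L (X ^ k * (1 - X) ^ m)) (n : ℕ) (hn : 0 < n) (m : ℕ) :
    |∑ k ∈ Finset.range (n + 1), L (bernsteinPolynomial ℝ n k) * ((k:ℝ) / n) ^ m - L (X ^ m)|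
      ≤ (m:ℝ) ^ 2 / n * (L 1 + |L (X ^ m)|) := by
  have hn' : (0:ℝ) < n := by exact_mod_cast hn
  have hLc : ∀ (c : ℕ) (q : ℝ[X]), L ((c : ℝ[X]) * q) = c * L q := by
    intro c q
    rw [← nsmul_eq_mul, map_nsmul, nsmul_eq_mul]
  have hw : ∀ k, 0 ≤ L (bernsteinPolynomial ℝ n k) := by
    intro k
    rw [bernsteinPolynomial, mul_assoc, hLc]
    exact mul_nonneg (Nat.cast_nonneg _) (hL _ _)
  have h1 : ∑ k ∈ Finset.range (n + 1), L (bernsteinPolynomial ℝ n k) = L 1 := by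
    rw [← map_sum, bernsteinPolynomial.sum]
  have h2 : ∑ k ∈ Finset.range (n + 1), L (bernsteinPolynomial ℝ n k) * ((k.descFactorial m : ℝ) / n ^ m)
      = (n.descFactorial m : ℝ) / n ^ m * L (X ^ m) := by
    have := congrArg L (bern_desc m n)
    rw [map_sum, hLc] at this
    simp only [hLc] at this
    rw [div_mul_eq_mul_div, ← this, Finset.sum_div]
    refine Finset.sum_congr rfl fun k _ => by ring
  have h3 : ∑ k ∈ Finset.range (n + 1), L (bernsteinPolynomial ℝ n k) * ((k:ℝ) / n) ^ m - L (X ^ m)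
    = ∑ k ∈ Finset.range (n + 1), L (bernsteinPolynomial ℝ n k) * (((k:ℝ) / n) ^ m - (k.descFactorial m : ℝ) / n ^ m)
      - (((n:ℝ)/n)^m - (n.descFactorial m : ℝ) / n ^ m) * L (X ^ m) := by
    simp only [mul_sub, Finset.sum_sub_distrib, h2]
    rw [div_self hn'.ne']; ring
  rw [h3]
  refine (abs_sub _ _).trans ?_
  rw [mul_add, abs_mul]
  refine add_le_add ?_ (mul_le_mul_of_nonneg_right (desc_bound n n hn le_rfl m).2.2 (abs_nonneg _))
  refine (Finset.abs_sum_le_sum_abs _ _).trans ?_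
  rw [← h1, Finset.mul_sum]
  refine Finset.sum_le_sum fun k hk => ?_
  rw [abs_mul, abs_of_nonneg (hw k), mul_comm]
  exact mul_le_mul_of_nonneg_right (desc_bound n k hn (by simpa [Nat.lt_succ_iff] using hk) m).2.2 (hw k)

/-- Hausdorff moment theorem. -/
lemma hausdorff (L : ℝ[X] →ₗ[ℝ] ℝ) (hL : ∀ k m, 0 ≤ L (X ^ k * (1 - X) ^ m)) :
    ∃ μ : Measure unitInterval, IsFiniteMeasure μ ∧ ∀ m : ℕ, ∫ x : unitInterval, (x:ℝ) ^ m ∂μ = L (X ^ m) := by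
  have hLc : ∀ (c : ℕ) (q : ℝ[X]), L ((c : ℝ[X]) * q) = c * L q := by
    intro c q
    rw [← nsmul_eq_mul, map_nsmul, nsmul_eq_mul]
  have hw : ∀ n k, 0 ≤ L (bernsteinPolynomial ℝ n k) := by
    intro n k
    rw [bernsteinPolynomial, mul_assoc, hLc]
    exact mul_nonneg (Nat.cast_nonneg _) (hL _ _)
  let z : ℕ → ℕ → unitInterval := fun n k => Set.projIcc 0 1 zero_le_one ((k:ℝ) / n)
  let M : ℕ → Measure unitInterval := fun n => ∑ k ∈ Finset.range (n + 1),
    ENNReal.ofReal (L (bernsteinPolynomial ℝ n k)) • Measure.dirac (z n k)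
  have hM : ∀ n (f : C(unitInterval, ℝ)), ∫ x, f x ∂(M n) = ∑ k ∈ Finset.range (n + 1), L (bernsteinPolynomial ℝ n k) * f (z n k) := by
    intro n f
    have hi : ∀ k ∈ Finset.range (n + 1), Integrable f (ENNReal.ofReal (L (bernsteinPolynomial ℝ n k)) • Measure.dirac (z n k)) := by
      intro k _
      exact Integrable.smul_measure (integrable_dirac (by simp)) ENNReal.ofReal_ne_top
    rw [integral_finsetSum_measure hi]
    refine Finset.sum_congr rfl fun k _ => ?_
    rw [integral_smul_measure, integral_dirac, ENNReal.toReal_ofReal (hw n k), smul_eq_mul]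
  have hMu : ∀ n, M n Set.univ = ENNReal.ofReal (L 1) := by
    intro n
    simp only [M, Measure.coe_finsetSum, Finset.sum_apply, Measure.smul_apply, smul_eq_mul, measure_univ, mul_one]
    rw [← ENNReal.ofReal_sum_of_nonneg (fun k _ => hw n k), ← map_sum, bernsteinPolynomial.sum]
  have hfin : ∀ n, IsFiniteMeasure (M n) := fun n => ⟨by rw [hMu]; exact ENNReal.ofReal_lt_top⟩
  let Mf : ℕ → FiniteMeasure unitInterval := fun n => ⟨M n, hfin n⟩
  have hK := isCompact_setOfPred_finiteMeasure_le_of_compactSpace unitInterval (L 1).toNNReal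
  have hmem : ∀ n, Mf n ∈ {μ : FiniteMeasure unitInterval | μ.mass ≤ (L 1).toNNReal} := by
    intro n
    have : (Mf n).mass = (L 1).toNNReal := by
      rw [← ENNReal.coe_inj, FiniteMeasure.ennreal_mass]
      exact hMu n
    exact this.le
  obtain ⟨μ, -, hμ⟩ := hK.ultrafilter_le_nhds ((hyperfilter ℕ : Ultrafilter ℕ).map Mf)
    (by simp only [le_principal_iff]; exact Filter.mem_map.2 (Filter.mem_of_superset univ_mem (fun n _ => hmem n)))
  have hT : Tendsto Mf (hyperfilter ℕ) (𝓝 μ) := hμ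
  refine ⟨μ, inferInstance, fun m => ?_⟩
  let f : C(unitInterval, ℝ) := ⟨fun x => (x:ℝ) ^ m, by fun_prop⟩
  have t1 := (FiniteMeasure.tendsto_iff_forall_integral_tendsto.1 hT) (BoundedContinuousFunction.mkOfCompact f)
  have t2 : Tendsto (fun n => ∑ k ∈ Finset.range (n + 1), L (bernsteinPolynomial ℝ n k) * ((k:ℝ) / n) ^ m) atTop (𝓝 (L (X ^ m))) := by
    rw [tendsto_iff_norm_sub_tendsto_zero]
    have t3 : Tendsto (fun n : ℕ => (m:ℝ) ^ 2 / n * (L 1 + |L (X ^ m)|)) atTop (𝓝 0) := by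
      have := (tendsto_const_div_atTop_nhds_zero_nat ((m:ℝ)^2)).mul_const (L 1 + |L (X ^ m)|)
      simpa using this
    refine squeeze_zero' (Eventually.of_forall fun n => norm_nonneg _) ?_ t3
    filter_upwards [eventually_gt_atTop 0] with n hn
    exact bern_moment L hL n hn m
  have t4 : Tendsto (fun n => ∫ x, f x ∂(M n)) atTop (𝓝 (L (X ^ m))) := by
    refine t2.congr' ?_
    filter_upwards [eventually_gt_atTop 0] with n hn
    rw [hM]
    refine Finset.sum_congr rfl fun k hk => ?_
    have hn' : (0:ℝ) < n := by exact_mod_cast hn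
    have : ((z n k : unitInterval) : ℝ) = (k:ℝ) / n := by
      have hk' : (k:ℝ) ≤ n := by
        have : k ≤ n := by simpa [Nat.lt_succ_iff] using hk
        exact_mod_cast this
      simp only [z]
      rw [Set.projIcc_of_mem zero_le_one ⟨by positivity, by rw [div_le_one hn']; exact hk'⟩]
    change _ = _ * ((z n k : unitInterval) : ℝ) ^ m
    rw [this]
  exact tendsto_nhds_unique t1 (t4.mono_left (by rw [← Nat.cofinite_eq_atTop]; exact hyperfilter_le_cofinite))

lemma moment_unique (μ ν : Measure unitInterval) [IsFiniteMeasure μ] [IsFiniteMeasure ν]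
    (h : ∀ m : ℕ, ∫ x : unitInterval, (x:ℝ) ^ m ∂μ = ∫ x : unitInterval, (x:ℝ) ^ m ∂ν) : μ = ν := by
  apply ext_of_forall_integral_eq_of_IsFiniteMeasure
  intro f
  have hp : ∀ q : ℝ[X], ∫ x : unitInterval, q.eval (x:ℝ) ∂μ = ∫ x : unitInterval, q.eval (x:ℝ) ∂ν := by
    intro q
    have hi : ∀ (ρ : Measure unitInterval) [IsFiniteMeasure ρ] (q : ℝ[X]), Integrable (fun x : unitInterval => q.eval (x:ℝ)) ρ := by
      intro ρ _ q
      have hc : Continuous (fun x : unitInterval => q.eval (x:ℝ)) := by fun_prop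
      exact hc.integrable_of_hasCompactSupport (HasCompactSupport.of_compactSpace _)
    induction q using Polynomial.induction_on' with
    | add a b ha hb =>
      simp only [eval_add]
      rw [integral_add (hi μ a) (hi μ b), integral_add (hi ν a) (hi ν b), ha, hb]
    | monomial n a =>
      simp only [eval_monomial, integral_const_mul, h]
  have hi : ∀ (ρ : Measure unitInterval) [IsFiniteMeasure ρ] (q : C(unitInterval, ℝ)), Integrable q ρ := by
    intro ρ _ q
    exact q.continuous.integrable_of_hasCompactSupport (HasCompactSupport.of_compactSpace _)
  let fc : C(unitInterval, ℝ) := f.toContinuousMap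
  let D : C(unitInterval, ℝ) → ℝ := fun q => ∫ x, q x ∂μ - ∫ x, q x ∂ν
  have hlip : ∀ (ρ : Measure unitInterval) [IsFiniteMeasure ρ], Continuous (fun q : C(unitInterval, ℝ) => ∫ x, q x ∂ρ) := by
    intro ρ _
    refine (LipschitzWith.of_dist_le_mul (K := (ρ.real Set.univ).toNNReal) fun q r => ?_).continuous
    rw [Real.coe_toNNReal _ measureReal_nonneg, dist_eq_norm, ← integral_sub (hi ρ q) (hi ρ r), mul_comm]
    apply norm_integral_le_of_norm_le_const
    refine Eventually.of_forall fun x => ?_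
    rw [← dist_eq_norm]
    exact ContinuousMap.dist_apply_le_dist x
  have hDc : Continuous D := (hlip μ).sub (hlip ν)
  have hcl : IsClosed {q | D q = 0} := isClosed_eq hDc continuous_const
  have hsub : ((polynomialFunctions unitInterval : Subalgebra ℝ C(unitInterval, ℝ)) : Set C(unitInterval, ℝ)) ⊆ {q | D q = 0} := by
    intro q hq
    rw [polynomialFunctions_coe] at hq
    obtain ⟨q, rfl⟩ := hq
    exact sub_eq_zero.2 (hp q)
  have hden : fc ∈ (polynomialFunctions unitInterval).topologicalClosure := by
    rw [polynomialFunctions_closure_eq_top']; trivial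
  exact sub_eq_zero.1 (hcl.closure_subset_iff.2 hsub hden)

end LK
end

section
namespace LK

open Filter Topology Polynomial

lemma moment_of_bpd (g : ℝ → ℝ) (hg : BPD g) (δ : ℝ) (hδ : 0 ≤ δ) :
    ∃ μ : Measure unitInterval, IsFiniteMeasure μ ∧ ∀ k : ℕ, ∫ x : unitInterval, (x:ℝ) ^ k ∂μ = g (k * δ) := by
  let L : ℝ[X] →ₗ[ℝ] ℝ := (Polynomial.basisMonomials ℝ).constr ℝ (fun k : ℕ => g (k * δ))
  have hLX : ∀ k : ℕ, L (X ^ k) = g (k * δ) := by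
    intro k
    have := (Polynomial.basisMonomials ℝ).constr_basis ℝ (fun k : ℕ => g (k * δ)) k
    rw [Polynomial.coe_basisMonomials] at this
    rw [X_pow_eq_monomial]
    exact this
  have hL : ∀ m k : ℕ, L (X ^ k * (1 - X) ^ m) = (LK.dif δ)^[m] g (k * δ) := by
    intro m
    induction m with
    | zero => intro k; simpa using hLX k
    | succ m ih =>
      intro k
      have e : (X ^ k * (1 - X) ^ (m + 1) : ℝ[X]) = X ^ k * (1 - X) ^ m - X ^ (k + 1) * (1 - X) ^ m := by ring
      rw [e, map_sub, ih, ih, Function.iterate_succ_apply']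
      simp only [LK.dif]
      push_cast
      rw [add_mul, one_mul]
  obtain ⟨μ, hμ, h⟩ := hausdorff L (fun k m => by
    rw [hL]; exact (hg.iter δ hδ m).cpd.nonneg _ (by positivity))
  exact ⟨μ, hμ, fun k => by rw [h, hLX]⟩

lemma rpow_integrable (μ : Measure unitInterval) [IsFiniteMeasure μ] (s : ℝ) (hs : 0 ≤ s) :
    Integrable (fun x : unitInterval => (x:ℝ) ^ s) μ := by
  have hc : Continuous (fun x : unitInterval => (x:ℝ) ^ s) :=
    (continuous_subtype_val).rpow_const (fun x => Or.inr hs)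
  exact hc.integrable_of_hasCompactSupport (HasCompactSupport.of_compactSpace _)

lemma rpow_continuousAt (μ : Measure unitInterval) [IsFiniteMeasure μ] (s : ℝ) (hs : 0 < s) :
    ContinuousAt (fun s => ∫ x : unitInterval, (x:ℝ) ^ s ∂μ) s := by
  refine continuousAt_of_dominated (bound := fun _ => 1) ?_ ?_ (integrable_const _) ?_
  · filter_upwards [lt_mem_nhds hs] with t ht
    exact (rpow_integrable μ t ht.le).aestronglyMeasurable
  · filter_upwards [lt_mem_nhds hs] with t ht
    refine Eventually.of_forall fun x => ?_
    rw [Real.norm_of_nonneg (Real.rpow_nonneg x.2.1 _)]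
    exact Real.rpow_le_one x.2.1 x.2.2 ht.le
  · exact Eventually.of_forall fun x => Real.continuousAt_const_rpow' hs.ne'

lemma BPD.anti {g : ℝ → ℝ} (hg : BPD g) (x y : ℝ) (hx : 0 ≤ x) (hxy : x ≤ y) : g y ≤ g x := by
  have := (hg.dif (y - x) (by linarith)).cpd.nonneg x hx
  simp only [LK.dif] at this
  rw [add_sub_cancel] at this
  linarith

/-- Representation of bounded positive definite functions on the semigroup. -/
lemma rep_bpd (g : ℝ → ℝ) (hg : BPD g) :
    ∃ μ : Measure unitInterval, IsFiniteMeasure μ ∧ ∀ s : ℝ, 0 ≤ s → ∫ x : unitInterval, (x:ℝ) ^ s ∂μ = g s := by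
  obtain ⟨μ, hμ, h⟩ := moment_of_bpd g hg 1 zero_le_one
  refine ⟨μ, hμ, ?_⟩
  have hdy : ∀ n k : ℕ, ∫ x : unitInterval, (x:ℝ) ^ ((k:ℝ) / 2 ^ n) ∂μ = g (k / 2 ^ n) := by
    intro n k
    obtain ⟨ρ, hρ, h'⟩ := moment_of_bpd g hg ((2 ^ n)⁻¹) (by positivity)
    let φ : unitInterval → unitInterval := fun x => x ^ (2 ^ n)
    have hφ : Continuous φ := by fun_prop
    have e : ρ.map φ = μ := by
      have := Measure.isFiniteMeasure_map ρ φ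
      apply moment_unique
      intro m
      rw [integral_map hφ.aemeasurable (by fun_prop)]
      rw [h]
      have := h' (2 ^ n * m)
      simp only [φ, Set.Icc.coe_pow, ← pow_mul, this]
      congr 1
      push_cast
      field_simp
    rw [← e, integral_map hφ.aemeasurable]
    · rw [div_eq_mul_inv, ← h' k]
      refine integral_congr_ae (Eventually.of_forall fun x => ?_)
      simp only [φ, Set.Icc.coe_pow]
      rw [← Real.rpow_natCast (x:ℝ) (2 ^ n), ← Real.rpow_mul x.2.1, ← Real.rpow_natCast (x:ℝ) k]
      congr 1
      push_cast
      field_simp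
    · exact ((continuous_subtype_val).rpow_const (fun x => Or.inr (by positivity))).aestronglyMeasurable
  intro s hs
  rcases hs.eq_or_lt with rfl | hs
  · simpa using hdy 0 0
  have t2 : Tendsto (fun n : ℕ => (2:ℝ) ^ n) atTop atTop := tendsto_pow_atTop_atTop_of_one_lt one_lt_two
  have tq : Tendsto (fun n : ℕ => (⌊s * 2 ^ n⌋₊ : ℝ) / 2 ^ n) atTop (𝓝 s) :=
    (tendsto_nat_floor_mul_div_atTop hs.le).comp t2
  have tr : Tendsto (fun n : ℕ => ((⌊s * 2 ^ n⌋₊ + 1 : ℕ) : ℝ) / 2 ^ n) atTop (𝓝 s) := by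
    have := tq.add (t2.inv_tendsto_atTop)
    rw [add_zero] at this
    refine this.congr fun n => ?_
    simp only [Pi.inv_apply]
    push_cast
    ring
  have cq := (rpow_continuousAt μ s hs).tendsto.comp tq
  have cr := (rpow_continuousAt μ s hs).tendsto.comp tr
  refine le_antisymm (le_of_tendsto' cr fun n => ?_) (ge_of_tendsto' cq fun n => ?_)
  · simp only [Function.comp]
    rw [hdy]
    refine hg.anti _ _ hs.le ?_
    rw [le_div_iff₀ (by positivity)]
    push_cast
    exact (Nat.lt_floor_add_one _).le
  · simp only [Function.comp]
    rw [hdy]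
    refine hg.anti _ _ (by positivity) ?_
    rw [div_le_iff₀ (by positivity)]
    exact Nat.floor_le (by positivity)

end LK
end

section
namespace LK

open Filter Topology

/-- The map `t ↦ e^{-t}` from `(0,∞)` to `[0,1]`. -/
noncomputable def ee (t : Set.Ioi (0:ℝ)) : unitInterval :=
  ⟨Real.exp (-(t:ℝ)), (Real.exp_pos _).le, Real.exp_le_one_iff.2 (neg_nonpos.2 (le_of_lt t.2))⟩

lemma ee_coe (t : Set.Ioi (0:ℝ)) : (ee t : ℝ) = Real.exp (-(t:ℝ)) := rfl

lemma ee_cont : Continuous ee := by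
  unfold ee; fun_prop

lemma ee_inj : Function.Injective ee := by
  intro s t h
  have h := congrArg Subtype.val h
  simp only [ee_coe] at h
  exact Subtype.ext (neg_injective (Real.exp_injective h))

lemma ee_emb : MeasurableEmbedding ee := by
  have : StandardBorelSpace (Set.Ioi (0:ℝ)) := measurableSet_Ioi.standardBorel
  exact ee_cont.measurable.measurableEmbedding ee_inj

lemma ee_ne_zero (t : Set.Ioi (0:ℝ)) : ee t ≠ 0 := by
  intro h
  have h := congrArg Subtype.val h
  exact (Real.exp_pos _).ne' h

lemma ee_ne_one (t : Set.Ioi (0:ℝ)) : ee t ≠ 1 := by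
  intro h
  have h := congrArg Subtype.val h
  have h2 : Real.exp (-(t:ℝ)) = 1 := h
  rw [Real.exp_eq_one_iff] at h2
  have : (0:ℝ) < t := t.2
  linarith

lemma ee_range : Set.range ee = ({0} ∪ {1})ᶜ := by
  ext x
  constructor
  · rintro ⟨t, rfl⟩ h
    rcases h with h | h
    · exact ee_ne_zero t h
    · exact ee_ne_one t h
  · intro h
    have h0 : (x:ℝ) ≠ 0 := fun hh => h (Or.inl (Subtype.ext hh))
    have h1 : (x:ℝ) ≠ 1 := fun hh => h (Or.inr (Subtype.ext hh))
    have h0' : 0 < (x:ℝ) := lt_of_le_of_ne x.2.1 (Ne.symm h0)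
    have h1' : (x:ℝ) < 1 := lt_of_le_of_ne x.2.2 h1
    refine ⟨⟨-Real.log x, neg_pos.2 (Real.log_neg h0' h1')⟩, Subtype.ext ?_⟩
    simp [ee_coe, Real.exp_log h0']

/-- The density. -/
noncomputable def dn (t : Set.Ioi (0:ℝ)) : ENNReal := ENNReal.ofReal (1 - Real.exp (-(t : ℝ)))

lemma dn_meas : Measurable dn := by unfold dn; fun_prop

lemma dn_pos' (t : Set.Ioi (0:ℝ)) : 0 < 1 - Real.exp (-(t : ℝ)) := by
  have : (0:ℝ) < t := t.2
  rw [sub_pos, Real.exp_lt_one_iff]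
  linarith

lemma dn_ne_zero (t : Set.Ioi (0:ℝ)) : dn t ≠ 0 := by
  rw [dn, ne_eq, ENNReal.ofReal_eq_zero, not_le]; exact dn_pos' t

lemma dn_ne_top (t : Set.Ioi (0:ℝ)) : dn t ≠ ⊤ := ENNReal.ofReal_ne_top

/-- The measure on `[0,1]` attached to a Lévy triple. -/
noncomputable def mm (b c : ℝ) (ν : Measure (Set.Ioi (0:ℝ))) : Measure unitInterval :=
  ENNReal.ofReal b • Measure.dirac 0 + ENNReal.ofReal c • Measure.dirac 1 + (ν.withDensity dn).map ee

lemma mm_finite (b c : ℝ) (ν : Measure (Set.Ioi (0:ℝ))) (h : ∫⁻ t, dn t ∂ν < ⊤) : IsFiniteMeasure (mm b c ν) := by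
  have : IsFiniteMeasure (ν.withDensity dn) := isFiniteMeasure_withDensity h.ne
  have h1 : IsFiniteMeasure (ENNReal.ofReal b • Measure.dirac (0 : unitInterval)) :=
    ⟨by simp⟩
  have h2 : IsFiniteMeasure (ENNReal.ofReal c • Measure.dirac (1 : unitInterval)) :=
    ⟨by simp⟩
  unfold mm
  infer_instance

/-- The right-hand side of the formula. -/
noncomputable def FT (b c : ℝ) (ν : Measure (Set.Ioi (0:ℝ))) (s : ℝ) : ℝ :=
  c * s + (if s = 0 then 0 else b) + ∫ t : Set.Ioi (0 : ℝ), (1 - Real.exp (-(t : ℝ) * s)) ∂ν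

lemma FT_incr (b c : ℝ) (ν : Measure (Set.Ioi (0:ℝ))) (hb : 0 ≤ b) (hc : 0 ≤ c) (h : ∫⁻ t, dn t ∂ν < ⊤)
    (s : ℝ) (hs : 0 ≤ s) : ∫ x : unitInterval, (x:ℝ) ^ s ∂(mm b c ν) = FT b c ν (s + 1) - FT b c ν s := by
  have := mm_finite b c ν h
  have hcont : Continuous (fun x : unitInterval => (x:ℝ) ^ s) :=
    (continuous_subtype_val).rpow_const (fun x => Or.inr hs)
  have hi := rpow_integrable (mm b c ν) s hs
  unfold mm at hi ⊢
  have hi12 := hi.left_of_add_measure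
  rw [integral_add_measure hi12 hi.right_of_add_measure,
    integral_add_measure hi12.left_of_add_measure hi12.right_of_add_measure,
    integral_smul_measure, integral_smul_measure, integral_dirac, integral_dirac,
    integral_map ee_emb.measurable.aemeasurable hcont.aestronglyMeasurable,
    integral_withDensity_eq_integral_toReal_smul dn_meas (Eventually.of_forall fun t => (dn_ne_top t).lt_top)]
  rw [ENNReal.toReal_ofReal hb, ENNReal.toReal_ofReal hc]
  have e : ∫ t : Set.Ioi (0:ℝ), (dn t).toReal • ((ee t : ℝ)) ^ s ∂ν
      = ∫ t : Set.Ioi (0 : ℝ), (1 - Real.exp (-(t : ℝ) * (s + 1))) ∂ν - ∫ t : Set.Ioi (0 : ℝ), (1 - Real.exp (-(t : ℝ) * s)) ∂ν := by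
    rw [← integral_sub (integrable_all ν h _ (by linarith)) (integrable_all ν h _ hs)]
    refine integral_congr_ae (Eventually.of_forall fun t => ?_)
    simp only [dn, ENNReal.toReal_ofReal (dn_pos' t).le, ee_coe, smul_eq_mul]
    rw [← Real.exp_mul, mul_add, Real.exp_add, mul_one]
    ring
  rw [e, FT, FT, if_neg (by linarith : s + 1 ≠ 0)]
  rcases hs.eq_or_lt with rfl | hs'
  · simp; ring
  · rw [if_neg hs'.ne']
    simp [Real.zero_rpow hs'.ne']; ring

lemma mm_surj (μ : Measure unitInterval) [IsFiniteMeasure μ] : ∃ (b c : ℝ) (ν : Measure (Set.Ioi (0:ℝ))),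
    0 ≤ b ∧ 0 ≤ c ∧ ∫⁻ t, dn t ∂ν < ⊤ ∧ mm b c ν = μ := by
  set lam := μ.comap ee
  have hl : (lam.withDensity dn⁻¹).withDensity dn = lam := by
    have := withDensity_inv_same (μ := lam) (f := dn⁻¹) dn_meas.inv
      (Eventually.of_forall fun t => by simpa using dn_ne_top t)
      (Eventually.of_forall fun t => by simpa using dn_ne_zero t)
    simp only [Pi.inv_apply, inv_inv] at this
    exact this
  have hm : lam.map ee = μ.restrict (Set.range ee) := ee_emb.map_comap μ
  refine ⟨μ.real {0}, μ.real {1}, lam.withDensity dn⁻¹, measureReal_nonneg, measureReal_nonneg, ?_, ?_⟩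
  · have : ∫⁻ t, dn t ∂(lam.withDensity dn⁻¹) = lam Set.univ := by
      rw [← hl, withDensity_apply _ MeasurableSet.univ, Measure.restrict_univ, hl]
    rw [this, ← Set.preimage_univ (f := ee), ← Measure.map_apply ee_emb.measurable MeasurableSet.univ, hm]
    exact measure_lt_top _ _
  · rw [mm, hl, hm, ofReal_measureReal, ofReal_measureReal, ← Measure.restrict_singleton, ← Measure.restrict_singleton,
      ← Measure.restrict_union (by simp) (measurableSet_singleton _), ee_range]
    exact Measure.restrict_add_restrict_compl ((measurableSet_singleton _).union (measurableSet_singleton _))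

lemma mm_inj (b₁ c₁ : ℝ) (ν₁ : Measure (Set.Ioi (0:ℝ))) (b₂ c₂ : ℝ) (ν₂ : Measure (Set.Ioi (0:ℝ)))
    (hb₁ : 0 ≤ b₁) (hc₁ : 0 ≤ c₁) (hb₂ : 0 ≤ b₂) (hc₂ : 0 ≤ c₂) (h : mm b₁ c₁ ν₁ = mm b₂ c₂ ν₂) :
    b₁ = b₂ ∧ c₁ = c₂ ∧ ν₁ = ν₂ := by
  have h0 : ∀ b c ν, mm b c ν {0} = ENNReal.ofReal b := by
    intro b c ν
    have : ee ⁻¹' {0} = ∅ := by ext t; simp [ee_ne_zero]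
    simp [mm, Measure.map_apply ee_emb.measurable (measurableSet_singleton _), this]
  have h1 : ∀ b c ν, mm b c ν {1} = ENNReal.ofReal c := by
    intro b c ν
    have : ee ⁻¹' {1} = ∅ := by ext t; simp [ee_ne_one]
    simp [mm, Measure.map_apply ee_emb.measurable (measurableSet_singleton _), this]
  have h2 : ∀ b c ν, ((mm b c ν).comap ee).withDensity dn⁻¹ = ν := by
    intro b c ν
    have : (mm b c ν).comap ee = ν.withDensity dn := by
      ext S hS
      rw [ee_emb.comap_apply, mm]
      have hS' : MeasurableSet (ee '' S) := ee_emb.measurableSet_image.2 hS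
      have n0 : (0 : unitInterval) ∉ ee '' S := by rintro ⟨t, -, ht⟩; exact ee_ne_zero t ht
      have n1 : (1 : unitInterval) ∉ ee '' S := by rintro ⟨t, -, ht⟩; exact ee_ne_one t ht
      rw [Measure.add_apply, Measure.add_apply, Measure.map_apply ee_emb.measurable hS', Set.preimage_image_eq _ ee_inj]
      simp [hS', n0, n1, -Set.mem_image]
    rw [this]
    exact withDensity_inv_same dn_meas (Eventually.of_forall dn_ne_zero) (Eventually.of_forall dn_ne_top)
  refine ⟨?_, ?_, ?_⟩
  · have := h0 b₁ c₁ ν₁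
    rw [h, h0] at this
    exact ((ENNReal.ofReal_eq_ofReal_iff hb₂ hb₁).1 this).symm
  · have := h1 b₁ c₁ ν₁
    rw [h, h1] at this
    exact ((ENNReal.ofReal_eq_ofReal_iff hc₂ hc₁).1 this).symm
  · rw [← h2 b₁ c₁ ν₁, h, h2]

end LK
end

section
namespace LK

open Filter Topology

lemma conc_of_negdef (F : ℝ → ℝ) (hF : CPD True (fun s => - F s)) (h0 : ∀ x, 0 ≤ x → 0 ≤ F x)
    (hz : F 0 = 0) (x d e : ℝ) (hx : 0 ≤ x) (hd : 0 ≤ d) (he : 0 ≤ e) :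
    F (x + d + e) - F (x + d) ≤ F (x + e) - F x := by
  rcases he.eq_or_lt with rfl | he
  · simp
  have hG : CPD True (fun s => - (fun s => F (e * s)) s) := by
    intro ι _ s c hs hc
    have := hF ι (fun i => e * s i) c (fun i => mul_nonneg he.le (hs i)) hc
    simpa only [mul_add] using this
  have := (bpd_of_negdef (fun s => F (e * s)) hG (fun x hx => h0 _ (mul_nonneg he.le hx)) (by simp [hz])).2.2.1
    (x / e) (d / e) (by positivity) (by positivity)
  simp only [mul_add, mul_div_cancel₀ _ he.ne', mul_one] at this
  rwa [add_right_comm] at this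

lemma incr_lim (F : ℝ → ℝ) (hc : ∀ x d e, 0 ≤ x → 0 ≤ d → 0 ≤ e → F (x + d + e) - F (x + d) ≤ F (x + e) - F x)
    (hm : ∀ x d, 0 ≤ x → 0 ≤ d → F x ≤ F (x + d)) (s : ℝ) (hs : 0 ≤ s) :
    ∃ l : ℝ, Tendsto (fun x : ℝ => F (max x 0 + s) - F (max x 0)) atTop (𝓝 l) := by
  refine ⟨_, tendsto_atTop_ciInf ?_ ⟨0, ?_⟩⟩
  · intro x y hxy
    have hxy' : max x 0 ≤ max y 0 := max_le_max_right 0 hxy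
    have := hc (max x 0) (max y 0 - max x 0) s (le_max_right _ _) (sub_nonneg.2 hxy') hs
    rw [add_sub_cancel] at this
    exact this
  · rintro _ ⟨x, rfl⟩
    exact sub_nonneg.2 (hm _ _ (le_max_right _ _) hs)

lemma mean_lim (F : ℝ → ℝ) (hz : F 0 = 0) (s : ℝ) (hs : 0 < s) (l : ℝ)
    (hl : Tendsto (fun x : ℝ => F (max x 0 + s) - F (max x 0)) atTop (𝓝 l)) :
    Tendsto (fun n : ℕ => (n:ℝ)⁻¹ * F (n * s)) atTop (𝓝 l) := by
  have t1 : Tendsto (fun n : ℕ => (n:ℝ) * s) atTop atTop :=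
    tendsto_natCast_atTop_atTop.atTop_mul_const hs
  have t2 := (hl.comp t1).cesaro
  refine t2.congr fun n => ?_
  congr 1
  induction n with
  | zero => simp [hz]
  | succ n ih =>
    rw [Finset.sum_range_succ, ih]
    simp only [Function.comp, max_eq_left (show 0 ≤ (n:ℝ) * s by positivity)]
    push_cast
    rw [add_mul, one_mul]; ring

/-- Two negative definite functions with the same unit increments agree. -/
lemma eq_of_incr (F G : ℝ → ℝ) (hF : CPD True (fun s => - F s)) (hF0 : ∀ x, 0 ≤ x → 0 ≤ F x)
    (hFz : F 0 = 0) (hG : CPD True (fun s => - G s)) (hG0 : ∀ x, 0 ≤ x → 0 ≤ G x)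
    (hGz : G 0 = 0) (hFG : ∀ s, 0 ≤ s → F (s + 1) - F s = G (s + 1) - G s) (s : ℝ) (hs : 0 ≤ s) : F s = G s := by
  rcases hs.eq_or_lt with rfl | hs
  · rw [hFz, hGz]
  have mF := (bpd_of_negdef F hF hF0 hFz).2.1
  have mG := (bpd_of_negdef G hG hG0 hGz).2.1
  obtain ⟨l, hl⟩ := incr_lim F (conc_of_negdef F hF hF0 hFz) mF s hs.le
  obtain ⟨l', hl'⟩ := incr_lim G (conc_of_negdef G hG hG0 hGz) mG s hs.le
  have hper : ∀ (n : ℕ) (x : ℝ), 0 ≤ x → F (n + x) - G (n + x) = F x - G x := by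
    intro n x hx
    induction n with
    | zero => simp
    | succ n ih =>
      have := hFG (n + x) (by positivity)
      push_cast
      rw [show (n:ℝ) + 1 + x = n + x + 1 by ring]
      linarith
  have hbd : ∀ x, 0 ≤ x → |F x - G x| ≤ F 1 + G 1 := by
    intro x hx
    have h1 := hper ⌊x⌋₊ (Int.fract x) (Int.fract_nonneg x)
    rw [natCast_floor_eq_intCast_floor hx, Int.floor_add_fract] at h1
    have f0 := Int.fract_nonneg x
    have f1 := Int.fract_lt_one x
    have a1 := mF (Int.fract x) (1 - Int.fract x) f0 (by linarith)
    have a2 := mG (Int.fract x) (1 - Int.fract x) f0 (by linarith)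
    rw [add_sub_cancel] at a1 a2
    have a3 := hF0 _ f0
    have a4 := hG0 _ f0
    rw [h1, abs_le]
    constructor <;> linarith
  have e1 : l - l' = 0 := by
    have t := (mean_lim F hFz s hs l hl).sub (mean_lim G hGz s hs l' hl')
    refine tendsto_nhds_unique t ?_
    have t0 : Tendsto (fun n : ℕ => (n:ℝ)⁻¹ * (F 1 + G 1)) atTop (𝓝 0) := by
      have := (tendsto_inv_atTop_nhds_zero_nat (𝕜 := ℝ)).mul_const (F 1 + G 1)
      simpa using this
    refine squeeze_zero_norm (fun n => ?_) t0
    rw [← mul_sub, norm_mul, Real.norm_of_nonneg (by positivity)]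
    exact mul_le_mul_of_nonneg_left (hbd _ (by positivity)) (by positivity)
  have t3 := ((hl.comp tendsto_natCast_atTop_atTop).sub (hl'.comp (tendsto_natCast_atTop_atTop (R := ℝ))))
  have t4 : Tendsto (fun _ : ℕ => F s - G s) atTop (𝓝 (l - l')) := by
    refine t3.congr fun n => ?_
    simp only [Function.comp, max_eq_left (Nat.cast_nonneg (α := ℝ) n)]
    have h1 := hper n s hs.le
    have h2 := hper n 0 le_rfl
    rw [add_zero, hFz, hGz] at h2
    linarith
  have := tendsto_nhds_unique t4 tendsto_const_nhds
  linarith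

lemma FT_lpp (p : ℝ) (b c : ℝ) (ν : Measure (Set.Ioi (0:ℝ))) (r : FP) :
    FT b c ν (lppFree p r) = c * lppFree p r + Set.indicator ({1}ᶜ : Set FP) (fun _ => b) r
        + ∫ t : Set.Ioi (0 : ℝ), (1 - Real.exp (-(t : ℝ) * lppFree p r)) ∂ν := by
  rw [FT]
  congr 2
  by_cases h : r = 1
  · simp [h, lpp_one]
  · simp [h, lpp_eq_zero]

lemma exists_lpp (p : ℝ) (hp0 : 0 < p) (s : ℝ) (hs : 0 ≤ s) : ∃ r : FP, lppFree p r = s := by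
  refine ⟨lt 0 (s ^ p⁻¹), ?_⟩
  rw [lpp_lt p hp0, abs_of_nonneg (by positivity), Real.rpow_inv_rpow hs hp0.ne']

lemma negdef_nonneg (ψ : FP → ℝ) (h : IsCondNegDef ψ) (hz : ψ 1 = 0) (g : FP) : 0 ≤ ψ g := by
  have := cnk_of_condNegDef ψ h Bool (fun i => if i then g else 1) (fun i => if i then 1 else -1) (by simp)
  simp [hz, h.1] at this
  linarith

theorem fwd (p : ℝ) (hp0 : 0 < p) (hp2 : p ≤ 2) (ψ : FP → ℝ)
    (F : ℝ → ℝ) (hrad : ∀ r : FP, ψ r = F (lppFree p r)) (hzero : ψ 1 = 0) (h : IsCondNegDef ψ) :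
    ∃ (b c : ℝ) (ν : Measure (Set.Ioi (0 : ℝ))), 0 ≤ b ∧ 0 ≤ c ∧
      (∫⁻ t : Set.Ioi (0 : ℝ), ENNReal.ofReal (1 - Real.exp (-(t : ℝ))) ∂ν) < ⊤ ∧
      ∀ r : FP, ψ r = c * lppFree p r + Set.indicator ({1}ᶜ : Set FP) (fun _ => b) r
        + ∫ t : Set.Ioi (0 : ℝ), (1 - Real.exp (-(t : ℝ) * lppFree p r)) ∂ν := by
  have key : ∀ (χ : FP → ℝ) (F : ℝ → ℝ), (∀ r : FP, χ r = F (lppFree p r)) → χ 1 = 0 → IsCondNegDef χ →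
      CPD True (fun s => - F s) ∧ (∀ x, 0 ≤ x → 0 ≤ F x) ∧ F 0 = 0 := by
    intro χ F hrad hzero h
    refine ⟨cpd_of_cnk p hp0 F ?_, ?_, ?_⟩
    · have := cnk_of_condNegDef χ h
      simpa only [hrad] using this
    · intro x hx
      obtain ⟨r, rfl⟩ := exists_lpp p hp0 x hx
      rw [← hrad]
      exact negdef_nonneg χ h hzero r
    · have := hrad 1
      rw [hzero, lpp_one] at this
      exact this.symm
  obtain ⟨hF, hF0, hFz⟩ := key ψ F hrad hzero h
  obtain ⟨μ, hμ, hrep⟩ := rep_bpd _ (bpd_of_negdef F hF hF0 hFz).1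
  obtain ⟨b, c, ν, hb, hc, hν, rfl⟩ := mm_surj μ
  refine ⟨b, c, ν, hb, hc, hν, ?_⟩
  have hχ := (bwd p hp0 hp2 (fun r => FT b c ν (lppFree p r)) b c ν hb hc hν (FT_lpp p b c ν)).1
  obtain ⟨hG, hG0, hGz⟩ := key _ (FT b c ν) (fun r => rfl) (by simp [lpp_one, FT]) hχ
  intro r
  rw [← FT_lpp, hrad]
  refine eq_of_incr F (FT b c ν) hF hF0 hFz hG hG0 hGz (fun s hs => ?_) _ (lpp_nonneg p r)
  rw [← FT_incr b c ν hb hc hν s hs, hrep s hs]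

theorem uniq (p : ℝ) (hp0 : 0 < p) (ψ : FP → ℝ)
    (b₁ c₁ : ℝ) (ν₁ : Measure (Set.Ioi (0 : ℝ))) (b₂ c₂ : ℝ) (ν₂ : Measure (Set.Ioi (0 : ℝ)))
    (hb₁ : 0 ≤ b₁) (hc₁ : 0 ≤ c₁)
    (hν₁ : (∫⁻ t : Set.Ioi (0 : ℝ), ENNReal.ofReal (1 - Real.exp (-(t : ℝ))) ∂ν₁) < ⊤)
    (hb₂ : 0 ≤ b₂) (hc₂ : 0 ≤ c₂)
    (hν₂ : (∫⁻ t : Set.Ioi (0 : ℝ), ENNReal.ofReal (1 - Real.exp (-(t : ℝ))) ∂ν₂) < ⊤)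
    (h₁ : ∀ r : FP, ψ r = c₁ * lppFree p r + Set.indicator ({1}ᶜ : Set FP) (fun _ => b₁) r
        + ∫ t : Set.Ioi (0 : ℝ), (1 - Real.exp (-(t : ℝ) * lppFree p r)) ∂ν₁)
    (h₂ : ∀ r : FP, ψ r = c₂ * lppFree p r + Set.indicator ({1}ᶜ : Set FP) (fun _ => b₂) r
        + ∫ t : Set.Ioi (0 : ℝ), (1 - Real.exp (-(t : ℝ) * lppFree p r)) ∂ν₂) :
    b₁ = b₂ ∧ c₁ = c₂ ∧ ν₁ = ν₂ := by
  have hFT : ∀ s, 0 ≤ s → FT b₁ c₁ ν₁ s = FT b₂ c₂ ν₂ s := by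
    intro s hs
    obtain ⟨r, rfl⟩ := exists_lpp p hp0 s hs
    rw [FT_lpp, FT_lpp, ← h₁, ← h₂]
  have i₁ := mm_finite b₁ c₁ ν₁ hν₁
  have i₂ := mm_finite b₂ c₂ ν₂ hν₂
  apply mm_inj _ _ _ _ _ _ hb₁ hc₁ hb₂ hc₂
  apply moment_unique
  intro m
  have e₁ := FT_incr b₁ c₁ ν₁ hb₁ hc₁ hν₁ m (by positivity)
  have e₂ := FT_incr b₂ c₂ ν₂ hb₂ hc₂ hν₂ m (by positivity)
  simp only [Real.rpow_natCast] at e₁ e₂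
  rw [e₁, e₂, hFT _ (by positivity), hFT _ (by positivity)]

end LK
end

/-- Lévy–Khintchine formula on `ℝ_∞`: a radial (w.r.t. `‖·‖_p^p`, `0 < p ≤ 2`) function
`ψ` with `ψ(e) = 0` is conditionally negative definite and bounded below iff
`ψ(r) = c‖r‖_p^p + b·χ_{ℝ_∞∖{e}}(r) + ∫_0^∞ (1 − e^{−t‖r‖_p^p}) dν(t)` for some
`b, c ≥ 0` and a positive Borel measure `ν` on `(0,∞)` with `∫_0^∞ (1 − e^{−t}) dν < ∞`;
moreover `b`, `c`, `ν` are then uniquely determined by `ψ`. -/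
theorem condNegDef_iff_levyKhintchine_lppFree
    (p : ℝ) (hp0 : 0 < p) (hp2 : p ≤ 2)
    (ψ : Monoid.CoprodI (fun _ : ℕ => Multiplicative ℝ) → ℝ)
    (hrad : ∃ ψdot : ℝ → ℝ,
      ∀ r : Monoid.CoprodI (fun _ : ℕ => Multiplicative ℝ), ψ r = ψdot (lppFree p r))
    (hzero : ψ 1 = 0) :
    ((IsCondNegDef ψ ∧ BddBelow (Set.range ψ)) ↔
      ∃ (b c : ℝ) (ν : Measure (Set.Ioi (0 : ℝ))), 0 ≤ b ∧ 0 ≤ c ∧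
        (∫⁻ t : Set.Ioi (0 : ℝ), ENNReal.ofReal (1 - Real.exp (-(t : ℝ))) ∂ν) < ⊤ ∧
        ∀ r : Monoid.CoprodI (fun _ : ℕ => Multiplicative ℝ),
          ψ r = c * lppFree p r
            + Set.indicator ({1}ᶜ : Set (Monoid.CoprodI (fun _ : ℕ => Multiplicative ℝ)))
                (fun _ => b) r
            + ∫ t : Set.Ioi (0 : ℝ), (1 - Real.exp (-(t : ℝ) * lppFree p r)) ∂ν) ∧
    ∀ (b₁ c₁ : ℝ) (ν₁ : Measure (Set.Ioi (0 : ℝ))) (b₂ c₂ : ℝ)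
        (ν₂ : Measure (Set.Ioi (0 : ℝ))),
      0 ≤ b₁ → 0 ≤ c₁ →
      (∫⁻ t : Set.Ioi (0 : ℝ), ENNReal.ofReal (1 - Real.exp (-(t : ℝ))) ∂ν₁) < ⊤ →
      0 ≤ b₂ → 0 ≤ c₂ →
      (∫⁻ t : Set.Ioi (0 : ℝ), ENNReal.ofReal (1 - Real.exp (-(t : ℝ))) ∂ν₂) < ⊤ →
      (∀ r : Monoid.CoprodI (fun _ : ℕ => Multiplicative ℝ),
        ψ r = c₁ * lppFree p r
          + Set.indicator ({1}ᶜ : Set (Monoid.CoprodI (fun _ : ℕ => Multiplicative ℝ)))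
              (fun _ => b₁) r
          + ∫ t : Set.Ioi (0 : ℝ), (1 - Real.exp (-(t : ℝ) * lppFree p r)) ∂ν₁) →
      (∀ r : Monoid.CoprodI (fun _ : ℕ => Multiplicative ℝ),
        ψ r = c₂ * lppFree p r
          + Set.indicator ({1}ᶜ : Set (Monoid.CoprodI (fun _ : ℕ => Multiplicative ℝ)))
              (fun _ => b₂) r
          + ∫ t : Set.Ioi (0 : ℝ), (1 - Real.exp (-(t : ℝ) * lppFree p r)) ∂ν₂) →
      b₁ = b₂ ∧ c₁ = c₂ ∧ ν₁ = ν₂ := by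
  obtain ⟨F, hF⟩ := hrad
  refine ⟨⟨fun h => LK.fwd p hp0 hp2 ψ F hF hzero h.1, ?_⟩, ?_⟩
  · rintro ⟨b, c, ν, hb, hc, hν, h⟩
    exact LK.bwd p hp0 hp2 ψ b c ν hb hc hν h
  · intro b₁ c₁ ν₁ b₂ c₂ ν₂ hb₁ hc₁ hν₁ hb₂ hc₂ hν₂ h₁ h₂
    exact LK.uniq p hp0 ψ b₁ c₁ ν₁ b₂ c₂ ν₂ hb₁ hc₁ hν₁ hb₂ hc₂ hν₂ h₁ h₂
end

section
/- Fix 0 < p ≤ 2 and let ℝ^{(ℕ)} be the additive group of finitely supported real sequences. Then for every t > 0, the function φ : ℝ^{(ℕ)} → ℝ defined by φ(r) := e^{−t ‖r‖_p^p}, where ‖r‖_p^p = ∑_n |r_n|^p, is positive definite on ℝ^{(ℕ)}. -/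
open ComplexOrder

/-- The `p`-th power ℓ^p length `‖r‖_p^p = ∑ n |r n|^p` of a finitely supported real
sequence. -/
noncomputable def lppFinsupp (p : ℝ) (r : ℕ →₀ ℝ) : ℝ :=
  ∑ n ∈ r.support, |r n| ^ p

/-- A real-valued function on an additive group is positive definite. -/
def IsPositiveDefiniteAdd {G : Type*} [AddGroup G] (φ : G → ℝ) : Prop :=
  ∀ (n : ℕ) (x : Fin n → G) (c : Fin n → ℂ),
    0 ≤ ∑ j, ∑ k, c j * (starRingEnd ℂ) (c k) * (φ (x k - x j) : ℂ)

/-- The quadratic form of a real kernel is nonnegative and the kernel is symmetric. -/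
def KerPSD {n : ℕ} (K : Fin n → Fin n → ℝ) : Prop :=
  (∀ i j, K i j = K j i) ∧ ∀ c : Fin n → ℝ, 0 ≤ ∑ i, ∑ j, c i * c j * K i j

theorem KerPSD.toMatrix {n : ℕ} {K : Fin n → Fin n → ℝ} (h : KerPSD K) :
    (Matrix.of K).PosSemidef := by
  rw [Matrix.posSemidef_iff_dotProduct_mulVec]
  refine ⟨?_, fun c => ?_⟩
  · ext i j
    simp [h.1 j i]
  · have := h.2 c
    simp only [dotProduct, Matrix.mulVec, Finset.mul_sum, Matrix.of_apply]
    refine this.trans_eq ?_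
    refine Finset.sum_congr rfl fun i _ => Finset.sum_congr rfl fun j _ => ?_
    simp
    ring

theorem KerPSD.ofMatrix {n : ℕ} {K : Fin n → Fin n → ℝ} (h : (Matrix.of K).PosSemidef) :
    KerPSD K := by
  rw [Matrix.posSemidef_iff_dotProduct_mulVec] at h
  refine ⟨fun i j => ?_, fun c => ?_⟩
  · have := h.1.apply j i
    simpa using this
  · have := h.2 c
    simp only [dotProduct, Matrix.mulVec, Finset.mul_sum, Matrix.of_apply] at this
    refine this.trans_eq ?_
    refine Finset.sum_congr rfl fun i _ => Finset.sum_congr rfl fun j _ => ?_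
    simp
    ring

theorem KerPSD.mul {n : ℕ} {K L : Fin n → Fin n → ℝ} (hK : KerPSD K) (hL : KerPSD L) :
    KerPSD (fun i j => K i j * L i j) :=
  KerPSD.ofMatrix (hK.toMatrix.hadamard hL.toMatrix)

theorem KerPSD.rankOne {n : ℕ} (f : Fin n → ℝ) : KerPSD (fun i j => f i * f j) := by
  refine ⟨fun i j => mul_comm _ _, fun c => ?_⟩
  have : ∑ i, ∑ j, c i * c j * (f i * f j) = (∑ i, c i * f i) ^ 2 := by
    rw [sq, Finset.sum_mul_sum]
    refine Finset.sum_congr rfl fun i _ => Finset.sum_congr rfl fun j _ => ?_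
    ring
  rw [this]
  positivity

theorem KerPSD.pow {n : ℕ} {K : Fin n → Fin n → ℝ} (hK : KerPSD K) (m : ℕ) :
    KerPSD (fun i j => K i j ^ m) := by
  induction m with
  | zero => simpa using KerPSD.rankOne (n := n) (fun _ => 1)
  | succ m ih => simpa only [pow_succ] using ih.mul hK

theorem KerPSD.exp {n : ℕ} {K : Fin n → Fin n → ℝ} (hK : KerPSD K) :
    KerPSD (fun i j => Real.exp (K i j)) := by
  refine ⟨fun i j => by simp only [hK.1 i j], fun c => ?_⟩
  have h : HasSum (fun m : ℕ => ∑ i, ∑ j, c i * c j * (K i j ^ m / (m.factorial : ℝ)))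
      (∑ i, ∑ j, c i * c j * Real.exp (K i j)) := by
    refine hasSum_sum fun i _ => hasSum_sum fun j _ => HasSum.mul_left _ ?_
    rw [Real.exp_eq_exp_ℝ]
    exact NormedSpace.expSeries_div_hasSum_exp (K i j)
  refine h.nonneg fun m => ?_
  have h2 := (hK.pow m).2 c
  have : ∑ i, ∑ j, c i * c j * (K i j ^ m / (m.factorial : ℝ))
      = (∑ i, ∑ j, c i * c j * K i j ^ m) / (m.factorial : ℝ) := by
    simp only [Finset.sum_div, mul_div_assoc]
  rw [this]
  positivity

theorem KerPSD.sum {n : ℕ} {ι : Type*} (S : Finset ι) {K : ι → Fin n → Fin n → ℝ}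
    (hK : ∀ s ∈ S, KerPSD (K s)) : KerPSD (fun i j => ∑ s ∈ S, K s i j) := by
  refine ⟨fun i j => Finset.sum_congr rfl fun s hs => (hK s hs).1 i j, fun c => ?_⟩
  have : ∑ i, ∑ j, c i * c j * ∑ s ∈ S, K s i j
      = ∑ s ∈ S, ∑ i, ∑ j, c i * c j * K s i j := by
    rw [Finset.sum_comm (s := S)]
    refine Finset.sum_congr rfl fun i _ => ?_
    rw [Finset.sum_comm (s := S)]
    refine Finset.sum_congr rfl fun j _ => ?_
    rw [Finset.mul_sum]
  rw [this]
  exact Finset.sum_nonneg fun s hs => (hK s hs).2 c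

theorem KerPSD.smul {n : ℕ} {K : Fin n → Fin n → ℝ} (hK : KerPSD K) {t : ℝ} (ht : 0 ≤ t) :
    KerPSD (fun i j => t * K i j) := by
  refine ⟨fun i j => by simp only [hK.1 i j], fun c => ?_⟩
  have : ∑ i, ∑ j, c i * c j * (t * K i j) = t * ∑ i, ∑ j, c i * c j * K i j := by
    simp only [Finset.mul_sum]
    refine Finset.sum_congr rfl fun i _ => Finset.sum_congr rfl fun j _ => ?_
    ring
  rw [this]
  exact mul_nonneg ht (hK.2 c)

open MeasureTheory Set in
theorem integrable_aux {p : ℝ} (hp0 : 0 < p) (hp2 : p < 2) :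
    IntegrableOn (fun u : ℝ => (1 - Real.cos u) * u ^ (-1 - p)) (Ioi 0) := by
  have hcont : ContinuousOn (fun u : ℝ => (1 - Real.cos u) * u ^ (-1 - p)) (Ioi 0) := by
    refine ContinuousOn.mul (by fun_prop) ?_
    exact fun u hu => (Real.continuousAt_rpow_const u _ (Or.inl (ne_of_gt hu))).continuousWithinAt
  rw [← Ioc_union_Ioi_eq_Ioi (zero_le_one (α := ℝ))]
  refine IntegrableOn.union ?_ ?_
  · have h1 : IntegrableOn (fun u : ℝ => u ^ (1 - p)) (Ioc 0 1) := by
      rw [← intervalIntegrable_iff_integrableOn_Ioc_of_le zero_le_one]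
      exact intervalIntegral.intervalIntegrable_rpow' (by linarith)
    refine Integrable.mono' h1
      ((hcont.mono Ioc_subset_Ioi_self).aestronglyMeasurable measurableSet_Ioc) ?_
    filter_upwards [ae_restrict_mem measurableSet_Ioc] with u hu
    have hu0 : 0 < u := hu.1
    have hc := Real.cos_le_one u
    have hc2 := Real.one_sub_sq_div_two_le_cos (x := u)
    have hr : 0 < u ^ (-1 - p) := Real.rpow_pos_of_pos hu0 _
    rw [Real.norm_of_nonneg (mul_nonneg (by linarith) hr.le)]
    have : u ^ (1 - p) = u ^ 2 * u ^ (-1 - p) := by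
      rw [← Real.rpow_natCast, ← Real.rpow_add hu0]
      congr 1
      push_cast
      ring
    rw [this]
    refine mul_le_mul_of_nonneg_right ?_ hr.le
    nlinarith [sq_nonneg u]
  · have h1 : IntegrableOn (fun u : ℝ => 2 * u ^ (-1 - p)) (Ioi 1) :=
      (integrableOn_Ioi_rpow_of_lt (by linarith) zero_lt_one).const_mul 2
    refine Integrable.mono' h1
      ((hcont.mono (Ioi_subset_Ioi zero_le_one)).aestronglyMeasurable measurableSet_Ioi) ?_
    filter_upwards [ae_restrict_mem measurableSet_Ioi] with u hu
    have hu0 : 0 < u := lt_trans zero_lt_one hu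
    have hc := Real.cos_le_one u
    have hc2 := Real.neg_one_le_cos u
    have hr : 0 < u ^ (-1 - p) := Real.rpow_pos_of_pos hu0 _
    rw [Real.norm_of_nonneg (mul_nonneg (by linarith) hr.le)]
    exact mul_le_mul_of_nonneg_right (by linarith) hr.le

open MeasureTheory Set in
theorem const_pos_aux {p : ℝ} (hp0 : 0 < p) (hp2 : p < 2) :
    0 < ∫ u in Ioi (0 : ℝ), (1 - Real.cos u) * u ^ (-1 - p) := by
  rw [setIntegral_pos_iff_support_of_nonneg_ae _ (integrable_aux hp0 hp2)]
  · have hsub : Ioo (0 : ℝ) 1 ⊆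
        Function.support (fun u : ℝ => (1 - Real.cos u) * u ^ (-1 - p)) ∩ Ioi 0 := by
      intro u hu
      refine ⟨?_, hu.1⟩
      have h1 : Real.cos u < Real.cos 0 :=
        Real.cos_lt_cos_of_nonneg_of_le_pi le_rfl (by linarith [hu.2, Real.pi_gt_three]) hu.1
      rw [Real.cos_zero] at h1
      exact (mul_pos (by linarith) (Real.rpow_pos_of_pos hu.1 _)).ne'
    refine lt_of_lt_of_le ?_ (measure_mono hsub)
    simp
  · filter_upwards [ae_restrict_mem measurableSet_Ioi] with u hu
    exact mul_nonneg (by linarith [Real.cos_le_one u]) (Real.rpow_nonneg (le_of_lt hu) _)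

open MeasureTheory Set in
theorem scale_aux {p : ℝ} (hp0 : 0 < p) (hp2 : p < 2) (y : ℝ) :
    IntegrableOn (fun u : ℝ => (1 - Real.cos (u * y)) * u ^ (-1 - p)) (Ioi 0) ∧
    ∫ u in Ioi (0 : ℝ), (1 - Real.cos (u * y)) * u ^ (-1 - p)
      = |y| ^ p * ∫ u in Ioi (0 : ℝ), (1 - Real.cos u) * u ^ (-1 - p) := by
  rcases eq_or_ne y 0 with rfl | hy
  · simp [Real.zero_rpow hp0.ne']
  have ha : 0 < |y| := abs_pos.mpr hy
  have heq : EqOn (fun u : ℝ => (1 - Real.cos (u * y)) * u ^ (-1 - p))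
      (fun u : ℝ => |y| ^ (1 + p) * ((1 - Real.cos (|y| * u)) * (|y| * u) ^ (-1 - p)))
      (Ioi 0) := by
    intro u hu
    have hu0 : (0 : ℝ) < u := hu
    have h1 : Real.cos (u * y) = Real.cos (|y| * u) := by
      rw [← Real.cos_abs (u * y), abs_mul, abs_of_pos hu0, mul_comm]
    have h2 : |y| ^ (1 + p) * |y| ^ (-1 - p) = 1 := by
      rw [← Real.rpow_add ha]
      simp
    simp only
    rw [h1, Real.mul_rpow ha.le hu0.le]
    linear_combination (-(1 - Real.cos (|y| * u)) * u ^ (-1 - p)) * h2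
  constructor
  · rw [integrableOn_congr_fun heq measurableSet_Ioi]
    refine Integrable.const_mul ?_ _
    have := (integrableOn_Ioi_comp_mul_left_iff
      (fun u : ℝ => (1 - Real.cos u) * u ^ (-1 - p)) 0 ha).2
      (by simpa using integrable_aux hp0 hp2)
    exact this
  · rw [setIntegral_congr_fun measurableSet_Ioi heq, integral_const_mul,
      integral_comp_mul_left_Ioi (fun u : ℝ => (1 - Real.cos u) * u ^ (-1 - p)) 0 ha]
    rw [mul_zero, smul_eq_mul, ← mul_assoc, ← Real.rpow_neg_one, ← Real.rpow_add ha]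
    congr 2
    ring

open MeasureTheory Set in
theorem KerPSD.abs_rpow {n : ℕ} {p : ℝ} (hp0 : 0 < p) (hp2 : p ≤ 2) (y : Fin n → ℝ) :
    KerPSD (fun i j => |y i| ^ p + |y j| ^ p - |y j - y i| ^ p) := by
  rcases hp2.eq_or_lt with rfl | hp2
  · have := (KerPSD.rankOne y).smul (zero_le_two)
    convert this using 3 with i j
    simp only [Real.rpow_two, sq_abs]
    ring
  refine ⟨fun i j => by simp only [abs_sub_comm (y j)]; ring, fun c => ?_⟩
  have hC := const_pos_aux hp0 hp2
  set C := ∫ u in Ioi (0 : ℝ), (1 - Real.cos u) * u ^ (-1 - p) with hCdef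
  refine nonneg_of_mul_nonneg_left ?_ hC
  let F : ℝ → ℝ → ℝ := fun y u => (1 - Real.cos (u * y)) * u ^ (-1 - p)
  have hF : ∀ y, IntegrableOn (F y) (Ioi 0) := fun y => (scale_aux hp0 hp2 y).1
  have hI : ∀ y, ∫ u in Ioi (0 : ℝ), F y u = |y| ^ p * C := fun y => (scale_aux hp0 hp2 y).2
  have key : (∑ i, ∑ j, c i * c j * (|y i| ^ p + |y j| ^ p - |y j - y i| ^ p)) * C
      = ∫ u in Ioi (0 : ℝ), ∑ i, ∑ j, c i * c j * (F (y i) u + F (y j) u - F (y j - y i) u) := by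
    have hint : ∀ i j, IntegrableOn
        (fun u => c i * c j * (F (y i) u + F (y j) u - F (y j - y i) u)) (Ioi 0) :=
      fun i j => (((hF (y i)).add (hF (y j))).sub (hF (y j - y i))).const_mul _
    rw [integral_finsetSum _ fun i _ => integrable_finsetSum _ fun j _ => hint i j]
    rw [Finset.sum_mul]
    refine Finset.sum_congr rfl fun i _ => ?_
    rw [integral_finsetSum _ fun j _ => hint i j, Finset.sum_mul]
    refine Finset.sum_congr rfl fun j _ => ?_
    rw [integral_const_mul, integral_sub (f := fun u => F (y i) u + F (y j) u) ((hF (y i)).add (hF (y j))) (hF (y j - y i)),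
      integral_add (hF (y i)) (hF (y j)), hI, hI, hI]
    ring
  rw [key]
  refine setIntegral_nonneg measurableSet_Ioi fun u hu => ?_
  have hr : 0 ≤ u ^ (-1 - p) := Real.rpow_nonneg (le_of_lt hu) _
  have : ∑ i, ∑ j, c i * c j * (F (y i) u + F (y j) u - F (y j - y i) u)
      = ((∑ i, c i * (1 - Real.cos (u * y i))) ^ 2 + (∑ i, c i * Real.sin (u * y i)) ^ 2)
        * u ^ (-1 - p) := by
    rw [sq, sq, Finset.sum_mul_sum, Finset.sum_mul_sum, ← Finset.sum_add_distrib, Finset.sum_mul]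
    refine Finset.sum_congr rfl fun i _ => ?_
    rw [← Finset.sum_add_distrib, Finset.sum_mul]
    refine Finset.sum_congr rfl fun j _ => ?_
    simp only [F]
    rw [mul_sub u, Real.cos_sub]
    ring
  rw [this]
  positivity

theorem lppFinsupp_eq {p : ℝ} (hp0 : 0 < p) (r : ℕ →₀ ℝ) {S : Finset ℕ} (h : r.support ⊆ S) :
    lppFinsupp p r = ∑ m ∈ S, |r m| ^ p := by
  refine Finset.sum_subset h fun m _ hm => ?_
  rw [Finsupp.notMem_support_iff.mp hm, abs_zero, Real.zero_rpow hp0.ne']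

theorem KerPSD.complex {n : ℕ} {K : Fin n → Fin n → ℝ} (hK : KerPSD K) (c : Fin n → ℂ) :
    0 ≤ ∑ j, ∑ k, c j * (starRingEnd ℂ) (c k) * (K j k : ℂ) := by
  rw [Complex.nonneg_iff]
  constructor
  · have h := add_nonneg (hK.2 fun i => (c i).re) (hK.2 fun i => (c i).im)
    refine h.trans_eq ?_
    simp only [Complex.re_sum, ← Finset.sum_add_distrib]
    refine Finset.sum_congr rfl fun i _ => Finset.sum_congr rfl fun j _ => ?_
    simp
    ring
  · have h1 : ∀ j k, (c j * (starRingEnd ℂ) (c k) * (K j k : ℂ)).im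
        = (c j).im * (c k).re * K j k - (c k).im * (c j).re * K k j := by
      intro j k
      rw [hK.1 k j]
      simp
      ring
    simp only [Complex.im_sum, h1, Finset.sum_sub_distrib]
    rw [Finset.sum_comm (f := fun j k => (c k).im * (c j).re * K k j), sub_self]

/-- For `0 < p ≤ 2` and every `t > 0`, the function `r ↦ e^{−t‖r‖_p^p}` is positive
definite on the additive group `ℝ^{(ℕ)}` of finitely supported real sequences. -/
theorem exp_neg_lppFinsupp_posDef
    (p : ℝ) (hp0 : 0 < p) (hp2 : p ≤ 2) (t : ℝ) (ht : 0 < t) :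
    IsPositiveDefiniteAdd (fun r : ℕ →₀ ℝ => Real.exp (-t * lppFinsupp p r)) := by
  intro n x c
  refine KerPSD.complex (K := fun j k => Real.exp (-t * lppFinsupp p (x k - x j))) ?_ c
  classical
  let S : Finset ℕ := Finset.univ.biUnion fun i => (x i).support
  have hS : ∀ i, (x i).support ⊆ S := fun i =>
    Finset.subset_biUnion_of_mem (fun i => (x i).support) (Finset.mem_univ i)
  have h1 := ((KerPSD.sum S fun m _ => KerPSD.abs_rpow hp0 hp2 fun i => x i m).smul ht.le).exp
  have h2 := (KerPSD.rankOne fun i => Real.exp (-t * lppFinsupp p (x i))).mul h1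
  convert h2 using 3 with i j
  rw [← Real.exp_add, ← Real.exp_add, lppFinsupp_eq hp0 _ (hS i), lppFinsupp_eq hp0 _ (hS j),
    lppFinsupp_eq hp0 (x j - x i)
      (Finsupp.support_sub.trans (Finset.union_subset (hS j) (hS i)))]
  simp only [Finset.sum_sub_distrib, Finset.sum_add_distrib, Finsupp.sub_apply]
  congr 1
  ring
end
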